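/- arXiv:2303.17435 — 6 statements merged into one kernel-verified Lean document; each statement's English description precedes it below -/
import Mathlib

section
/- Let F be an algebraically closed field and n ≥ 2. Let N be a normal subset of SL_n(F) that contains a regular semisimple element, i.e., a matrix s whose characteristic polynomial has n distinct roots in F. Then N·N·N = SL_n(F). -/
open Pointwise

open Polynomial in
/-- `A` is a product of two matrices with characteristic polynomials `p` and `q`. -/
def Matrix.FactorsWithCharpolys {m R : Type*} [Fintype m] [DecidableEq m] [CommRing R]
    (A : Matrix m m R) (p q : R[X]) : Prop :=
  ∃ B C : Matrix m m R, A = B * C ∧ B.charpoly = p ∧ C.charpoly = q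

namespace Matrix.FactorsWithCharpolys

open Polynomial

theorem of_conj {m R : Type*} [Fintype m] [DecidableEq m] [CommRing R]
    {A : Matrix m m R} {p q : R[X]} (P : (Matrix m m R)ˣ)
    (h : (P.val * A * P⁻¹.val).FactorsWithCharpolys p q) : A.FactorsWithCharpolys p q := by
  obtain ⟨B, C, hBC, rfl, rfl⟩ := h
  refine ⟨P⁻¹.val * B * P.val, P⁻¹.val * C * P.val, ?_, by simp, by simp⟩
  calc A = P⁻¹.val * (P.val * A * P⁻¹.val) * P.val := by simp [mul_assoc]
    _ = _ := by rw [hBC]; simp [mul_assoc]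

theorem of_toMatrix {m m' K V : Type*} [Fintype m] [DecidableEq m] [Fintype m'] [DecidableEq m']
    [Field K] [AddCommGroup V] [Module K V] {p q : K[X]} {f : Module.End K V}
    (b : Module.Basis m K V) (b' : Module.Basis m' K V)
    (h : (LinearMap.toMatrix b b f).FactorsWithCharpolys p q) :
    (LinearMap.toMatrix b' b' f).FactorsWithCharpolys p q := by
  have := b.finiteDimensional_of_finite
  obtain ⟨B, C, hBC, rfl, rfl⟩ := h
  refine ⟨LinearMap.toMatrix b' b' (toLin b b B), LinearMap.toMatrix b' b' (toLin b b C),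
    ?_, ?_, ?_⟩
  · rw [← LinearMap.toMatrix_mul]
    congr 1
    apply (LinearMap.toMatrix b b).injective
    rw [LinearMap.toMatrix_mul, LinearMap.toMatrix_toLin, LinearMap.toMatrix_toLin, hBC]
  · rw [LinearMap.charpoly_toMatrix, ← LinearMap.charpoly_toMatrix _ b, LinearMap.toMatrix_toLin]
  · rw [LinearMap.charpoly_toMatrix, ← LinearMap.charpoly_toMatrix _ b, LinearMap.toMatrix_toLin]

theorem fromBlocks {m K : Type*} [Fintype m] [DecidableEq m] [Field K] {p q : K[X]} {β γ : K}
    (hβ : β ≠ 0) (hγ : γ ≠ 0) (y : Matrix Unit m K) (z : Matrix m Unit K) (R : Matrix m m K)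
    (h : (R - (β * γ)⁻¹ • (z * y)).FactorsWithCharpolys p q) :
    (Matrix.fromBlocks ((β * γ) • 1) y z R).FactorsWithCharpolys
      ((X - C β) * p) ((X - C γ) * q) := by
  obtain ⟨B, D, hBD, rfl, rfl⟩ := h
  refine ⟨Matrix.fromBlocks (β • 1) 0 (γ⁻¹ • z) B, Matrix.fromBlocks (γ • 1) (β⁻¹ • y) 0 D,
    ?_, ?_, ?_⟩
  · rw [fromBlocks_multiply, ← hBD]
    congr 1
    · simp [smul_smul, mul_comm]
    · simp [smul_smul, hβ]
    · simp [smul_smul, hγ]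
    · simp [smul_smul, mul_comm]
  · rw [charpoly_fromBlocks_zero₁₂]
    congr 1
    simp [charpoly, charmatrix]
  · rw [charpoly_fromBlocks_zero₂₁]
    congr 1
    simp [charpoly, charmatrix]

end Matrix.FactorsWithCharpolys

namespace Matrix

theorem det_fromBlocks_smul_one {m K : Type*} [Fintype m] [DecidableEq m] [Field K] {c : K}
    (hc : c ≠ 0) (y : Matrix Unit m K) (z : Matrix m Unit K) (R : Matrix m m K) :
    (fromBlocks (c • 1) y z R).det = c * (R - c⁻¹ • (z * y)).det := by
  have : fromBlocks (c • 1) y z R =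
      fromBlocks 1 0 (c⁻¹ • z) 1 * fromBlocks (c • 1) y 0 (R - c⁻¹ • (z * y)) := by
    simp [fromBlocks_multiply, smul_smul, hc]
  rw [this, det_mul, det_fromBlocks_zero₁₂, det_fromBlocks_zero₂₁]
  simp

/-- A nonzero column is annihilated by some nonzero row, in dimension at least two. -/
theorem exists_row_ne_zero_mul_eq_zero {m K : Type*} [Fintype m] [DecidableEq m] [Nontrivial m]
    [Field K] {z : Matrix m Unit K} (hz : z ≠ 0) : ∃ w : Matrix Unit m K, w ≠ 0 ∧ w * z = 0 := by
  obtain ⟨i, hi⟩ : ∃ i, z i () ≠ 0 := by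
    contrapose! hz
    ext i j
    exact hz i
  obtain ⟨j, hj⟩ := exists_ne i
  refine ⟨single () i (z j ()) - single () j (z i ()), fun h ↦ hi ?_, ?_⟩
  · simpa [single_apply, hj.symm] using congrFun₂ h () j
  · ext a b
    simp [Matrix.sub_mul, mul_comm]

/-- A scalar matrix minus a nonzero square-zero rank one matrix is not scalar. -/
theorem sub_smul_col_mul_row_ne_smul_one {m K : Type*} [Fintype m] [DecidableEq m] [Field K]
    {z : Matrix m Unit K} {w : Matrix Unit m K} (hz : z ≠ 0) (hw : w ≠ 0) (hwz : w * z = 0)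
    {a : K} (ha : a ≠ 0) (μ ν : K) : (μ • 1 : Matrix m m K) - a • (z * w) ≠ ν • 1 := by
  intro h
  have h1 : a • (z * w) = (μ - ν) • (1 : Matrix m m K) := by
    rw [sub_smul, ← h]; abel
  have h2 : (μ - ν) • z = 0 := by
    calc (μ - ν) • z = ((μ - ν) • (1 : Matrix m m K)) * z := by simp
      _ = 0 := by rw [← h1]; simp [Matrix.mul_assoc, hwz]
  have h3 : μ - ν = 0 := (smul_eq_zero.mp h2).resolve_right hz
  rw [h3, zero_smul] at h1
  have h4 := (smul_eq_zero.mp h1).resolve_left ha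
  apply hz
  ext i ⟨⟩
  by_contra hi
  apply hw
  ext ⟨⟩ j
  have h5 : z i () = 0 ∨ w () j = 0 := by simpa [mul_apply] using congrFun₂ h4 i j
  exact h5.resolve_left hi

/-- A block matrix with nonzero lower left column can be conjugated by a block unipotent one,
keeping the top left entry, so that its Schur complement is not scalar, unless it has size one. -/
theorem exists_units_conj_fromBlocks_schur_ne_smul_one {m K : Type*} [Fintype m] [DecidableEq m]
    [Field K] {c : K} (hc : c ≠ 0) (y : Matrix Unit m K) {z : Matrix m Unit K}
    (hz : z ≠ 0) (R : Matrix m m K) (hdet : (fromBlocks (c • 1) y z R).det ≠ 0) :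
    ∃ (P : (Matrix (Unit ⊕ m) (Unit ⊕ m) K)ˣ) (y' : Matrix Unit m K) (R' : Matrix m m K),
      P.val * fromBlocks (c • 1) y z R * P⁻¹.val = fromBlocks (c • 1) y' z R' ∧
      (Nontrivial m → ∀ μ : K, R' - c⁻¹ • (z * y') ≠ μ • 1) := by
  by_cases hS : Nontrivial m → ∀ μ : K, R - c⁻¹ • (z * y) ≠ μ • 1
  · exact ⟨1, y, R, by simp, hS⟩
  push Not at hS
  obtain ⟨_, μ, hμ⟩ := hS
  have hμ0 : μ ≠ 0 := by
    rintro rfl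
    apply hdet
    rw [det_fromBlocks_smul_one hc, hμ]
    simp
  obtain ⟨w, hw, hwz⟩ := exists_row_ne_zero_mul_eq_zero hz
  have hR : R = c⁻¹ • (z * y) + μ • 1 := by rw [← hμ]; abel
  refine ⟨⟨fromBlocks 1 w 0 1, fromBlocks 1 (-w) 0 1, ?_, ?_⟩, y + w * R - c • w, R - z * w,
    ?_, fun _ ν hν ↦ ?_⟩
  · simp [fromBlocks_multiply]
  · simp [fromBlocks_multiply]
  · simp [fromBlocks_multiply, hwz]
    constructor <;> abel
  · refine sub_smul_col_mul_row_ne_smul_one hz hw hwz (mul_ne_zero (inv_ne_zero hc) hμ0) μ ν ?_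
    rw [← hν, hR]
    simp only [Matrix.mul_add, Matrix.mul_sub, Matrix.mul_smul, ← Matrix.mul_assoc, hwz,
      Matrix.zero_mul, Matrix.mul_one, smul_zero, Matrix.mul_zero]
    simp only [smul_sub, smul_add, smul_smul, inv_mul_cancel₀ hc]
    module

/-- A linearly independent pair consisting of a vector and its image yields a basis in which
the endomorphism has a prescribed top left entry. -/
theorem _root_.LinearMap.exists_basis_toMatrix_eq_fromBlocks {n : ℕ} {K V : Type*} [Field K]
    [AddCommGroup V] [Module K V] [FiniteDimensional K V] (hV : Module.finrank K V = n + 1)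
    (f : Module.End K V) (hf : ∀ a : K, f ≠ a • LinearMap.id) (c : K) :
    ∃ (b : Module.Basis (Unit ⊕ Fin n) K V) (y : Matrix Unit (Fin n) K)
      (z : Matrix (Fin n) Unit K) (R : Matrix (Fin n) (Fin n) K),
      z ≠ 0 ∧ LinearMap.toMatrix b b f = fromBlocks (c • 1) y z R := by
  obtain ⟨x, hx⟩ : ∃ x, LinearIndependent K ![x, f x] := by
    by_contra! h
    obtain ⟨a, ha⟩ := f.exists_eq_smul_id_of_forall_notLinearIndependent h
    exact hf a ha
  obtain ⟨φ, hφ⟩ := ((Finsupp.linearCombination K ![1, c]) ∘ₗ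
    (hx.repr : _ →ₗ[K] _)).exists_extend
  have hφ' (i : Fin 2) : φ (![x, f x] i) = ![1, c] i := by
    have := LinearMap.congr_fun hφ ⟨![x, f x] i, Submodule.subset_span ⟨i, rfl⟩⟩
    rw [LinearMap.comp_apply, LinearMap.comp_apply] at this
    simpa [hx.repr_eq_single i] using this
  have hφx : φ x = 1 := hφ' 0
  have hφfx : φ (f x) = c := hφ' 1
  have hker : Module.finrank K (LinearMap.ker φ) = n := by
    have h1 := φ.finrank_range_add_finrank_ker
    have h2 : LinearMap.range φ = ⊤ :=
      LinearMap.range_eq_top.mpr fun a ↦ ⟨a • x, by simp [hφx]⟩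
    rw [h2, finrank_top, Module.finrank_self] at h1
    omega
  let e : Fin (n + 1) ≃ Unit ⊕ Fin n := (finSuccEquiv n).trans
    ((Equiv.optionEquivSumPUnit _).trans (Equiv.sumComm _ _))
  let b₀ := Module.Basis.mkFinCons x (Module.finBasisOfFinrankEq K _ hker)
    (fun a v hv h ↦ by simpa [hφx, LinearMap.mem_ker.mp hv] using congrArg φ h)
    (fun v ↦ ⟨-φ v, by simp [hφx]⟩)
  let b := b₀.reindex e
  have hb1 : b (Sum.inl ()) = x := by
    simp [b, b₀, e]
  have hb2 (i : Fin n) : φ (b (Sum.inr i)) = 0 := by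
    simp [b, b₀, e]
  have hcoord : b.coord (Sum.inl ()) = φ := by
    apply b.ext
    rintro (i | i)
    · rw [hb1, hφx]; simp [← hb1]
    · rw [hb2]; simp
  let M := LinearMap.toMatrix b b f
  refine ⟨b, M.toBlocks₁₂, M.toBlocks₂₁, M.toBlocks₂₂, fun h ↦ ?_, ?_⟩
  · have h1 : f x = c • x := by
      apply b.ext_elem
      rintro (i | i)
      · have := LinearMap.congr_fun hcoord
        simp only [Module.Basis.coord_apply] at this
        simp [this, hφx, hφfx]
      · have := congrFun₂ h i ()
        simp only [toBlocks₂₁, of_apply, M, LinearMap.toMatrix_apply, hb1] at this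
        rw [this, map_smul, Finsupp.smul_apply, ← hb1]
        simp
    have := (LinearIndependent.pair_iff.mp hx) c (-1) (by simp [h1])
    simp at this
  · rw [← fromBlocks_toBlocks (LinearMap.toMatrix b b f)]
    congr 1
    ext
    simpa [toBlocks₁₁, LinearMap.toMatrix_apply, hb1, hφfx] using LinearMap.congr_fun hcoord (f x)

open Polynomial in
/-- **Sourour's factorization theorem**: an invertible nonscalar matrix is a product of two
matrices with prescribed eigenvalues, subject only to the determinant condition. -/
theorem factorsWithCharpolys_prod {K : Type*} [Field K] (n : ℕ) (A : Matrix (Fin n) (Fin n) K)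
    (β γ : Fin n → K) (hβ : ∀ i, β i ≠ 0) (hγ : ∀ i, γ i ≠ 0)
    (hdet : A.det = ∏ i, β i * γ i) (hA : 2 ≤ n → ∀ a : K, A ≠ a • 1) :
    A.FactorsWithCharpolys (∏ i, (X - C (β i))) (∏ i, (X - C (γ i))) := by
  induction n with
  | zero => exact ⟨1, 1, Subsingleton.elim _ _, by simp [charpoly], by simp [charpoly]⟩
  | succ n ih =>
    rcases n with _ | n
    · refine ⟨β 0 • 1, γ 0 • 1, ?_, by simp [charpoly, charmatrix], by simp [charpoly, charmatrix]⟩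
      ext i j
      fin_cases i; fin_cases j
      simpa [mul_comm] using hdet
    have hc : β 0 * γ 0 ≠ 0 := mul_ne_zero (hβ 0) (hγ 0)
    have hdet0 : A.det ≠ 0 := by
      rw [hdet]
      exact Finset.prod_ne_zero_iff.mpr fun i _ ↦ mul_ne_zero (hβ i) (hγ i)
    obtain ⟨b, y, z, R, hz, hM⟩ := LinearMap.exists_basis_toMatrix_eq_fromBlocks (n := n + 1)
      (by simp) (toLin' A) (fun a ha ↦ hA (by omega) a (toLin'.injective (by simpa using ha)))
      (β 0 * γ 0)
    have hdetM : (fromBlocks ((β 0 * γ 0) • 1) y z R).det = A.det := by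
      rw [← hM, LinearMap.det_toMatrix, LinearMap.det_toLin']
    obtain ⟨P, y', R', hP, hS⟩ := exists_units_conj_fromBlocks_schur_ne_smul_one hc y hz R
      (hdetM ▸ hdet0)
    have hdetS : (R' - (β 0 * γ 0)⁻¹ • (z * y')).det = ∏ i : Fin (n + 1), β i.succ * γ i.succ := by
      apply mul_left_cancel₀ hc
      rw [← det_fromBlocks_smul_one hc, ← hP, det_units_conj, hdetM, hdet, Fin.prod_univ_succ]
    have key := FactorsWithCharpolys.fromBlocks (hβ 0) (hγ 0) y' z R'
      (ih _ (fun i ↦ β i.succ) (fun i ↦ γ i.succ) (fun i ↦ hβ _) (fun i ↦ hγ _) hdetS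
        fun h ↦ hS (Fin.nontrivial_iff_two_le.mpr h))
    rw [← hP] at key
    have key := key.of_conj
    rw [← hM, ← Fin.prod_univ_succ (fun i ↦ X - C (β i)),
      ← Fin.prod_univ_succ (fun i ↦ X - C (γ i))] at key
    have key := key.of_toMatrix b (Pi.basisFun K _)
    rwa [LinearMap.toMatrix_eq_toMatrix', LinearMap.toMatrix'_toLin'] at key

open Polynomial in
/-- A matrix of determinant one with distinct eigenvalues `a i` is diagonalized by a matrix of
determinant one. -/
theorem SpecialLinearGroup.exists_mul_eq_mul_diagonal {K : Type*} [Field K] [IsAlgClosed K] {n : ℕ}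
    (hn : n ≠ 0) (A : Matrix (Fin n) (Fin n) K) {a : Fin n → K} (ha : Function.Injective a)
    (hA : A.charpoly = ∏ i, (X - C (a i))) :
    ∃ P : SpecialLinearGroup (Fin n) K, A * P.val = P.val * diagonal a := by
  have hev (i : Fin n) : ∃ v, Module.End.HasEigenvector (Matrix.toLin' A) (a i) v := by
    apply Module.End.HasEigenvalue.exists_hasEigenvector
    rw [Module.End.hasEigenvalue_iff_isRoot_charpoly,
      ← LinearMap.charpoly_toMatrix _ (Pi.basisFun K _),
      LinearMap.toMatrix_eq_toMatrix', LinearMap.toMatrix'_toLin', hA, IsRoot, eval_prod]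
    exact Finset.prod_eq_zero (Finset.mem_univ i) (by simp)
  choose v hv using hev
  have hli := Module.End.eigenvectors_linearIndependent' _ a ha v hv
  let P : Matrix (Fin n) (Fin n) K := (of v)ᵀ
  have hP : P.det ≠ 0 := by
    have : IsUnit P := linearIndependent_cols_iff_isUnit.mp hli
    exact ((isUnit_iff_isUnit_det P).mp this).ne_zero
  have hAP : A * P = P * diagonal a := by
    ext i j
    have := congrFun (hv j).apply_eq_smul i
    rw [mul_diagonal]
    simpa [mul_apply, mulVec, dotProduct, P, mul_comm] using this
  obtain ⟨t, ht⟩ := IsAlgClosed.exists_pow_nat_eq (P.det)⁻¹ (Nat.pos_of_ne_zero hn)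
  refine ⟨⟨t • P, ?_⟩, ?_⟩
  · rw [det_smul, Fintype.card_fin, ht, inv_mul_cancel₀ hP]
  · simp [hAP]

open Polynomial in
/-- Two elements of the special linear group with the same characteristic polynomial, whose roots
are distinct, are conjugate. -/
theorem SpecialLinearGroup.exists_conj_eq_of_charpoly_eq_prod {K : Type*} [Field K] [IsAlgClosed K]
    {n : ℕ} (hn : n ≠ 0) (A B : SpecialLinearGroup (Fin n) K) {a : Fin n → K}
    (ha : Function.Injective a) (hA : A.val.charpoly = ∏ i, (X - C (a i)))
    (hB : B.val.charpoly = ∏ i, (X - C (a i))) :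
    ∃ P : SpecialLinearGroup (Fin n) K, P * A * P⁻¹ = B := by
  obtain ⟨P, hP⟩ := exists_mul_eq_mul_diagonal hn A.val ha hA
  obtain ⟨Q, hQ⟩ := exists_mul_eq_mul_diagonal hn B.val ha hB
  have hdet : (diagonal a).det = 1 := by
    simpa using (congrArg det hP).symm
  let D : SpecialLinearGroup (Fin n) K := ⟨diagonal a, hdet⟩
  have hP' : A * P = P * D := Subtype.ext hP
  have hQ' : B * Q = Q * D := Subtype.ext hQ
  refine ⟨Q * P⁻¹, ?_⟩
  rw [eq_mul_inv_of_mul_eq hP', eq_mul_inv_of_mul_eq hQ']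
  group

open Polynomial in
/-- The square of the class of a regular semisimple element contains all nonscalar elements. -/
theorem SpecialLinearGroup.mem_mul_of_ne_smul_one {K : Type*} [Field K] [IsAlgClosed K] {n : ℕ}
    (hn : n ≠ 0) {N : Set (SpecialLinearGroup (Fin n) K)}
    (hN : ∀ g ∈ N, ∀ h : SpecialLinearGroup (Fin n) K, h * g * h⁻¹ ∈ N)
    {s : SpecialLinearGroup (Fin n) K} (hs : s ∈ N) (hnodup : s.val.charpoly.roots.Nodup)
    {g : SpecialLinearGroup (Fin n) K} (hg : ∀ a : K, g.val ≠ a • 1) : g ∈ N * N := by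
  have hsplit := IsAlgClosed.splits s.val.charpoly
  have hcard : s.val.charpoly.roots.card = n := by
    rw [← hsplit.natDegree_eq_card_roots, charpoly_natDegree_eq_dim, Fintype.card_fin]
  obtain ⟨l, hl⟩ := Quot.exists_rep s.val.charpoly.roots
  change (l : Multiset K) = _ at hl
  obtain rfl : l.length = n := by rw [← hcard, ← hl, Multiset.coe_card]
  have ha : Function.Injective l.get := by
    rw [← hl, Multiset.coe_nodup] at hnodup
    exact List.nodup_iff_injective_get.mp hnodup
  have hroots : s.val.charpoly.roots = Finset.univ.val.map l.get := by
    simp [← hl]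
  have hchar : s.val.charpoly = ∏ i, (X - C (l.get i)) := by
    rw [hsplit.eq_prod_roots_of_monic (charpoly_monic _), hroots, Multiset.map_map]
    rfl
  have hprod : ∏ i, l.get i = 1 := by
    rw [← s.det_coe, det_eq_prod_roots_charpoly, hroots]
    rfl
  have ha0 (i) : l.get i ≠ 0 := fun h ↦ by
    rw [Finset.prod_eq_zero (Finset.mem_univ i) h] at hprod
    exact zero_ne_one hprod
  have hmem (B : Matrix _ _ K) (hB : B.charpoly = ∏ i, (X - C (l.get i))) :
      ∃ t ∈ N, t.val = B := by
    have hdet : B.det = 1 := by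
      rw [det_eq_sign_charpoly_coeff, hB, ← hchar, ← det_eq_sign_charpoly_coeff, s.det_coe]
    obtain ⟨P, hP⟩ := exists_conj_eq_of_charpoly_eq_prod hn s ⟨B, hdet⟩ ha hchar hB
    exact ⟨⟨B, hdet⟩, hP ▸ hN s hs P, rfl⟩
  obtain ⟨B, D, hBD, hB, hD⟩ := factorsWithCharpolys_prod _ g.val l.get l.get ha0 ha0
    (by rw [g.det_coe, Finset.prod_mul_distrib, hprod, one_mul]) (fun _ ↦ hg)
  obtain ⟨t, ht, rfl⟩ := hmem B hB
  obtain ⟨u, hu, rfl⟩ := hmem D hD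
  exact ⟨t, ht, u, hu, Subtype.ext hBD.symm⟩

/-- In dimension at least two, the nonscalar elements of the special linear group are not all
scalar multiples of a single matrix. -/
theorem SpecialLinearGroup.exists_ne_smul_one_and_ne_smul {m K : Type*} [Fintype m]
    [DecidableEq m] [Nontrivial m] [Field K] (M : Matrix m m K) :
    ∃ u : SpecialLinearGroup m K, (∀ a : K, u.val ≠ a • 1) ∧ ∀ a : K, u.val ≠ a • M := by
  obtain ⟨i, j, hij⟩ := exists_pair_ne m
  have hns {i j : m} (hij : i ≠ j) (a : K) : Matrix.transvection i j (1 : K) ≠ a • 1 := fun h ↦ by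
    simpa [Matrix.transvection, one_apply, hij] using congrFun₂ h i j
  by_contra! h
  obtain ⟨a, ha⟩ := h ⟨Matrix.transvection i j 1, det_transvection_of_ne i j hij 1⟩ (hns hij)
  obtain ⟨b, hb⟩ := h ⟨Matrix.transvection j i 1, det_transvection_of_ne j i hij.symm 1⟩
    (hns hij.symm)
  have h1 : 1 = a * M i j := by
    simpa [Matrix.transvection, one_apply, hij] using congrFun₂ ha i j
  have h2 : b = 0 ∨ M i j = 0 := by
    simpa [Matrix.transvection, one_apply, hij, hij.symm, single_apply] using congrFun₂ hb i j
  have h3 : 1 = b * M i i := by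
    simpa [Matrix.transvection, one_apply, hij, hij.symm, single_apply] using congrFun₂ hb i i
  rcases h2 with h2 | h2 <;> simp [h2] at h1 h3

end Matrix

/-- A normal subset of `SL_n(F)`, `F` algebraically closed, containing a regular
semisimple element (a matrix whose characteristic polynomial has `n` distinct
roots in `F`) covers the group in three steps. -/
theorem normal_subset_regular_semisimple_cube {F : Type*} [Field F] [IsAlgClosed F]
    (n : ℕ) (hn : 2 ≤ n)
    (N : Set (Matrix.SpecialLinearGroup (Fin n) F))
    (hN : ∀ g ∈ N, ∀ h : Matrix.SpecialLinearGroup (Fin n) F, h * g * h⁻¹ ∈ N)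
    (s : Matrix.SpecialLinearGroup (Fin n) F) (hs : s ∈ N)
    (hreg : (s : Matrix (Fin n) (Fin n) F).charpoly.roots.Nodup ∧
      Multiset.card (s : Matrix (Fin n) (Fin n) F).charpoly.roots = n) :
    N * N * N = Set.univ := by
  have hn0 : n ≠ 0 := by omega
  have : Nontrivial (Fin n) := Fin.nontrivial_iff_two_le.mpr hn
  have hsq {g : Matrix.SpecialLinearGroup (Fin n) F} (hg : ∀ a : F, g.val ≠ a • 1) : g ∈ N * N :=
    Matrix.SpecialLinearGroup.mem_mul_of_ne_smul_one hn0 hN hs hreg.1 hg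
  rw [mul_assoc, Set.eq_univ_iff_forall]
  intro g
  suffices h : ∃ t ∈ N, ∀ a : F, (t⁻¹ * g).val ≠ a • 1 by
    obtain ⟨t, ht, h⟩ := h
    exact ⟨t, ht, t⁻¹ * g, hsq h, mul_inv_cancel_left t g⟩
  by_contra! h
  have hmul (t) (ht : t ∈ N) : ∃ a : F, t.val = a • g.val := by
    obtain ⟨a, ha⟩ := h t ht
    have hg : g.val = a • t.val := by
      calc g.val = t.val * (t⁻¹ * g).val := by
            rw [← Matrix.SpecialLinearGroup.coe_mul, mul_inv_cancel_left]
        _ = a • t.val := by rw [ha, Matrix.mul_smul, Matrix.mul_one]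
    have ha0 : a ≠ 0 := by
      rintro rfl
      apply g.det_ne_zero
      rw [hg, zero_smul, Matrix.det_zero]
    exact ⟨a⁻¹, by rw [hg, inv_smul_smul₀ ha0]⟩
  obtain ⟨u, hu, hu'⟩ := Matrix.SpecialLinearGroup.exists_ne_smul_one_and_ne_smul (g.val * g.val)
  obtain ⟨t, ht, v, hv, rfl⟩ := hsq hu
  obtain ⟨a, ha⟩ := hmul t ht
  obtain ⟨b, hb⟩ := hmul v hv
  apply hu' (a * b)
  rw [Matrix.SpecialLinearGroup.coe_mul, ha, hb, smul_mul_smul_comm]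
end

section
/- Let F be an algebraically closed field, d ≥ 0 a natural number, and n = 2d + 2. Let Q be the set of all matrices in SL_n(F) of block form [[I_{d+1}, B], [0, I_{d+1}]] with B an arbitrary (d+1)×(d+1) matrix over F (i.e., all matrices g with g_{ii} = 1 for all i, g_{ij} arbitrary when i ≤ d+1 < j, and g_{ij} = 0 for all other pairs i ≠ j). If N is a normal subset of SL_n(F) containing Q, then N^6 = SL_n(F). -/
open Pointwise

open Matrix Polynomial in
/-- `A` is a product of two matrices with the prescribed split characteristic polynomials. -/
def Matrix.FactorsWithRoots {F ι : Type*} [Field F] [Fintype ι] [DecidableEq ι]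
    (β γ : ι → F) (A : Matrix ι ι F) : Prop :=
  ∃ X Y : Matrix ι ι F, X * Y = A ∧ X.charpoly = ∏ i, (Polynomial.X - C (β i)) ∧
    Y.charpoly = ∏ i, (Polynomial.X - C (γ i))

namespace Matrix

variable {F ι κ : Type*} [Field F] [Fintype ι] [DecidableEq ι] [Fintype κ] [DecidableEq κ]

theorem charpoly_conj_of_mul_eq_one {P P' : Matrix ι ι F} (h : P * P' = 1) (A : Matrix ι ι F) :
    (P * A * P').charpoly = A.charpoly := by
  rw [charpoly_mul_comm, ← Matrix.mul_assoc, mul_eq_one_comm.mp h, Matrix.one_mul]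

theorem FactorsWithRoots.of_conj {β γ : ι → F} {A P P' : Matrix ι ι F} (h : P * P' = 1)
    (hA : FactorsWithRoots β γ (P' * A * P)) : FactorsWithRoots β γ A := by
  obtain ⟨X, Y, hXY, hX, hY⟩ := hA
  have h' := mul_eq_one_comm.mp h
  refine ⟨P * X * P', P * Y * P', ?_, by rwa [charpoly_conj_of_mul_eq_one h],
    by rwa [charpoly_conj_of_mul_eq_one h]⟩
  calc P * X * P' * (P * Y * P') = P * X * (P' * P) * Y * P' := by noncomm_ring
    _ = P * (X * Y) * P' := by rw [h']; noncomm_ring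
    _ = (P * P') * A * (P * P') := by rw [hXY]; noncomm_ring
    _ = A := by rw [h]; simp

theorem FactorsWithRoots.of_submatrix {β γ : ι → F} {A : Matrix ι ι F} (e : κ ≃ ι)
    (hA : FactorsWithRoots (β ∘ e) (γ ∘ e) (A.submatrix e e)) : FactorsWithRoots β γ A := by
  obtain ⟨X, Y, hXY, hX, hY⟩ := hA
  refine ⟨reindex e e X, reindex e e Y, ?_, ?_, ?_⟩
  · rw [reindex_apply, reindex_apply, submatrix_mul_equiv, hXY]
    simp
  · rw [charpoly_reindex, hX]
    exact e.prod_comp fun i => Polynomial.X - Polynomial.C (β i)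
  · rw [charpoly_reindex, hY]
    exact e.prod_comp fun i => Polynomial.X - Polynomial.C (γ i)

omit [DecidableEq ι] in
theorem fromBlocks_eq_schur_mul (D : Matrix ι ι F) (c : Matrix ι Unit F)
    (r : Matrix Unit ι F) {b g : F} (hb : b ≠ 0) (hg : g ≠ 0) {X Y : Matrix ι ι F}
    (h : X * Y = D - (b * g)⁻¹ • (c * r)) :
    fromBlocks X (g⁻¹ • c) 0 (b • 1) * fromBlocks Y 0 (b⁻¹ • r) (g • 1) =
      fromBlocks D c r ((b * g) • 1) := by
  rw [fromBlocks_multiply, h]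
  congr 1
  · simp [smul_smul, mul_comm g⁻¹]
  · simp [hg]
  · simp [hb]
  · simp [smul_smul, mul_comm b]

theorem charpoly_smul_one_punit (b : F) :
    (b • (1 : Matrix Unit Unit F)).charpoly = Polynomial.X - Polynomial.C b := by
  rw [smul_one_eq_diagonal, charpoly_diagonal]
  simp

theorem FactorsWithRoots.fromBlocks {β γ : ι → F} (D : Matrix ι ι F) (c : Matrix ι Unit F)
    (r : Matrix Unit ι F) {b g : F} (hb : b ≠ 0) (hg : g ≠ 0)
    (h : FactorsWithRoots β γ (D - (b * g)⁻¹ • (c * r))) :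
    FactorsWithRoots (Sum.elim β fun _ => b) (Sum.elim γ fun _ => g)
      (Matrix.fromBlocks D c r ((b * g) • 1)) := by
  obtain ⟨X, Y, hXY, hX, hY⟩ := h
  refine ⟨_, _, fromBlocks_eq_schur_mul D c r hb hg hXY, ?_, ?_⟩
  · rw [charpoly_fromBlocks_zero₂₁, hX, charpoly_smul_one_punit]
    simp
  · rw [charpoly_fromBlocks_zero₁₂, hY, charpoly_smul_one_punit]
    simp

theorem det_fromBlocks_smul_one_punit (D : Matrix ι ι F) (c : Matrix ι Unit F)
    (r : Matrix Unit ι F) {δ : F} (hδ : δ ≠ 0) :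
    (fromBlocks D c r (δ • 1)).det = (D - δ⁻¹ • (c * r)).det * δ := by
  have := fromBlocks_eq_schur_mul D c r hδ one_ne_zero
    (X := D - δ⁻¹ • (c * r)) (Y := 1) (by simp)
  rw [mul_one] at this
  rw [← this, det_mul, det_fromBlocks_zero₂₁, det_fromBlocks_zero₁₂]
  simp

theorem fromBlocks_conj_lower (D : Matrix ι ι F) (c : Matrix ι Unit F)
    (r : Matrix Unit ι F) (s : Matrix Unit Unit F) (y : Matrix Unit ι F) :
    fromBlocks 1 0 (-y) 1 * fromBlocks D c r s * fromBlocks 1 0 y 1 =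
      fromBlocks (D + c * y) c (r - y * D + (s - y * c) * y) (s - y * c) := by
  simp only [fromBlocks_multiply]
  congr 1 <;> simp [Matrix.add_mul, Matrix.sub_mul, Matrix.mul_assoc] <;> abel

theorem fromBlocks_lower_mul_neg (y : Matrix Unit ι F) :
    fromBlocks (1 : Matrix ι ι F) 0 y (1 : Matrix Unit Unit F) * fromBlocks 1 0 (-y) 1 = 1 := by
  simp [fromBlocks_multiply]

theorem exists_conj_offDiag_ne_zero {A : Matrix ι ι F} (hA : ∀ a, A ≠ scalar ι a)
    (hι : Nonempty ι) :
    ∃ P P' : Matrix ι ι F, P * P' = 1 ∧ ∃ i j, i ≠ j ∧ (P' * A * P) i j ≠ 0 := by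
  by_cases h : ∃ i j, i ≠ j ∧ A i j ≠ 0
  · exact ⟨1, 1, by simp, by simpa using h⟩
  push Not at h
  obtain ⟨i, j, hij, hne⟩ : ∃ i j, i ≠ j ∧ A i i ≠ A j j := by
    by_contra! hcon
    obtain ⟨o⟩ := hι
    refine hA (A o o) ?_
    ext i j
    by_cases hij : i = j
    · subst hij
      by_cases hio : i = o
      · simp [hio]
      · simp [hcon i o hio]
    · simp [h i j hij, hij]
  refine ⟨transvection i j 1, transvection i j (-1), ?_, i, j, hij, ?_⟩
  · rw [transvection_mul_transvection_same _ _ hij]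
    simp
  · simp [transvection, Matrix.add_mul, Matrix.mul_add, h i j hij, h j i hij.symm]
    rwa [neg_add_eq_zero, eq_comm]

theorem exists_sub_mul_eq_smul_one {c : Matrix ι Unit F} (hc : c ≠ 0)
    (s : Matrix Unit Unit F) (δ : F) : ∃ y : Matrix Unit ι F, s - y * c = δ • 1 := by
  obtain ⟨i, hi⟩ : ∃ i, c i .unit ≠ 0 := by
    by_contra! h
    exact hc (by ext i; exact h i)
  refine ⟨of fun _ => Pi.single i ((s .unit .unit - δ) / c i .unit), ?_⟩
  ext
  simp [mul_apply, Pi.single_apply, hi]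

theorem one_add_smul_mul_ne_scalar {c : Matrix ι Unit F} {y : Matrix Unit ι F} {i j : ι}
    (hij : i ≠ j) (hi : c i .unit ≠ 0) (hj : y .unit j ≠ 0) {t u : F} (ht : t ≠ 0) (hu : u ≠ 0)
    (a : F) : u • (1 + t • (c * y)) ≠ scalar ι a := by
  intro h
  have := congrFun (congrFun h i) j
  simp [mul_apply, hij, hi, hj, ht, hu] at this

/-- A block matrix with nonzero last column above the corner is similar to one with prescribed
corner, whose Schur complement is not a scalar matrix. -/
theorem exists_conj_corner_eq (D : Matrix ι ι F) {c : Matrix ι Unit F}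
    (r : Matrix Unit ι F) (s : Matrix Unit Unit F) (hc : c ≠ 0)
    (hdet : (fromBlocks D c r s).det ≠ 0) {δ : F} (hδ : δ ≠ 0) :
    ∃ P P' : Matrix (ι ⊕ Unit) (ι ⊕ Unit) F, P * P' = 1 ∧ ∃ D' r',
      P' * fromBlocks D c r s * P = fromBlocks D' c r' (δ • 1) ∧
        (Subsingleton ι ∨ ∀ a, D' - δ⁻¹ • (c * r') ≠ scalar ι a) := by
  obtain ⟨z, hz⟩ := exists_sub_mul_eq_smul_one hc s δ
  have key := fromBlocks_conj_lower D c r s z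
  rw [hz] at key
  generalize D + c * z = D₁ at key
  generalize r - z * D + (δ • 1 : Matrix Unit Unit F) * z = r₁ at key
  by_cases hS : Subsingleton ι ∨ ∀ a, D₁ - δ⁻¹ • (c * r₁) ≠ scalar ι a
  · exact ⟨_, _, fromBlocks_lower_mul_neg z, D₁, r₁, key, hS⟩
  push Not at hS
  obtain ⟨hnt, u, hu⟩ := hS
  have hu0 : u ≠ 0 := by
    rintro rfl
    apply hdet
    have h1 := congrArg det key
    rw [det_mul, det_mul, det_fromBlocks_smul_one_punit _ _ _ hδ, hu,
      det_fromBlocks_zero₁₂, det_fromBlocks_zero₁₂] at h1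
    simpa using h1
  obtain ⟨i, hi⟩ : ∃ i, c i .unit ≠ 0 := by
    by_contra! h
    exact hc (by ext i; exact h i)
  obtain ⟨j, hji⟩ := exists_ne i
  let y : Matrix Unit ι F := of fun _ => Pi.single j (c i .unit) - Pi.single i (c j .unit)
  have hyc : y * c = 0 := by
    ext
    simp only [y, mul_apply, of_apply, Pi.sub_apply, sub_mul, Finset.sum_sub_distrib]
    simp [Pi.single_apply, mul_comm]
  have hyj : y .unit j ≠ 0 := by simpa [y, hji] using hi
  refine ⟨fromBlocks 1 0 z 1 * fromBlocks 1 0 y 1, fromBlocks 1 0 (-y) 1 * fromBlocks 1 0 (-z) 1,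
    ?_, D₁ + c * y, r₁ - y * D₁ + (δ • 1 - y * c : Matrix Unit Unit F) * y, ?_, Or.inr ?_⟩
  · rw [Matrix.mul_assoc, ← Matrix.mul_assoc (fromBlocks 1 0 y 1), fromBlocks_lower_mul_neg,
      Matrix.one_mul, fromBlocks_lower_mul_neg]
  · have h2 := fromBlocks_conj_lower D₁ c r₁ (δ • 1) y
    rw [← key] at h2
    simp only [hyc, sub_zero, Matrix.mul_assoc] at h2 ⊢
    exact h2
  · have hD : D₁ = u • 1 + δ⁻¹ • (c * r₁) := by
      rw [sub_eq_iff_eq_add] at hu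
      rw [hu]
      simp [smul_one_eq_diagonal]
    have hyD : y * D₁ = u • y := by
      rw [hD, Matrix.mul_add, Matrix.mul_smul, Matrix.mul_smul, ← Matrix.mul_assoc, hyc]
      simp
    have : D₁ + c * y - δ⁻¹ • (c * (r₁ - y * D₁ + (δ • 1 - y * c : Matrix Unit Unit F) * y)) =
        u • (1 + δ⁻¹ • (c * y)) := by
      rw [hyD, hyc, hD]
      simp only [sub_zero, Matrix.smul_mul, Matrix.one_mul, Matrix.mul_add, Matrix.mul_sub,
        Matrix.mul_smul, smul_add, smul_sub, inv_smul_smul₀ hδ, smul_comm δ⁻¹ u]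
      abel
    intro a
    rw [this]
    exact one_add_smul_mul_ne_scalar hji.symm hi hyj (inv_ne_zero hδ) hu0 a

/-- A nonsingular matrix which is not scalar is a product of two matrices with prescribed
nonzero eigenvalues, subject only to the determinant condition. -/
theorem factorsWithRoots_of_ne_scalar (k : ℕ) : ∀ {ι : Type} [Fintype ι] [DecidableEq ι],
    Fintype.card ι = k → ∀ {A : Matrix ι ι F} {β γ : ι → F}, (∀ i, β i ≠ 0) → (∀ i, γ i ≠ 0) →
    A.det = ∏ i, β i * γ i → (Subsingleton ι ∨ ∀ a, A ≠ scalar ι a) →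
    FactorsWithRoots β γ A := by
  induction k with
  | zero =>
    intro ι _ _ hk A β γ _ _ _ _
    have := Fintype.card_eq_zero_iff.mp hk
    exact ⟨1, 1, Subsingleton.elim _ _, by simp [charpoly_isEmpty], by simp [charpoly_isEmpty]⟩
  | succ k ih =>
    intro ι _ _ hk A β γ hβ hγ hdet hA
    have hne : Nonempty ι := Fintype.card_pos_iff.mp (by omega)
    rcases hA with hs | hA
    · refine ⟨diagonal β, diagonal γ, ?_, charpoly_diagonal β, charpoly_diagonal γ⟩
      obtain ⟨o⟩ := hne
      rw [diagonal_mul_diagonal]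
      ext i j
      obtain rfl := Subsingleton.elim i o
      obtain rfl := Subsingleton.elim j i
      rw [det_eq_elem_of_subsingleton A j] at hdet
      have : Unique ι := ⟨⟨j⟩, fun _ => Subsingleton.elim _ _⟩
      rw [hdet, Fintype.prod_subsingleton _ j]
      simp
    · obtain ⟨P, P', hP, i, j, hij, hne⟩ := exists_conj_offDiag_ne_zero hA hne
      refine FactorsWithRoots.of_conj hP ?_
      have hdet₁ : (P' * A * P).det = ∏ i, β i * γ i := by
        rw [det_mul, det_mul, ← hdet, mul_right_comm, ← det_mul, mul_eq_one_comm.mp hP]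
        simp
      generalize P' * A * P = A₁ at hne hdet₁
      let e : {x // x ≠ j} ⊕ Unit ≃ ι :=
        (Equiv.optionEquivSumPUnit.{0} _).symm.trans (Equiv.optionSubtypeNe j)
      refine FactorsWithRoots.of_submatrix e ?_
      have hdet₂ : (A₁.submatrix e e).det = ∏ i, β (e i) * γ (e i) := by
        rw [det_submatrix_equiv_self, hdet₁]
        exact (e.prod_comp fun i => β i * γ i).symm
      have hc : (A₁.submatrix e e).toBlocks₁₂ ≠ 0 := fun h =>
        hne (by simpa [e, toBlocks₁₂] using congrFun (congrFun h ⟨i, hij⟩) .unit)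
      rw [← fromBlocks_toBlocks (A₁.submatrix e e)] at hdet₂ ⊢
      have hδ : β j * γ j ≠ 0 := mul_ne_zero (hβ j) (hγ j)
      obtain ⟨Q, Q', hQ, D, r, hD, hS⟩ := exists_conj_corner_eq _ _ _ hc
        (by rw [hdet₂]; exact Finset.prod_ne_zero_iff.mpr fun _ _ => mul_ne_zero (hβ _) (hγ _)) hδ
      refine FactorsWithRoots.of_conj hQ ?_
      have hdet₃ := det_fromBlocks_smul_one_punit D (A₁.submatrix e e).toBlocks₁₂ r hδ
      rw [← hD, det_mul, det_mul, hdet₂, mul_right_comm, ← det_mul, mul_eq_one_comm.mp hQ,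
        Fintype.prod_sum_type] at hdet₃
      rw [hD]
      have hsplit (f : ι → F) : f ∘ e = Sum.elim (fun x => f x.1) fun _ => f j := by
        ext x
        rcases x with x | x <;> simp [e]
      rw [hsplit β, hsplit γ]
      refine FactorsWithRoots.fromBlocks _ _ _ (hβ j) (hγ j)
        (ih ?_ (fun _ => hβ _) (fun _ => hγ _) ?_ hS)
      · simp [hk]
      · refine mul_right_cancel₀ hδ ?_
        rw [← hdet₃]
        simp [e]

open Polynomial in
theorem exists_conj_diagonal_of_charpoly_eq {X : Matrix ι ι F} {β : ι → F}
    (hβ : Function.Injective β) (hX : X.charpoly = ∏ i, (Polynomial.X - C (β i))) :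
    ∃ V V' : Matrix ι ι F, V * V' = 1 ∧ X = V * diagonal β * V' := by
  have hev (i : ι) : ∃ v, Module.End.HasEigenvector (toLin' X) (β i) v := by
    refine Module.End.HasEigenvalue.exists_hasEigenvector ?_
    rw [Module.End.hasEigenvalue_iff_isRoot_charpoly, charpoly_toLin', hX, IsRoot, eval_prod]
    exact Finset.prod_eq_zero (Finset.mem_univ i) (by simp)
  choose v hv using hev
  have hlin := Module.End.eigenvectors_linearIndependent' _ β hβ v hv
  let V : Matrix ι ι F := (of v)ᵀ
  have hV : IsUnit V := linearIndependent_cols_iff_isUnit.mp hlin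
  obtain ⟨V', hVV', -⟩ := isUnit_iff_exists.mp hV
  refine ⟨V, V', hVV', ?_⟩
  have hXV : X * V = V * diagonal β := by
    ext i j
    have := congrFun (hv j).apply_eq_smul i
    rw [mul_diagonal]
    simpa [V, mul_apply, mulVec, dotProduct, mul_comm] using this
  rw [← hXV, Matrix.mul_assoc, hVV', Matrix.mul_one]

/-- A product of two opposite block unipotents with eigenvalues `b i` and `(b i)⁻¹`. -/
theorem exists_upper_mul_lower_eq_conj_diagonal {b : ι → F} (hb : ∀ i, b i ≠ 0)
    (hb' : ∀ i, b i ≠ (b i)⁻¹) :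
    ∃ t : ι → F, ∃ V V' : Matrix (ι ⊕ ι) (ι ⊕ ι) F, V' * V = 1 ∧
      fromBlocks 1 (diagonal t) 0 1 * fromBlocks 1 0 1 1 =
        V * diagonal (Sum.elim b fun i => (b i)⁻¹) * V' := by
  let V : Matrix (ι ⊕ ι) (ι ⊕ ι) F :=
    fromBlocks (diagonal fun i => b i - 1) (diagonal fun i => (b i)⁻¹ - 1) 1 1
  have hV : IsUnit V := by
    rw [isUnit_iff_isUnit_det, det_fromBlocks_one₂₂]
    simp [Finset.prod_ne_zero_iff, sub_eq_zero, hb']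
  obtain ⟨V', hVV', hV'V⟩ := isUnit_iff_exists.mp hV
  refine ⟨fun i => (b i - 1) ^ 2 / b i, V, V', hV'V, ?_⟩
  have : fromBlocks 1 (diagonal fun i => (b i - 1) ^ 2 / b i) 0 1 * fromBlocks 1 0 1 1 * V =
      V * diagonal (Sum.elim b fun i => (b i)⁻¹) := by
    rw [← fromBlocks_diagonal, fromBlocks_multiply, fromBlocks_multiply, fromBlocks_multiply]
    congr 1 <;> ext i j <;> by_cases hij : i = j <;>
      simp [hij, add_apply, Matrix.add_mul]
    all_goals have := hb j; field_simp; ring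
  rw [← this, Matrix.mul_assoc, hVV', Matrix.mul_one]

end Matrix

theorem IsAlgClosed.exists_pairwise_ne_inv {F : Type*} [Field F] [IsAlgClosed F] (ι : Type*)
    [Finite ι] :
    ∃ b : ι → F, (∀ i, b i ≠ 0) ∧ Function.Injective (Sum.elim b fun i => (b i)⁻¹) := by
  have hinf : ({2, -2}ᶜ : Set F).Infinite := (Set.toFinite _).infinite_compl
  have : Infinite ({2, -2}ᶜ : Set F) := hinf.to_subtype
  obtain ⟨k, ⟨f⟩⟩ := Finite.exists_equiv_fin ι
  let t : ι → ({2, -2}ᶜ : Set F) := fun i => Infinite.natEmbedding _ (f i).val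
  have ht : Function.Injective t := fun i j h =>
    f.injective (Fin.ext ((Infinite.natEmbedding _).injective h))
  have hex (x : F) : ∃ b : F, b ≠ 0 ∧ b + b⁻¹ = x := by
    obtain ⟨b, hb⟩ := IsAlgClosed.exists_root
      (Polynomial.X ^ 2 - Polynomial.C x * Polynomial.X + 1 : Polynomial F) (by
        have : (Polynomial.X ^ 2 - Polynomial.C x * Polynomial.X + 1 : Polynomial F).degree = 2 := by
          compute_degree!
        simp [this])
    simp only [Polynomial.IsRoot, Polynomial.eval_add, Polynomial.eval_sub, Polynomial.eval_pow,
      Polynomial.eval_X, Polynomial.eval_mul, Polynomial.eval_C, Polynomial.eval_one] at hb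
    have hb0 : b ≠ 0 := by
      rintro rfl
      simp at hb
    refine ⟨b, hb0, ?_⟩
    field_simp
    linear_combination hb
  choose b hb0 hb using fun i => hex (t i)
  have hinj (i j : ι) (h : b i + (b i)⁻¹ = b j + (b j)⁻¹) : i = j :=
    ht (Subtype.ext (by rw [← hb, ← hb, h]))
  have hne (i j : ι) : b i ≠ (b j)⁻¹ := by
    intro h
    obtain rfl := hinj i j (by rw [h, inv_inv, add_comm])
    have hsq : b i * b i = 1 := by
      nth_rewrite 1 [h]
      exact inv_mul_cancel₀ (hb0 i)
    refine (t i).2 ?_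
    rw [← hb, ← h]
    rcases mul_self_eq_one_iff.mp hsq with h1 | h1
    · left
      rw [h1]
      norm_num
    · right
      rw [h1]
      norm_num
  refine ⟨b, hb0, Function.Injective.sumElim ?_ ?_ hne⟩
  · exact fun i j h => hinj i j (by rw [h])
  · exact fun i j h => hinj i j (by rw [inv_injective h])

namespace Matrix.SpecialLinearGroup

variable {F ι : Type*} [Field F] [IsAlgClosed F] [Fintype ι] [DecidableEq ι] [Nonempty ι]

/-- Over an algebraically closed field, normal subsets of `SL` are stable under conjugation by
arbitrary invertible matrices. -/
theorem exists_mem_coe_eq_conj {N : Set (SpecialLinearGroup ι F)}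
    (hN : ∀ g ∈ N, ∀ h, h * g * h⁻¹ ∈ N) {g : SpecialLinearGroup ι F} (hg : g ∈ N)
    {P P' : Matrix ι ι F} (hP : P * P' = 1) :
    ∃ g' ∈ N, (g' : Matrix ι ι F) = P * g * P' := by
  obtain ⟨z, hz⟩ := IsAlgClosed.exists_pow_nat_eq P.det (Fintype.card_pos (α := ι))
  have hdet : P.det ≠ 0 := fun h => by simpa [h] using congrArg det hP
  have hz0 : z ≠ 0 := fun h => hdet (by simp [← hz, h])
  let h : SpecialLinearGroup ι F := ⟨z⁻¹ • P, by
    rw [det_smul, ← hz, ← mul_pow, inv_mul_cancel₀ hz0, one_pow]⟩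
  refine ⟨h * g * h⁻¹, hN g hg h, ?_⟩
  have key : ((h * g * h⁻¹ : SpecialLinearGroup ι F) : Matrix ι ι F) * (h : Matrix ι ι F) =
      (h : Matrix ι ι F) * g := by
    rw [← coe_mul, ← coe_mul, inv_mul_cancel_right]
  generalize ((h * g * h⁻¹ : SpecialLinearGroup ι F) : Matrix ι ι F) = M at key ⊢
  have key' : M * P = P * g := by
    simpa [h, hz0] using key
  rw [← key', Matrix.mul_assoc, hP, Matrix.mul_one]

/-- If a normal subset contains the block unipotents, it contains each nonscalar matrix as a
product of four of its elements. -/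
theorem mem_pow_four_of_ne_scalar {m ι : Type} [Fintype m] [DecidableEq m] [Fintype ι]
    [DecidableEq ι] [Nonempty ι] (e : m ⊕ m ≃ ι) {N : Set (SpecialLinearGroup ι F)}
    (hN : ∀ g ∈ N, ∀ h, h * g * h⁻¹ ∈ N)
    (hU : ∀ B : Matrix m m F, ∃ g ∈ N,
      (g : Matrix ι ι F) = reindexAlgEquiv F F e (fromBlocks 1 B 0 1))
    {g : SpecialLinearGroup ι F} (hg : ∀ a, (g : Matrix ι ι F) ≠ scalar ι a) : g ∈ N ^ 4 := by
  obtain ⟨b, hb0, hinj⟩ := IsAlgClosed.exists_pairwise_ne_inv (F := F) m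
  have hb' (i : m) : b i ≠ (b i)⁻¹ := fun h => Sum.inl_ne_inr (hinj (a₁ := .inl i) (a₂ := .inr i) h)
  let φ := reindexAlgEquiv F F e
  let β : m ⊕ m → F := Sum.elim b fun i => (b i)⁻¹
  have hβ0 (s) : β s ≠ 0 := by rcases s with i | i <;> simp [β, hb0]
  have hL (B : Matrix m m F) : ∃ g ∈ N, (g : Matrix ι ι F) = φ (fromBlocks 1 0 B 1) := by
    obtain ⟨u, hu, hu'⟩ := hU B
    let J : Matrix (m ⊕ m) (m ⊕ m) F := fromBlocks 0 1 1 0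
    have hJ : φ J * φ J = 1 := by
      rw [← map_mul, ← map_one φ]
      simp [J, fromBlocks_multiply]
    obtain ⟨l, hl, hl'⟩ := exists_mem_coe_eq_conj hN hu hJ
    refine ⟨l, hl, ?_⟩
    rw [hl', hu', ← map_mul, ← map_mul]
    simp [J, fromBlocks_multiply, φ]
  obtain ⟨t, V, V', hV, hT⟩ := exists_upper_mul_lower_eq_conj_diagonal hb0 hb'
  have hφβ : φ (diagonal β) = diagonal (β ∘ e.symm) := by
    simp [φ]
  have hpair {X : Matrix ι ι F}
      (hX : X.charpoly = ∏ i, (Polynomial.X - Polynomial.C ((β ∘ e.symm) i))) :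
      ∃ x ∈ N * N, (x : Matrix ι ι F) = X := by
    obtain ⟨W, W', hW, hXW⟩ :=
      exists_conj_diagonal_of_charpoly_eq (hinj.comp e.symm.injective) hX
    have hφV : φ V' * φ V = 1 := by rw [← map_mul, hV, map_one]
    have hconj : W * φ V' * (φ V * W') = 1 := by
      rw [Matrix.mul_assoc, ← Matrix.mul_assoc (φ V'), hφV, Matrix.one_mul, hW]
    obtain ⟨u, hu, hu'⟩ := hU (diagonal t)
    obtain ⟨l, hl, hl'⟩ := hL 1
    obtain ⟨u₁, hu₁, hu₁'⟩ := exists_mem_coe_eq_conj hN hu hconj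
    obtain ⟨l₁, hl₁, hl₁'⟩ := exists_mem_coe_eq_conj hN hl hconj
    refine ⟨u₁ * l₁, Set.mul_mem_mul hu₁ hl₁, ?_⟩
    have hV₂ : φ V * φ V' = 1 := mul_eq_one_comm.mp hφV
    calc (u₁ * l₁ : Matrix ι ι F)
        = W * φ V' * u * (φ V * (W' * W) * φ V') * l * φ V * W' := by
          rw [hu₁', hl₁']; noncomm_ring
      _ = W * φ V' * (u * l) * φ V * W' := by
          rw [mul_eq_one_comm.mp hW, Matrix.mul_one, hV₂]; noncomm_ring
      _ = W * (φ V' * φ V) * φ (diagonal β) * (φ V' * φ V) * W' := by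
          rw [hu', hl', ← map_mul, hT, map_mul, map_mul]; noncomm_ring
      _ = X := by
          rw [hφV, hXW, hφβ]
          simp only [Matrix.mul_one]
          rfl
  obtain ⟨X, Y, hXY, hX, hY⟩ := factorsWithRoots_of_ne_scalar (Fintype.card ι) rfl
    (β := β ∘ e.symm) (γ := β ∘ e.symm) (fun _ => hβ0 _) (fun _ => hβ0 _)
    (A := (g : Matrix ι ι F)) (by
      rw [g.det_coe]
      refine Eq.symm ((e.symm.prod_comp fun s => β s * β s).trans ?_)
      rw [Fintype.prod_sum_type, ← Finset.prod_mul_distrib]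
      refine Finset.prod_eq_one fun i _ => ?_
      have := hb0 i
      simp [β]
      field_simp) (Or.inr hg)
  obtain ⟨x, hx, rfl⟩ := hpair hX
  obtain ⟨y, hy, rfl⟩ := hpair hY
  have : g = x * y := Subtype.ext hXY.symm
  rw [this, show N ^ 4 = N * N * (N * N) by rw [← sq N, ← pow_add]]
  exact Set.mul_mem_mul hx hy

end Matrix.SpecialLinearGroup

/-- Paper's Lemma 3.4 for `SL_{2d+2}(F)`: if a normal subset `N` contains the
unipotent radical `Q` of the maximal parabolic obtained by deleting the middle
node (the block upper unitriangular matrices `[[I,B],[0,I]]`, in 0-based index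
language: `g i i = 1`, `g i j` arbitrary when `i < d+1 ≤ j`, and `g i j = 0`
for all other `i ≠ j`), then `N^6 = SL_{2d+2}(F)`. -/
theorem normal_subset_containing_abelian_radical_pow_six {F : Type*} [Field F]
    [IsAlgClosed F] (d : ℕ) (n : ℕ) (hn : n = 2 * d + 2)
    (Q : Set (Matrix.SpecialLinearGroup (Fin n) F))
    (hQ : Q = {g : Matrix.SpecialLinearGroup (Fin n) F | (∀ i : Fin n, (g : Matrix (Fin n) (Fin n) F) i i = 1) ∧
      ∀ i j : Fin n, i ≠ j → ¬(i.val < d + 1 ∧ d + 1 ≤ j.val) →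
        (g : Matrix (Fin n) (Fin n) F) i j = 0})
    (N : Set (Matrix.SpecialLinearGroup (Fin n) F))
    (hN : ∀ g ∈ N, ∀ h : Matrix.SpecialLinearGroup (Fin n) F, h * g * h⁻¹ ∈ N)
    (hQN : Q ⊆ N) :
    N ^ 6 = Set.univ := by
  subst hn
  let e : Fin (d + 1) ⊕ Fin (d + 1) ≃ Fin (2 * d + 2) :=
    finSumFinEquiv.trans (finCongr (by ring))
  have hel (i : Fin (d + 1)) : (e (.inl i)).val = i.val := by simp [e]
  have her (i : Fin (d + 1)) : (e (.inr i)).val = d + 1 + i.val := by simp [e, add_comm]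
  have hU (B : Matrix (Fin (d + 1)) (Fin (d + 1)) F) : ∃ g ∈ Q,
      (g : Matrix (Fin (2 * d + 2)) (Fin (2 * d + 2)) F) =
        Matrix.reindexAlgEquiv F F e (Matrix.fromBlocks 1 B 0 1) := by
    refine ⟨⟨Matrix.reindexAlgEquiv F F e (Matrix.fromBlocks 1 B 0 1), ?_⟩, ?_, rfl⟩
    · rw [Matrix.det_reindexAlgEquiv, Matrix.det_fromBlocks_zero₂₁]
      simp
    · rw [hQ]
      refine ⟨fun i => ?_, fun i j hij hlt => ?_⟩
      · obtain ⟨x, rfl⟩ := e.surjective i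
        rcases x with x | x <;> simp
      · obtain ⟨x, rfl⟩ := e.surjective i
        obtain ⟨y, rfl⟩ := e.surjective j
        rcases x with x | x <;> rcases y with y | y
        · have : x ≠ y := fun h => hij (by rw [h])
          simp [this]
        · exact absurd ⟨by rw [hel]; exact x.2, by rw [her]; omega⟩ hlt
        · simp
        · have : x ≠ y := fun h => hij (by rw [h])
          simp [this]
  have hUN (B) := (hU B).imp fun _ h => And.imp_left (@hQN _) h
  have h4 {g : Matrix.SpecialLinearGroup (Fin (2 * d + 2)) F} :=
    Matrix.SpecialLinearGroup.mem_pow_four_of_ne_scalar e hN hUN (g := g)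
  have h1 : (1 : Matrix.SpecialLinearGroup (Fin (2 * d + 2)) F) ∈ N :=
    hQN (by
      rw [hQ]
      exact ⟨fun i => by simp, fun i j hij _ => by simp [hij]⟩)
  refine Set.eq_univ_of_forall fun g => ?_
  by_cases hg : ∀ a, (g : Matrix (Fin (2 * d + 2)) (Fin (2 * d + 2)) F) ≠ Matrix.scalar _ a
  · exact Set.pow_subset_pow_right h1 (by norm_num) (h4 hg)
  · push Not at hg
    obtain ⟨a, ha⟩ := hg
    obtain ⟨u, hu, hu'⟩ := hUN 1
    obtain ⟨v, hv, hv'⟩ := hUN (-1)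
    have huv : u * v = 1 := by
      apply Subtype.ext
      rw [Matrix.SpecialLinearGroup.coe_mul, hu', hv', ← map_mul, Matrix.fromBlocks_multiply]
      simp
    have ha0 : a ≠ 0 := by
      rintro rfl
      have := g.det_coe
      rw [ha] at this
      simp at this
    have hgu : g * u ∈ N ^ 4 := by
      refine h4 fun c hc => ?_
      have := congrFun (congrFun hc (e (.inl 0))) (e (.inr 0))
      rw [Matrix.SpecialLinearGroup.coe_mul, ha, hu'] at this
      simp [ha0] at this
    have h5 : g ∈ N ^ 5 := by
      rw [pow_succ, ← mul_one g, ← huv, ← mul_assoc]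
      exact Set.mul_mem_mul hgu hv
    exact Set.pow_subset_pow_right h1 (by norm_num) h5
end

section
/- Let F be an algebraically closed field, n ≥ 2, and let u ∈ SL_n(F) be a regular unipotent element, i.e., (u − 1)^n = 0 and (u − 1)^{n−1} ≠ 0 as matrices. Let C = {h u h⁻¹ : h ∈ SL_n(F)} be the conjugacy class of u. Then every upper unitriangular matrix in SL_n(F) (all diagonal entries equal to 1 and all entries below the diagonal equal to 0) belongs to C·C. -/
open Pointwise

/-- The vectors `v, Nv, …, N ^ (n - 1) v` are linearly independent as soon as `N ^ n = 0` and
`N ^ (n - 1) v ≠ 0`. -/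
theorem linearIndependent_pow_mulVec {F : Type*} [Field F] {n : ℕ}
    {N : Matrix (Fin n) (Fin n) F} (hN : N ^ n = 0) {v : Fin n → F}
    (hv : (N ^ (n - 1)).mulVec v ≠ 0) :
    LinearIndependent F (fun j : Fin n => (N ^ (j : ℕ)).mulVec v) := by
  rw [Fintype.linearIndependent_iff]
  intro w hw k
  induction k using WellFoundedLT.induction with
  | ind k ih =>
    have h := congrArg (N ^ (n - 1 - (k : ℕ))).mulVec hw
    rw [Matrix.mulVec_sum, Matrix.mulVec_zero, Finset.sum_eq_single k] at h
    · rw [Matrix.mulVec_smul, Matrix.mulVec_mulVec, ← pow_add,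
        show n - 1 - (k : ℕ) + k = n - 1 by omega] at h
      exact (smul_eq_zero.mp h).resolve_right hv
    · intro j _ hjk
      rcases lt_or_gt_of_ne hjk with hlt | hgt
      · rw [ih j hlt, zero_smul, Matrix.mulVec_zero]
      · rw [Matrix.mulVec_smul, Matrix.mulVec_mulVec, ← pow_add,
          pow_eq_zero_of_le (by have : (k : ℕ) < j := hgt; omega) hN, Matrix.zero_mulVec,
          smul_zero]
    · simp

/-- The nilpotent lower Jordan block. -/
def lowerShift (F : Type*) [Field F] (n : ℕ) : Matrix (Fin n) (Fin n) F :=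
  Matrix.of fun i j => if (i : ℕ) = j + 1 then 1 else 0

/-- Over an algebraically closed field, a nilpotent matrix of maximal nilpotency index is
conjugate to the Jordan block by a matrix of determinant one. -/
theorem exists_specialLinearGroup_mul_eq_mul_lowerShift {F : Type*} [Field F] [IsAlgClosed F]
    {n : ℕ} (hn : n ≠ 0) {N : Matrix (Fin n) (Fin n) F} (hN : N ^ n = 0)
    (hN' : N ^ (n - 1) ≠ 0) :
    ∃ P : Matrix.SpecialLinearGroup (Fin n) F,
      N * (P : Matrix (Fin n) (Fin n) F) = P * lowerShift F n := by
  obtain ⟨v, hv⟩ : ∃ v, (N ^ (n - 1)).mulVec v ≠ 0 := by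
    by_contra! h
    exact hN' (Matrix.ext_of_mulVec_single fun i => by rw [h, Matrix.zero_mulVec])
  let P : Matrix (Fin n) (Fin n) F := Matrix.of fun i j => (N ^ (j : ℕ)).mulVec v i
  have hdet : P.det ≠ 0 := by
    have hP : IsUnit P :=
      Matrix.linearIndependent_cols_iff_isUnit.mp (linearIndependent_pow_mulVec hN hv)
    exact ((Matrix.isUnit_iff_isUnit_det P).mp hP).ne_zero
  have hNP : N * P = P * lowerShift F n := by
    ext i j
    have hl : (N * P) i j = (N ^ ((j : ℕ) + 1)).mulVec v i := by
      rw [pow_succ', ← Matrix.mulVec_mulVec]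
      rfl
    rw [hl, Matrix.mul_apply]
    by_cases hj : (j : ℕ) + 1 < n
    · rw [Finset.sum_eq_single ⟨j + 1, hj⟩]
      · simp [P, lowerShift]
      · intro k _ hk
        have : (k : ℕ) ≠ j + 1 := fun h => hk (Fin.ext h)
        simp [lowerShift, this]
      · simp
    · rw [pow_eq_zero_of_le (by omega) hN, Finset.sum_eq_zero]
      · simp
      · intro k _
        have : (k : ℕ) ≠ j + 1 := by omega
        simp [lowerShift, this]
  obtain ⟨c, hc⟩ := IsAlgClosed.exists_pow_nat_eq (P.det)⁻¹ (Nat.pos_of_ne_zero hn)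
  refine ⟨⟨c • P, ?_⟩, ?_⟩
  · rw [Matrix.det_smul, Fintype.card_fin, hc, inv_mul_cancel₀ hdet]
  · simp [hNP]

/-- Regular unipotent elements of `SL_n(F)` are conjugate. -/
theorem exists_conj_of_regular_unipotent {F : Type*} [Field F] [IsAlgClosed F]
    {n : ℕ} (hn : n ≠ 0) {u g : Matrix.SpecialLinearGroup (Fin n) F}
    (hu : ((u : Matrix (Fin n) (Fin n) F) - 1) ^ n = 0)
    (hu' : ((u : Matrix (Fin n) (Fin n) F) - 1) ^ (n - 1) ≠ 0)
    (hg : ((g : Matrix (Fin n) (Fin n) F) - 1) ^ n = 0)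
    (hg' : ((g : Matrix (Fin n) (Fin n) F) - 1) ^ (n - 1) ≠ 0) :
    ∃ h : Matrix.SpecialLinearGroup (Fin n) F, g = h * u * h⁻¹ := by
  obtain ⟨P, hP⟩ := exists_specialLinearGroup_mul_eq_mul_lowerShift hn hu hu'
  obtain ⟨Q, hQ⟩ := exists_specialLinearGroup_mul_eq_mul_lowerShift hn hg hg'
  have key : P⁻¹ * u * P = Q⁻¹ * g * Q := by
    have aux : ∀ {x R : Matrix.SpecialLinearGroup (Fin n) F},
        ((x : Matrix (Fin n) (Fin n) F) - 1) * R = R * lowerShift F n →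
          ((R⁻¹ * x * R : Matrix.SpecialLinearGroup (Fin n) F) : Matrix (Fin n) (Fin n) F) =
            1 + lowerShift F n := by
      intro x R h
      have hR : ((R⁻¹ : Matrix.SpecialLinearGroup (Fin n) F) : Matrix (Fin n) (Fin n) F) * R
          = 1 := by
        rw [← Matrix.SpecialLinearGroup.coe_mul, inv_mul_cancel,
          Matrix.SpecialLinearGroup.coe_one]
      have hx : (x : Matrix (Fin n) (Fin n) F) * R = R * (1 + lowerShift F n) := by
        rw [mul_add, ← h, sub_mul, mul_one, one_mul, add_sub_cancel]
      rw [mul_assoc, Matrix.SpecialLinearGroup.coe_mul, Matrix.SpecialLinearGroup.coe_mul, hx,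
        ← mul_assoc, hR, one_mul]
    exact Subtype.ext ((aux hP).trans (aux hQ).symm)
  refine ⟨Q * P⁻¹, ?_⟩
  calc g = Q * (Q⁻¹ * g * Q) * Q⁻¹ := by group
    _ = Q * P⁻¹ * u * (Q * P⁻¹)⁻¹ := by rw [← key]; group

/-- Powers of a strictly upper triangular matrix vanish below the corresponding superdiagonal, and
have nonzero entries there if the first superdiagonal has nonzero entries. -/
theorem pow_apply_of_strictly_upper {F : Type*} [Field F] {n : ℕ}
    {N : Matrix (Fin n) (Fin n) F} (h₀ : ∀ i j : Fin n, j ≤ i → N i j = 0)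
    (h₁ : ∀ i j : Fin n, (j : ℕ) = i + 1 → N i j ≠ 0) (k : ℕ) (i j : Fin n) :
    ((j : ℕ) < i + k → (N ^ k) i j = 0) ∧ ((j : ℕ) = i + k → (N ^ k) i j ≠ 0) := by
  induction k generalizing j with
  | zero =>
    refine ⟨fun h => ?_, fun h => ?_⟩
    · rw [pow_zero, Matrix.one_apply_ne (fun e => by subst e; omega)]
    · obtain rfl : j = i := Fin.ext h
      simp
  | succ k ih =>
    rw [pow_succ, Matrix.mul_apply]
    have hz : ∀ l : Fin n, (j : ℕ) ≤ i + k + 1 → (l : ℕ) ≠ i + k →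
        (N ^ k) i l * N l j = 0 := by
      intro l hj hl
      rcases lt_or_gt_of_ne hl with hl | hl
      · rw [(ih l).1 hl, zero_mul]
      · rw [h₀ l j (Fin.le_def.mpr (by omega)), mul_zero]
    refine ⟨fun h => Finset.sum_eq_zero fun l _ => ?_, fun h => ?_⟩
    · by_cases hl : (l : ℕ) = i + k
      · rw [h₀ l j (Fin.le_def.mpr (by omega)), mul_zero]
      · exact hz l (by omega) hl
    · have hlt : (i : ℕ) + k < n := by omega
      rw [Finset.sum_eq_single ⟨i + k, hlt⟩
        (fun l _ hl => hz l (by omega) fun e => hl (Fin.ext e)) (by simp)]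
      exact mul_ne_zero ((ih _).2 rfl) (h₁ _ _ h)

/-- An upper unitriangular matrix with nonzero superdiagonal entries is regular unipotent. -/
theorem regular_unipotent_of_unitriangular {F : Type*} [Field F] {n : ℕ} (hn : n ≠ 0)
    {M : Matrix (Fin n) (Fin n) F} (hd : ∀ i, M i i = 1) (h₀ : ∀ i j : Fin n, j < i → M i j = 0)
    (h₁ : ∀ i j : Fin n, (j : ℕ) = i + 1 → M i j ≠ 0) :
    (M - 1) ^ n = 0 ∧ (M - 1) ^ (n - 1) ≠ 0 := by
  have key := pow_apply_of_strictly_upper (N := M - 1)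
    (fun i j hij => by
      rcases hij.eq_or_lt with rfl | hlt
      · simp [hd]
      · simp [h₀ i j hlt, Matrix.one_apply_ne hlt.ne'])
    (fun i j hij => by
      have hne : i ≠ j := fun e => by subst e; omega
      simpa [Matrix.one_apply_ne hne] using h₁ i j hij)
  refine ⟨?_, fun h => ?_⟩
  · ext i j
    exact (key n i j).1 (by omega)
  · exact (key (n - 1) ⟨0, by omega⟩ ⟨n - 1, by omega⟩).2 (by simp) (by rw [h]; rfl)

/-- Over an infinite field, every upper unitriangular matrix is a product of two upper
unitriangular matrices with nonzero superdiagonal entries. -/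
theorem exists_mul_eq_of_unitriangular {F : Type*} [Field F] [Infinite F] {n : ℕ}
    {g : Matrix.SpecialLinearGroup (Fin n) F} (hd : ∀ i, g i i = 1)
    (h₀ : ∀ i j : Fin n, j < i → g i j = 0) :
    ∃ x y : Matrix.SpecialLinearGroup (Fin n) F, x * y = g ∧
      ((∀ i, x i i = 1) ∧ (∀ i j : Fin n, j < i → x i j = 0) ∧
        ∀ i j : Fin n, (j : ℕ) = i + 1 → x i j ≠ 0) ∧
      ((∀ i, y i i = 1) ∧ (∀ i j : Fin n, j < i → y i j = 0) ∧
        ∀ i j : Fin n, (j : ℕ) = i + 1 → y i j ≠ 0) := by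
  classical
  have ha : ∀ i j : Fin n, ∃ a : F, a ≠ 0 ∧ a ≠ g i j := fun i j => by
    obtain ⟨a, ha⟩ := Infinite.exists_notMem_finset ({0, g i j} : Finset F)
    exact ⟨a, by simpa using ha⟩
  choose a ha₀ hag using ha
  let X : Matrix (Fin n) (Fin n) F :=
    Matrix.of fun i j => if i = j then 1 else if (j : ℕ) = i + 1 then a i j else 0
  have hXd : ∀ i, X i i = 1 := fun i => by simp [X]
  have hX₀ : ∀ i j : Fin n, j < i → X i j = 0 := fun i j hij => by
    have : (j : ℕ) ≠ i + 1 := by have : (j : ℕ) < i := hij; omega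
    simp [X, hij.ne', this]
  have hX₁ : ∀ i j : Fin n, (j : ℕ) = i + 1 → X i j = a i j := fun i j hij => by
    have : i ≠ j := fun e => by subst e; omega
    simp [X, this, hij]
  have hX₂ : ∀ i j : Fin n, (i : ℕ) + 1 < j → X i j = 0 := fun i j hij => by
    have : i ≠ j := fun e => by subst e; omega
    have : (j : ℕ) ≠ i + 1 := by omega
    simp [X, *]
  have hXt : X.BlockTriangular id := fun i j hij => hX₀ i j hij
  have hdet : X.det = 1 := by
    rw [Matrix.det_of_isUpperTriangular hXt]
    simp [hXd]
  let x : Matrix.SpecialLinearGroup (Fin n) F := ⟨X, hdet⟩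
  have hxy : x * (x⁻¹ * g) = g := mul_inv_cancel_left x g
  generalize hy : x⁻¹ * g = y at hxy
  have hyt : (y : Matrix (Fin n) (Fin n) F).BlockTriangular id := by
    have : Invertible X := X.invertibleOfIsUnitDet (by simp [hdet])
    have hyX : (y : Matrix (Fin n) (Fin n) F) = X⁻¹ * g := by
      rw [← hxy, Matrix.SpecialLinearGroup.coe_mul]
      exact (Matrix.inv_mul_cancel_left_of_invertible X _).symm
    rw [hyX]
    exact (Matrix.blockTriangular_inv_of_blockTriangular hXt).mul fun i j hij => h₀ i j hij
  have hy₀ : ∀ i j : Fin n, j < i → y i j = 0 := fun i j hij => hyt hij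
  have hg : ∀ i j, g i j = ∑ l, X i l * y l j := fun i j => by
    rw [← hxy, Matrix.SpecialLinearGroup.coe_mul, Matrix.mul_apply]
  have hyd : ∀ i, y i i = 1 := fun i => by
    have h := hg i i
    rw [Finset.sum_eq_single i, hXd, one_mul, hd] at h
    · exact h.symm
    · intro l _ hl
      rcases lt_or_gt_of_ne hl with hl | hl
      · rw [hX₀ i l hl, zero_mul]
      · rw [hy₀ l i hl, mul_zero]
    · simp
  refine ⟨x, y, hxy, ⟨hXd, hX₀, fun i j hij => ?_⟩, hyd, hy₀, fun i j hij h => ?_⟩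
  · exact (hX₁ i j hij).trans_ne (ha₀ i j)
  · have hs := hg i j
    rw [Finset.sum_eq_single j, hX₁ i j hij, hyd, mul_one] at hs
    · exact hag i j hs.symm
    · intro l _ hl
      rcases lt_trichotomy l i with hli | rfl | hli
      · rw [hX₀ i l hli, zero_mul]
      · rw [h, mul_zero]
      · have h₁ : (i : ℕ) < l := hli
        have h₂ : (l : ℕ) ≠ j := fun e => hl (Fin.ext e)
        rw [hX₂ i l (by omega), zero_mul]
    · simp

/-- The square of the conjugacy class of a regular unipotent element of
`SL_n(F)` contains every upper unitriangular matrix. -/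
theorem unitriangular_mem_sq_of_regular_unipotent_class {F : Type*} [Field F]
    [IsAlgClosed F] (n : ℕ) (hn : 2 ≤ n)
    (u : Matrix.SpecialLinearGroup (Fin n) F)
    (hu : ((u : Matrix (Fin n) (Fin n) F) - 1) ^ n = 0)
    (hu' : ((u : Matrix (Fin n) (Fin n) F) - 1) ^ (n - 1) ≠ 0)
    (C : Set (Matrix.SpecialLinearGroup (Fin n) F))
    (hC : C = {g | ∃ h : Matrix.SpecialLinearGroup (Fin n) F, g = h * u * h⁻¹}) :
    ∀ g : Matrix.SpecialLinearGroup (Fin n) F,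
      (∀ i : Fin n, (g : Matrix (Fin n) (Fin n) F) i i = 1) →
      (∀ i j : Fin n, j < i → (g : Matrix (Fin n) (Fin n) F) i j = 0) →
      g ∈ C * C := by
  have hn₀ : n ≠ 0 := by omega
  have hmem : ∀ x : Matrix.SpecialLinearGroup (Fin n) F,
      ((∀ i, x i i = 1) ∧ (∀ i j : Fin n, j < i → x i j = 0) ∧
        ∀ i j : Fin n, (j : ℕ) = i + 1 → x i j ≠ 0) → x ∈ C := by
    rintro x ⟨hd, h₀, h₁⟩
    obtain ⟨hx, hx'⟩ := regular_unipotent_of_unitriangular hn₀ hd h₀ h₁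
    rw [hC]
    exact exists_conj_of_regular_unipotent hn₀ hu hu' hx hx'
  intro g hd h₀
  obtain ⟨x, y, hxy, hx, hy⟩ := exists_mul_eq_of_unitriangular hd h₀
  exact ⟨x, hmem x hx, y, hmem y hy, hxy⟩
end

section
/- Let F be an algebraically closed field, n ≥ 2, and let u ∈ SL_n(F) be a regular unipotent element, i.e., (u − 1)^n = 0 and (u − 1)^{n−1} ≠ 0 as matrices. Let C = {h u h⁻¹ : h ∈ SL_n(F)} be the conjugacy class of u. Then C^4 = SL_n(F). -/
open Pointwise

namespace RegularUnipotent

open Matrix Polynomial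

variable {F : Type*} [Field F]

/-- Elements of `SL_n` over an algebraically closed field that are similar to a common matrix are
conjugate in `SL_n`. -/
theorem exists_specialLinear_conj [IsAlgClosed F] {n : ℕ} (hn : 0 < n)
    {A B : SpecialLinearGroup (Fin n) F} {P Q J : Matrix (Fin n) (Fin n) F} (hP : P.det ≠ 0)
    (hQ : Q.det ≠ 0) (hA : (A : Matrix (Fin n) (Fin n) F) * P = P * J)
    (hB : (B : Matrix (Fin n) (Fin n) F) * Q = Q * J) :
    ∃ g : SpecialLinearGroup (Fin n) F, A = g * B * g⁻¹ := by
  have hQ' : IsUnit Q.det := hQ.isUnit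
  have hR : (P * Q⁻¹).det ≠ 0 := by simp [det_nonsing_inv, hP, hQ]
  have h : (A : Matrix (Fin n) (Fin n) F) * (P * Q⁻¹) = P * Q⁻¹ * B := by
    have h1 : J * Q⁻¹ = Q⁻¹ * B := by
      calc J * Q⁻¹ = Q⁻¹ * (Q * J) * Q⁻¹ := by
            rw [← mul_assoc, nonsing_inv_mul _ hQ', one_mul]
        _ = Q⁻¹ * B := by
            rw [← hB, mul_assoc, mul_assoc, mul_nonsing_inv _ hQ', mul_one]
    rw [← mul_assoc, hA, mul_assoc, h1, mul_assoc]
  obtain ⟨c, hc⟩ := IsAlgClosed.exists_pow_nat_eq ((P * Q⁻¹).det)⁻¹ hn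
  let g : SpecialLinearGroup (Fin n) F :=
    ⟨c • (P * Q⁻¹), by rw [det_smul, Fintype.card_fin, hc, inv_mul_cancel₀ hR]⟩
  refine ⟨g, ?_⟩
  rw [eq_mul_inv_iff_mul_eq]
  apply Subtype.ext
  change (A : Matrix (Fin n) (Fin n) F) * (c • (P * Q⁻¹)) = c • (P * Q⁻¹) * B
  rw [mul_smul_comm, h, smul_mul_assoc]

/-- The standard nilpotent Jordan block, with ones below the diagonal. -/
def shift (F : Type*) [Field F] (n : ℕ) : Matrix (Fin n) (Fin n) F :=
  Matrix.of fun i j => if (i : ℕ) = j + 1 then 1 else 0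

theorem exists_mul_eq_mul_shift {n : ℕ} (N : Matrix (Fin n) (Fin n) F) (h : N ^ n = 0)
    (h' : N ^ (n - 1) ≠ 0) :
    ∃ P : Matrix (Fin n) (Fin n) F, P.det ≠ 0 ∧ N * P = P * shift F n := by
  obtain ⟨x, hx⟩ : ∃ x, (N ^ (n - 1)) *ᵥ x ≠ 0 := by
    by_contra! H
    exact h' (Matrix.ext_of_mulVec_single fun i => by rw [H, zero_mulVec])
  have hpow (k : ℕ) (hk : n ≤ k) : N ^ k = 0 := pow_eq_zero_of_le hk h
  refine ⟨Matrix.of fun i j => ((N ^ (j : ℕ)) *ᵥ x) i, ?_, ?_⟩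
  · intro hdet
    obtain ⟨w, hw, hw0⟩ := exists_mulVec_eq_zero_iff.2 hdet
    have hsum : ∑ j : Fin n, w j • ((N ^ (j : ℕ)) *ᵥ x) = 0 := by
      ext i
      have := congrFun hw0 i
      simpa [mulVec, dotProduct, mul_comm] using this
    apply hw
    funext j
    obtain ⟨j, hj⟩ := j
    induction j using Nat.strong_induction_on with
    | _ j ih =>
      have h1 := congrArg (fun v => (N ^ (n - 1 - j)) *ᵥ v) hsum
      simp only [mulVec_zero, mulVec_sum, mulVec_smul, mulVec_mulVec, ← pow_add] at h1
      rw [Finset.sum_eq_single ⟨j, hj⟩] at h1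
      · rw [show n - 1 - j + j = n - 1 by lia] at h1
        exact (smul_eq_zero.1 h1).resolve_right hx
      · intro b _ hb
        rcases lt_or_gt_of_ne (fun e => hb (Fin.ext e) : (b : ℕ) ≠ j) with hlt | hgt
        · rw [ih b hlt b.2]; simp
        · rw [hpow _ (by lia)]; simp
      · simp
  · ext i j
    have e : (N * Matrix.of fun i (j : Fin n) => ((N ^ (j : ℕ)) *ᵥ x) i) i j
        = ((N ^ (j + 1 : ℕ)) *ᵥ x) i := by
      rw [pow_succ', ← mulVec_mulVec]; rfl
    rw [e, mul_apply]
    by_cases hj : (j : ℕ) + 1 < n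
    · rw [Finset.sum_eq_single ⟨j + 1, hj⟩]
      · simp [shift]
      · intro b _ hb
        have : (b : ℕ) ≠ j + 1 := fun e => hb (Fin.ext e)
        simp [shift, this]
      · simp
    · rw [hpow _ (by lia), zero_mulVec, Finset.sum_eq_zero]
      · rfl
      · intro b _
        have : (b : ℕ) ≠ j + 1 := by lia
        simp [shift, this]

/-- Any two regular unipotent elements of `SL_n` are conjugate. -/
theorem exists_conj_of_regular [IsAlgClosed F] {n : ℕ} (hn : 0 < n)
    {u v : SpecialLinearGroup (Fin n) F}
    (hu : ((u : Matrix (Fin n) (Fin n) F) - 1) ^ n = 0)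
    (hu' : ((u : Matrix (Fin n) (Fin n) F) - 1) ^ (n - 1) ≠ 0)
    (hv : ((v : Matrix (Fin n) (Fin n) F) - 1) ^ n = 0)
    (hv' : ((v : Matrix (Fin n) (Fin n) F) - 1) ^ (n - 1) ≠ 0) :
    ∃ g : SpecialLinearGroup (Fin n) F, v = g * u * g⁻¹ := by
  obtain ⟨P, hP, h⟩ := exists_mul_eq_mul_shift _ hu hu'
  obtain ⟨Q, hQ, h'⟩ := exists_mul_eq_mul_shift _ hv hv'
  refine exists_specialLinear_conj hn hQ hP (J := 1 + shift F n) ?_ ?_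
  · rw [mul_add, ← h']; noncomm_ring
  · rw [mul_add, ← h]; noncomm_ring

/-- The powers of a strictly lower triangular matrix. -/
theorem pow_apply_eq_zero {n : ℕ} {N : Matrix (Fin n) (Fin n) F}
    (h : ∀ i j : Fin n, i ≤ j → N i j = 0) (k : ℕ) (i j : Fin n) (hij : (i : ℕ) < j + k) :
    (N ^ k) i j = 0 := by
  induction k generalizing i with
  | zero => exact one_apply_ne (by rintro rfl; simp at hij)
  | succ k ih =>
    rw [pow_succ', mul_apply]
    refine Finset.sum_eq_zero fun l _ => ?_
    rcases le_or_gt i l with hl | hl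
    · rw [h _ _ hl, zero_mul]
    · have : (l : ℕ) < i := hl
      rw [ih l (by lia), mul_zero]

theorem pow_card_eq_zero {n : ℕ} {N : Matrix (Fin n) (Fin n) F}
    (h : ∀ i j : Fin n, i ≤ j → N i j = 0) : N ^ n = 0 := by
  ext i j
  exact pow_apply_eq_zero h n i j (by lia)

theorem pow_pred_ne_zero {n : ℕ} (hn : 0 < n) {N : Matrix (Fin n) (Fin n) F}
    (h : ∀ i j : Fin n, i ≤ j → N i j = 0)
    (h' : ∀ i j : Fin n, (i : ℕ) = j + 1 → N i j ≠ 0) : N ^ (n - 1) ≠ 0 := by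
  have key (k : ℕ) (hk : k < n) : (N ^ k) ⟨k, hk⟩ ⟨0, hn⟩ ≠ 0 := by
    induction k with
    | zero => simp
    | succ k ih =>
      rw [pow_succ', mul_apply, Finset.sum_eq_single ⟨k, by lia⟩]
      · exact mul_ne_zero (h' _ _ rfl) (ih _)
      · intro l _ hl
        rcases lt_or_gt_of_ne (fun e => hl (Fin.ext e) : (l : ℕ) ≠ k) with hlt | hgt
        · rw [pow_apply_eq_zero h k l _ (by simpa using hlt), mul_zero]
        · rw [h _ _ (Fin.mk_le_of_le_val hgt), zero_mul]
      · simp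
  intro h0
  apply key (n - 1) (by lia)
  rw [h0]; rfl

theorem det_one_add {n : ℕ} {N : Matrix (Fin n) (Fin n) F}
    (h : ∀ i j : Fin n, i ≤ j → N i j = 0) : (1 + N).det = 1 := by
  rw [det_of_isLowerTriangular (1 + N)]
  · exact Finset.prod_eq_one fun i _ => by simp [h i i le_rfl]
  · intro i j hij
    have : i < j := hij
    simp [h i j this.le, this.ne]

/-- A matrix with the prescribed distinct eigenvalues `t` is diagonalizable. -/
theorem exists_mul_eq_mul_diagonal {n : ℕ} {A : Matrix (Fin n) (Fin n) F} {t : Fin n → F}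
    (ht : Function.Injective t) (h : ∀ i, ∃ x ≠ 0, A *ᵥ x = t i • x) :
    ∃ P : Matrix (Fin n) (Fin n) F, P.det ≠ 0 ∧ A * P = P * diagonal t := by
  choose x hx hAx using h
  refine ⟨(Matrix.of x)ᵀ, ?_, ?_⟩
  · have hli : LinearIndependent F x :=
      Module.End.eigenvectors_linearIndependent' (toLin' A) t ht x fun i =>
        ⟨Module.End.mem_eigenspace_iff.2 (by simpa using hAx i), hx i⟩
    rw [det_transpose]
    exact ((isUnit_iff_isUnit_det _).1 (linearIndependent_rows_iff_isUnit.1 hli)).ne_zero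
  · ext i j
    rw [mul_diagonal, mul_comm]
    exact congrFun (hAx j) i

/-- Two elements of `SL_n` with the same `n` distinct eigenvalues are conjugate. -/
theorem exists_conj_of_eigenvalues [IsAlgClosed F] {n : ℕ} (hn : 0 < n)
    {A B : SpecialLinearGroup (Fin n) F} {t : Fin n → F} (ht : Function.Injective t)
    (hA : ∀ i, ∃ x ≠ 0, (A : Matrix (Fin n) (Fin n) F) *ᵥ x = t i • x)
    (hB : ∀ i, ∃ x ≠ 0, (B : Matrix (Fin n) (Fin n) F) *ᵥ x = t i • x) :
    ∃ g : SpecialLinearGroup (Fin n) F, A = g * B * g⁻¹ := by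
  obtain ⟨P, hP, hAP⟩ := exists_mul_eq_mul_diagonal ht hA
  obtain ⟨Q, hQ, hBQ⟩ := exists_mul_eq_mul_diagonal ht hB
  exact exists_specialLinear_conj hn hP hQ hAP hBQ

/-- Every square matrix over an algebraically closed field is triangularizable. -/
theorem exists_mul_eq_mul_upperTriangular [IsAlgClosed F] {n : ℕ}
    (A : Matrix (Fin n) (Fin n) F) :
    ∃ P T : Matrix (Fin n) (Fin n) F,
      P.det ≠ 0 ∧ (∀ i j, j < i → T i j = 0) ∧ A * P = P * T := by
  induction n with
  | zero => exact ⟨1, 1, by simp, fun i => i.elim0, Subsingleton.elim _ _⟩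
  | succ n ih =>
    obtain ⟨μ, hμ⟩ := Module.End.exists_eigenvalue (toLin' A)
    obtain ⟨v, hv⟩ := hμ.exists_hasEigenvector
    have hAv : A *ᵥ v = μ • v := by simpa using hv.apply_eq_smul
    obtain ⟨k, hk⟩ := Function.ne_iff.1 hv.2
    set Q : Matrix (Fin (n + 1)) (Fin (n + 1)) F :=
      ((1 : Matrix _ _ F).updateCol k v).submatrix id (Equiv.swap 0 k) with hQ
    have hQdet : IsUnit Q.det := by
      have : ((1 : Matrix _ _ F).updateCol k v).det = v k := by
        rw [← cramer_apply, cramer_one]; rfl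
      rw [hQ, det_permute', this, isUnit_iff_ne_zero]
      refine mul_ne_zero ?_ hk
      rcases Int.units_eq_one_or (Equiv.Perm.sign (Equiv.swap 0 k)) with h | h <;> simp [h]
    have hQ0 : Q *ᵥ Pi.single 0 1 = v := by
      ext i
      simp [hQ]
    obtain ⟨B, hB⟩ : ∃ B, B = Q⁻¹ * A * Q := ⟨_, rfl⟩
    have hAQ : A * Q = Q * B := by
      rw [hB, ← mul_assoc, ← mul_assoc, mul_nonsing_inv _ hQdet, one_mul]
    have hB0 (i : Fin n) : B i.succ 0 = 0 := by
      have : B *ᵥ Pi.single 0 1 = μ • Pi.single 0 1 := by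
        rw [hB, ← mulVec_mulVec, hQ0, ← mulVec_mulVec, hAv, mulVec_smul, ← hQ0, mulVec_mulVec,
          nonsing_inv_mul _ hQdet, one_mulVec]
      simpa using congrFun this i.succ
    obtain ⟨P, T, hP, hT, h⟩ := ih (B.submatrix Fin.succ Fin.succ)
    let P' : Matrix (Fin (n + 1)) (Fin (n + 1)) F :=
      Matrix.of (Fin.cons (Fin.cons 1 0) fun i => Fin.cons 0 (P i))
    let T' : Matrix (Fin (n + 1)) (Fin (n + 1)) F :=
      Matrix.of (Fin.cons (Fin.cons (B 0 0) fun j => ∑ l, B 0 (Fin.succ l) * P l j)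
        fun i => Fin.cons 0 (T i))
    refine ⟨Q * P', T', ?_, ?_, ?_⟩
    · rw [det_mul]
      refine mul_ne_zero hQdet.ne_zero ?_
      have : P'.det = P.det := by
        rw [det_succ_row_zero, Fin.sum_univ_succ]
        simp [P']
        rfl
      rwa [this]
    · intro i j
      refine Fin.cases ?_ (fun i => ?_) i
      · intro h; simp at h
      · refine Fin.cases ?_ (fun j => ?_) j
        · intro _; rfl
        · intro h; exact hT i j (by simpa using h)
    · rw [← mul_assoc, hAQ, mul_assoc, mul_assoc Q]
      congr 1
      ext i j
      simp only [mul_apply, Fin.sum_univ_succ]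
      refine Fin.cases ?_ (fun i => ?_) i <;> refine Fin.cases ?_ (fun j => ?_) j
      · simp [P', T']
      · simp [P', T']
      · simp [P', T', hB0]
      · have := congrFun (congrFun h i) j
        simp only [mul_apply, submatrix_apply] at this
        simp [P', T', this]

/-- A three-term recurrence whose solutions are eigenvectors of a pencil of bidiagonal matrices. -/
noncomputable def continuant (s : ℕ → F) : ℕ → F[X]
  | 0 => 1
  | 1 => X - 1
  | k + 2 => (X - 1) * continuant s (k + 1) + C (s k) * (X * continuant s k)

theorem continuant_monic_natDegree (s : ℕ → F) (k : ℕ) :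
    (continuant s k).Monic ∧ (continuant s k).natDegree = k := by
  induction k using Nat.twoStepInduction with
  | zero => simp [continuant]
  | one =>
    rw [continuant, ← C_1]
    exact ⟨monic_X_sub_C 1, natDegree_X_sub_C 1⟩
  | more k ih0 ih1 =>
    have h1 : ((X - 1 : F[X]) * continuant s (k + 1)).Monic := by
      rw [← C_1]; exact (monic_X_sub_C 1).mul ih1.1
    have h2 : ((X - 1 : F[X]) * continuant s (k + 1)).natDegree = k + 2 := by
      rw [← C_1, (monic_X_sub_C 1).natDegree_mul ih1.1, natDegree_X_sub_C, ih1.2]; ring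
    have h3 : (C (s k) * (X * continuant s k)).degree
        < ((X - 1 : F[X]) * continuant s (k + 1)).degree := by
      rw [degree_eq_natDegree h1.ne_zero, h2]
      refine (degree_le_of_natDegree_le (n := k + 1) ?_).trans_lt (by norm_cast; lia)
      refine (natDegree_C_mul_le _ _).trans ?_
      rw [monic_X.natDegree_mul ih0.1, natDegree_X, ih0.2]; lia
    rw [continuant]
    exact ⟨h1.add_of_left h3, by rw [natDegree_add_eq_left_of_degree_lt h3, h2]⟩

theorem continuant_coeff_self (s : ℕ → F) (k : ℕ) : (continuant s k).coeff k = 1 := by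
  have h := continuant_monic_natDegree s k
  simpa [Monic, leadingCoeff, h.2] using h.1

theorem continuant_coeff_zero (s : ℕ → F) (k : ℕ) : (continuant s k).coeff 0 = (-1) ^ k := by
  induction k using Nat.twoStepInduction with
  | zero => simp [continuant]
  | one => simp [continuant]
  | more k _ ih1 => simp [continuant, mul_coeff_zero, ih1, pow_succ]

theorem continuant_succ_coeff (s : ℕ → F) (k : ℕ) :
    (continuant s (k + 1)).coeff k = ∑ i ∈ Finset.range k, s i - (k + 1) := by
  induction k with
  | zero => simp [continuant]
  | succ k ih =>
    rw [continuant, sub_mul, one_mul, coeff_add, coeff_sub, coeff_X_mul, coeff_C_mul, coeff_X_mul,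
      ih, continuant_coeff_self, continuant_coeff_self, Finset.sum_range_succ]
    push_cast
    ring

/-- Expansion of a polynomial in a basis of monic polynomials, one in each degree. -/
theorem exists_eq_sum_of_monic {p : ℕ → F[X]} (hp : ∀ k, (p k).Monic ∧ (p k).natDegree = k)
    (m : ℕ) (q : F[X]) (hq : q.degree < (m + 1 : ℕ)) :
    ∃ c : ℕ → F, q = ∑ j ∈ Finset.range (m + 1), C (c j) * p j ∧ c m = q.coeff m := by
  have hlead (k : ℕ) : (p k).coeff k = 1 := by
    simpa [Monic, leadingCoeff, (hp k).2] using (hp k).1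
  have hdeg (m : ℕ) (q : F[X]) (hq : q.degree < (m + 1 : ℕ)) :
      (q - C (q.coeff m) * p m).degree < (m : ℕ) := by
    rw [degree_lt_iff_coeff_zero] at hq ⊢
    intro k hk
    rcases hk.eq_or_lt with rfl | hk
    · simp [hlead]
    · rw [coeff_sub, coeff_C_mul, hq k (by lia),
        coeff_eq_zero_of_natDegree_lt (p := p m) (by rw [(hp m).2]; exact hk)]
      simp
  induction m generalizing q with
  | zero =>
    refine ⟨fun _ => q.coeff 0, ?_, rfl⟩
    have : q - C (q.coeff 0) * p 0 = 0 := by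
      rw [← degree_eq_bot, ← Nat.WithBot.lt_zero_iff]; simpa using hdeg 0 q hq
    simpa using sub_eq_zero.1 this
  | succ m ih =>
    obtain ⟨c, hc, -⟩ := ih _ (hdeg _ q hq)
    refine ⟨Function.update c (m + 1) (q.coeff (m + 1)), ?_, by simp⟩
    rw [Finset.sum_range_succ, Function.update_self,
      Finset.sum_congr rfl (g := fun j => C (c j) * p j), ← hc, sub_add_cancel]
    intro j hj
    rw [Function.update_of_ne (Finset.mem_range.1 hj).ne]

/-- A choice of nonzero parameters making the trace differ from a given value. -/
theorem exists_sum_range_ne [Infinite F] {m : ℕ} (hm : 0 < m) (r : F) :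
    ∃ s : ℕ → F, (∀ k, s k ≠ 0) ∧ ∑ i ∈ Finset.range m, s i ≠ r := by
  obtain ⟨a, ha⟩ := (Set.toFinite {0, r - ∑ i ∈ Finset.range (m - 1), (1 : F)}).exists_notMem
  simp only [Set.mem_insert_iff, Set.mem_singleton_iff, not_or] at ha
  refine ⟨Function.update 1 (m - 1) a, fun k => ?_, fun h => ha.2 ?_⟩
  · by_cases hk : k = m - 1
    · subst hk; simpa using ha.1
    · simp [hk]
  · obtain ⟨m, rfl⟩ : ∃ l, m = l + 1 := ⟨m - 1, by lia⟩
    rw [Finset.sum_range_succ, Finset.sum_congr rfl (g := fun _ => (1 : F))] at h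
    · simp at h ⊢
      rw [← h]; ring
    · intro i hi
      simp [(Finset.mem_range.1 hi).ne]

/-- The pencil `(1 + Jᵀ) - λ (1 + N)` with `J` the standard Jordan block and `N` a regular strictly
lower triangular matrix can be given any prescribed distinct eigenvalues of product one. -/
theorem exists_pencil [Infinite F] {m : ℕ} {t : Fin (m + 2) → F} (ht : Function.Injective t)
    (hprod : ∏ i, t i = 1) :
    ∃ N : Matrix (Fin (m + 2)) (Fin (m + 2)) F, (∀ i j, i ≤ j → N i j = 0) ∧
      (∀ i j : Fin (m + 2), (i : ℕ) = j + 1 → N i j ≠ 0) ∧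
      ∀ i, ∃ x ≠ 0, (1 + (shift F (m + 2))ᵀ) *ᵥ x = t i • ((1 + N) *ᵥ x) := by
  set f : F[X] := ∏ i, (X - C (t i)) with hf
  have hfm : f.Monic := monic_prod_of_monic _ _ fun i _ => monic_X_sub_C _
  have hfd : f.natDegree = m + 2 := by
    rw [hf, natDegree_prod_of_monic _ _ fun i _ => monic_X_sub_C _]; simp
  have hf0 : f.coeff 0 = (-1) ^ m := by
    rw [hf, coeff_zero_eq_eval_zero, eval_prod]
    simp [Finset.prod_neg, hprod, pow_succ]
  have hroot (i) : f.eval (t i) = 0 := by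
    rw [hf, eval_prod]
    exact Finset.prod_eq_zero (Finset.mem_univ i) (by simp)
  obtain ⟨s, hs, hs'⟩ : ∃ s : ℕ → F, (∀ k, s k ≠ 0) ∧
      (f - (X - 1) * continuant s (m + 1)).coeff (m + 1) ≠ 0 := by
    have key (s : ℕ → F) : (f - (X - 1) * continuant s (m + 1)).coeff (m + 1)
        = f.coeff (m + 1) + (m + 2) - ∑ i ∈ Finset.range m, s i := by
      rw [sub_mul, one_mul, coeff_sub, coeff_sub, coeff_X_mul, continuant_succ_coeff,
        continuant_coeff_self]
      ring
    rcases Nat.eq_zero_or_pos m with rfl | hm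
    · refine ⟨1, by simp, fun h => ?_⟩
      have hfeq : f = X ^ 2 - C (t 0 + t 1) * X + C (t 0 * t 1) := by
        rw [hf, Fin.prod_univ_two]; simp only [C_add, C_mul]; ring
      rw [key, hfeq] at h
      simp [coeff_X_pow] at h
      rw [Fin.prod_univ_two] at hprod
      have h01 : (1 - t 0) * (1 - t 1) = 0 := by linear_combination h + hprod
      have hne : t 0 ≠ t 1 := fun e => absurd (ht e) (by simp)
      rcases mul_eq_zero.1 h01 with h0 | h0
      · have : t 0 = 1 := (sub_eq_zero.1 h0).symm
        rw [this, one_mul] at hprod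
        exact hne (by rw [this, hprod])
      · have : t 1 = 1 := (sub_eq_zero.1 h0).symm
        rw [this, mul_one] at hprod
        exact hne (by rw [this, hprod])
    · obtain ⟨s, hs, hs'⟩ := exists_sum_range_ne hm (f.coeff (m + 1) + (m + 2))
      exact ⟨s, hs, by rw [key, sub_ne_zero]; exact hs'.symm⟩
  set p := continuant s with hp
  set g := f - (X - 1) * p (m + 1) with hg
  have hgX : X * g.divX = g := by
    have h0 : g.coeff 0 = 0 := by
      simp [hg, mul_coeff_zero, hf0, hp, continuant_coeff_zero, pow_succ]
    conv_rhs => rw [← X_mul_divX_add g, h0]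
    simp
  have hqd : g.divX.degree < (m + 1 : ℕ) := by
    rw [degree_lt_iff_coeff_zero]
    intro k hk
    rw [coeff_divX]
    have hPm : ((X - 1 : F[X]) * p (m + 1)).coeff (m + 2) = 1 := by
      rw [sub_mul, one_mul, coeff_sub, coeff_X_mul, hp, continuant_coeff_self,
        coeff_eq_zero_of_natDegree_lt (by rw [(continuant_monic_natDegree s _).2]; lia), sub_zero]
    have hPd : ((X - 1 : F[X]) * p (m + 1)).natDegree ≤ m + 2 := by
      refine natDegree_mul_le.trans ?_
      rw [hp, (continuant_monic_natDegree s _).2, ← C_1, natDegree_X_sub_C]; lia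
    rcases hk.eq_or_lt with rfl | hk
    · rw [hg, coeff_sub, hPm, sub_eq_zero]
      simpa [Monic, leadingCoeff, hfd] using hfm
    · rw [hg, coeff_sub, coeff_eq_zero_of_natDegree_lt (by lia),
        coeff_eq_zero_of_natDegree_lt (by lia), sub_zero]
  obtain ⟨c, hc, hcm⟩ := exists_eq_sum_of_monic (continuant_monic_natDegree s) m g.divX hqd
  rw [coeff_divX] at hcm
  refine ⟨Matrix.of fun i j => if (i : ℕ) = m + 1 then (if (j : ℕ) < m + 1 then c j else 0) else
    if (i : ℕ) = j + 1 then s j else 0, ?_, ?_, ?_⟩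
  · intro i j hij
    have : (i : ℕ) ≤ j := hij
    simp only [of_apply]
    split_ifs <;> first | rfl | lia
  · intro i j hij
    simp only [of_apply]
    split_ifs with h1 h2
    · rw [show (j : ℕ) = m by lia, hcm]; exact hs'
    · lia
    · exact hs _
  · intro l
    refine ⟨fun j => (p j).eval (t l), fun h => ?_, ?_⟩
    · simpa [hp, continuant] using congrFun h 0
    · rw [add_mulVec, add_mulVec, one_mulVec]
      ext i
      obtain ⟨i, hi⟩ := i
      simp only [Pi.add_apply, Pi.smul_apply, smul_eq_mul, mulVec, dotProduct, transpose_apply,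
        shift, of_apply, ite_mul, one_mul, zero_mul]
      rw [Fin.sum_univ_eq_sum_range (fun j => if j = i + 1 then (p j).eval (t l) else 0)]
      by_cases him : i = m + 1
      · subst him
        simp only [if_true]
        rw [Fin.sum_univ_eq_sum_range
          (fun j => if j < m + 1 then c j * (p j).eval (t l) else 0), Finset.sum_ite_eq',
          Finset.sum_range_succ _ (m + 1)]
        have h1 : ∑ j ∈ Finset.range (m + 1), (if j < m + 1 then c j * (p j).eval (t l) else 0)
            = g.divX.eval (t l) := by
          rw [hc, eval_finsetSum]
          refine Finset.sum_congr rfl fun j hj => ?_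
          rw [if_pos (Finset.mem_range.1 hj)]
          simp [hp]
        rw [h1]
        have h2 := congrArg (eval (t l)) hgX
        simp only [hg, eval_sub, eval_mul, eval_X, hroot, eval_one] at h2
        simp
        linear_combination -h2
      · simp only [him, if_false]
        rw [Fin.sum_univ_eq_sum_range (fun j => if i = j + 1 then s j * (p j).eval (t l) else 0),
          Finset.sum_ite_eq', if_pos (Finset.mem_range.2 (by lia))]
        rcases i with _ | i
        · simp [hp, continuant]
        · simp only [Nat.add_right_cancel_iff]
          rw [Finset.sum_ite_eq, if_pos (Finset.mem_range.2 (by lia))]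
          simp only [hp, continuant, eval_add, eval_mul, eval_sub, eval_X, eval_one, eval_C]
          ring

theorem exists_eigenvector_of_upperTriangular {n : ℕ} {T : Matrix (Fin n) (Fin n) F}
    (hT : ∀ i j, j < i → T i j = 0) (i : Fin n) : ∃ x ≠ 0, T *ᵥ x = T i i • x := by
  have hdet : (T - T i i • 1).det = 0 := by
    rw [det_of_isUpperTriangular]
    · exact Finset.prod_eq_zero (Finset.mem_univ i) (by simp)
    · intro j k hjk
      have : k < j := hjk
      simp [hT _ _ this, this.ne']
  obtain ⟨x, hx, h⟩ := exists_mulVec_eq_zero_iff.2 hdet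
  refine ⟨x, hx, ?_⟩
  rwa [sub_mulVec, smul_mulVec, one_mulVec, sub_eq_zero] at h

theorem regular_inv {n : ℕ} {M : SpecialLinearGroup (Fin n) F}
    (h : ((M : Matrix (Fin n) (Fin n) F) - 1) ^ n = 0)
    (h' : ((M : Matrix (Fin n) (Fin n) F) - 1) ^ (n - 1) ≠ 0) :
    (((M⁻¹ : SpecialLinearGroup (Fin n) F) : Matrix (Fin n) (Fin n) F) - 1) ^ n = 0 ∧
      (((M⁻¹ : SpecialLinearGroup (Fin n) F) : Matrix (Fin n) (Fin n) F) - 1) ^ (n - 1) ≠ 0 := by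
  obtain ⟨A, hA⟩ : ∃ A : Matrix (Fin n) (Fin n) F, A = M := ⟨_, rfl⟩
  obtain ⟨B, hB⟩ : ∃ B : Matrix (Fin n) (Fin n) F, B = (M⁻¹ : SpecialLinearGroup (Fin n) F) :=
    ⟨_, rfl⟩
  have hAB : A * B = 1 := by
    rw [hA, hB]
    exact (Matrix.SpecialLinearGroup.coe_mul M M⁻¹).symm.trans (by rw [mul_inv_cancel]; rfl)
  have hBA : B * A = 1 := mul_eq_one_comm.1 hAB
  rw [← hA] at h h'
  rw [← hB]
  have e1 : B - 1 = -B * (A - 1) := by rw [mul_sub, neg_mul, hBA]; noncomm_ring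
  have e2 : A - 1 = -A * (B - 1) := by rw [mul_sub, neg_mul, hAB]; noncomm_ring
  have c1 : Commute (-B) (A - 1) := by
    rw [Commute, SemiconjBy, mul_sub, sub_mul, neg_mul, mul_neg, hAB, hBA]; simp
  have c2 : Commute (-A) (B - 1) := by
    rw [Commute, SemiconjBy, mul_sub, sub_mul, neg_mul, mul_neg, hAB, hBA]; simp
  refine ⟨by rw [e1, c1.mul_pow, h, mul_zero], fun h0 => h' ?_⟩
  rw [e2, c2.mul_pow, h0, mul_zero]

/-- An upper triangular matrix of determinant one with distinct diagonal entries is a product of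
two conjugates of a regular unipotent element. -/
theorem exists_eq_mul_conj [IsAlgClosed F] {n : ℕ} (hn : 2 ≤ n)
    {u : SpecialLinearGroup (Fin n) F}
    (hu : ((u : Matrix (Fin n) (Fin n) F) - 1) ^ n = 0)
    (hu' : ((u : Matrix (Fin n) (Fin n) F) - 1) ^ (n - 1) ≠ 0)
    {T : SpecialLinearGroup (Fin n) F} (hT : ∀ i j, j < i → T i j = 0)
    (hinj : Function.Injective fun i => T i i) :
    ∃ g h : SpecialLinearGroup (Fin n) F, T = (g * u * g⁻¹) * (h * u * h⁻¹) := by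
  obtain ⟨m, rfl⟩ : ∃ m, n = m + 2 := ⟨n - 2, by lia⟩
  have hprod : ∏ i, T i i = 1 := by
    have h := T.det_coe
    rwa [det_of_isUpperTriangular fun i j hij => hT i j hij] at h
  have : Infinite F := IsAlgClosed.instInfinite
  obtain ⟨N, hN, hN', hpencil⟩ := exists_pencil hinj hprod
  have hJ : ∀ i j : Fin (m + 2), i ≤ j → shift F (m + 2) i j = 0 := by
    intro i j hij
    have : (i : ℕ) ≠ j + 1 := by have : (i : ℕ) ≤ j := hij; lia
    simp [shift, this]
  have hJ' : ∀ i j : Fin (m + 2), (i : ℕ) = j + 1 → shift F (m + 2) i j ≠ 0 := by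
    intro i j hij
    simp [shift, hij]
  let M : SpecialLinearGroup (Fin (m + 2)) F := ⟨1 + N, det_one_add hN⟩
  let U : SpecialLinearGroup (Fin (m + 2)) F :=
    ⟨1 + (shift F (m + 2))ᵀ, by
      rw [← transpose_one, ← transpose_add, det_transpose, det_one_add hJ]⟩
  have hM1 : (M : Matrix (Fin (m + 2)) (Fin (m + 2)) F) - 1 = N := add_sub_cancel_left _ _
  have hU1 : (U : Matrix (Fin (m + 2)) (Fin (m + 2)) F) - 1 = (shift F (m + 2))ᵀ :=
    add_sub_cancel_left _ _
  obtain ⟨hMr, hMr'⟩ := regular_inv (M := M) (by rw [hM1]; exact pow_card_eq_zero hN)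
    (by rw [hM1]; exact pow_pred_ne_zero (by lia) hN hN')
  obtain ⟨g, hg⟩ := exists_conj_of_regular (by lia) hu hu' hMr hMr'
  obtain ⟨h, hh⟩ := exists_conj_of_regular (v := U) (by lia) hu hu'
    (by rw [hU1, ← transpose_pow, pow_card_eq_zero hJ, transpose_zero])
    (by
      rw [hU1, ← transpose_pow, Ne, transpose_eq_zero]
      exact pow_pred_ne_zero (by lia) hJ hJ')
  have heig (i : Fin (m + 2)) : ∃ x ≠ 0,
      ((M⁻¹ * U : SpecialLinearGroup (Fin (m + 2)) F) :
        Matrix (Fin (m + 2)) (Fin (m + 2)) F) *ᵥ x = T i i • x := by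
    obtain ⟨x, hx, h⟩ := hpencil i
    refine ⟨x, hx, ?_⟩
    have h1 : (U : Matrix (Fin (m + 2)) (Fin (m + 2)) F) *ᵥ x
        = T i i • ((M : Matrix (Fin (m + 2)) (Fin (m + 2)) F) *ᵥ x) := h
    have h2 : ((M⁻¹ : SpecialLinearGroup (Fin (m + 2)) F) : Matrix (Fin (m + 2)) (Fin (m + 2)) F)
        * (M : Matrix (Fin (m + 2)) (Fin (m + 2)) F) = 1 :=
      (Matrix.SpecialLinearGroup.coe_mul M⁻¹ M).symm.trans (by rw [inv_mul_cancel]; rfl)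
    rw [Matrix.SpecialLinearGroup.coe_mul M⁻¹ U, ← mulVec_mulVec, h1, mulVec_smul,
      mulVec_mulVec, h2, one_mulVec]
  obtain ⟨k, hk⟩ := exists_conj_of_eigenvalues (A := T) (by lia) hinj
    (exists_eigenvector_of_upperTriangular hT) heig
  refine ⟨k * g, k * h, ?_⟩
  rw [hk, hg, hh]
  group

/-- There are elements of product one, distinct and with distinct quotients by given ones. -/
theorem exists_generic [IsAlgClosed F] {n : ℕ} (hn : 0 < n) {d : Fin n → F} (hd : ∀ i, d i ≠ 0) :
    ∃ t : Fin n → F, ∏ i, t i = 1 ∧ Function.Injective t ∧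
      Function.Injective fun i => (t i)⁻¹ * d i := by
  have : Infinite F := IsAlgClosed.instInfinite
  set P : F[X] := X * ∏ ij ∈ (Finset.univ : Finset (Fin n)).offDiag,
    ((X ^ (ij.1 : ℕ) - X ^ (ij.2 : ℕ)) *
      (C (d ij.1) * X ^ (ij.2 : ℕ) - C (d ij.2) * X ^ (ij.1 : ℕ))) with hP
  have hP0 : P ≠ 0 := by
    refine mul_ne_zero X_ne_zero (Finset.prod_ne_zero_iff.2 fun ij hij => ?_)
    have hne : (ij.1 : ℕ) ≠ ij.2 := fun e => (Finset.mem_offDiag.1 hij).2.2 (Fin.ext e)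
    refine mul_ne_zero (fun h => ?_) fun h => ?_
    · simpa [coeff_X_pow, hne] using congrArg (fun q => coeff q ij.1) h
    · have := congrArg (fun q => coeff q ij.2) h
      simp [coeff_X_pow, hne.symm, hd] at this
  obtain ⟨z, hz⟩ : ∃ z, P.eval z ≠ 0 := by
    by_contra! H
    exact hP0 (Polynomial.funext fun x => by simpa using H x)
  simp only [hP, eval_mul, eval_X, eval_prod, mul_ne_zero_iff, Finset.prod_ne_zero_iff, eval_sub,
    eval_pow, eval_C, Finset.mem_offDiag, Prod.forall, Finset.mem_univ, true_and, sub_ne_zero] at hz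
  obtain ⟨hz0, hz⟩ := hz
  obtain ⟨c, hc⟩ := IsAlgClosed.exists_pow_nat_eq (∏ i : Fin n, z ^ (i : ℕ))⁻¹ hn
  have hne : ∏ i : Fin n, z ^ (i : ℕ) ≠ 0 := Finset.prod_ne_zero_iff.2 fun i _ => pow_ne_zero _ hz0
  have hc0 : c ≠ 0 := by
    rintro rfl
    rw [zero_pow hn.ne'] at hc
    exact inv_ne_zero hne hc.symm
  refine ⟨fun i => c * z ^ (i : ℕ), ?_, fun i j h => ?_, fun i j h => ?_⟩
  · rw [Finset.prod_mul_distrib, Finset.prod_const, Finset.card_univ, Fintype.card_fin, hc,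
      inv_mul_cancel₀ hne]
  · by_contra hij
    exact (hz i j hij).1 (mul_left_cancel₀ hc0 h)
  · by_contra hij
    apply (hz i j hij).2
    have hi := pow_ne_zero (i : ℕ) hz0
    have hj := pow_ne_zero (j : ℕ) hz0
    simp only at h
    field_simp at h
    linear_combination h

/-- Every element of `SL_n` is conjugate to a product of two upper triangular ones, each with
distinct diagonal entries. -/
theorem exists_conj_mul_upperTriangular [IsAlgClosed F] {n : ℕ} (hn : 0 < n)
    (g : SpecialLinearGroup (Fin n) F) :
    ∃ h S T : SpecialLinearGroup (Fin n) F, g = h * (S * T) * h⁻¹ ∧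
      (∀ i j, j < i → S i j = 0) ∧ (Function.Injective fun i => S i i) ∧
      (∀ i j, j < i → T i j = 0) ∧ Function.Injective fun i => T i i := by
  obtain ⟨P, R, hP, hR, h⟩ := exists_mul_eq_mul_upperTriangular (g : Matrix (Fin n) (Fin n) F)
  have hRdet : R.det = 1 := by
    have := congrArg det h
    rw [det_mul, det_mul, g.det_coe, one_mul] at this
    exact mul_left_cancel₀ hP (by rw [← this, mul_one])
  have hd (i) : R i i ≠ 0 := by
    have h1 := hRdet
    rw [det_of_isUpperTriangular fun i j hij => hR i j hij] at h1
    exact Finset.prod_ne_zero_iff.1 (h1.trans_ne one_ne_zero) i (Finset.mem_univ i)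
  obtain ⟨t, ht1, htinj, hdinj⟩ := exists_generic hn hd
  let S : SpecialLinearGroup (Fin n) F := ⟨diagonal t, by rw [det_diagonal, ht1]⟩
  let T : SpecialLinearGroup (Fin n) F := ⟨diagonal (fun i => (t i)⁻¹) * R, by
    rw [det_mul, det_diagonal, hRdet, Finset.prod_inv_distrib, ht1, inv_one, one_mul]⟩
  have ht0 (i) : t i ≠ 0 := Finset.prod_ne_zero_iff.1 (ht1.trans_ne one_ne_zero) i (Finset.mem_univ i)
  have hT (i j) : T i j = (t i)⁻¹ * R i j := diagonal_mul _ _ _ _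
  have hS (i j) : S i j = diagonal t i j := rfl
  have hST : ((S * T : SpecialLinearGroup (Fin n) F) : Matrix (Fin n) (Fin n) F) = R := by
    change diagonal t * (diagonal (fun i => (t i)⁻¹) * R) = R
    ext i j
    rw [diagonal_mul, diagonal_mul, mul_inv_cancel_left₀ (ht0 i)]
  obtain ⟨k, hk⟩ := exists_specialLinear_conj (A := g) (B := S * T) (Q := 1) hn hP (by simp) h
    (by rw [hST, mul_one, one_mul])
  refine ⟨k, S, T, hk, fun i j hij => ?_, ?_, fun i j hij => ?_, ?_⟩
  · rw [hS, diagonal_apply_ne _ hij.ne']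
  · simpa only [hS, diagonal_apply_eq] using htinj
  · rw [hT, hR _ _ hij, mul_zero]
  · simpa only [hT] using hdinj

end RegularUnipotent


/-- The conjugacy class of a regular unipotent element of `SL_n(F)` covers the
group in four steps. -/
theorem regular_unipotent_class_pow_four {F : Type*} [Field F]
    [IsAlgClosed F] (n : ℕ) (hn : 2 ≤ n)
    (u : Matrix.SpecialLinearGroup (Fin n) F)
    (hu : ((u : Matrix (Fin n) (Fin n) F) - 1) ^ n = 0)
    (hu' : ((u : Matrix (Fin n) (Fin n) F) - 1) ^ (n - 1) ≠ 0)
    (C : Set (Matrix.SpecialLinearGroup (Fin n) F))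
    (hC : C = {g | ∃ h : Matrix.SpecialLinearGroup (Fin n) F, g = h * u * h⁻¹}) :
    C ^ 4 = Set.univ := by
  subst hC
  refine Set.eq_univ_of_forall fun g => ?_
  obtain ⟨k, S, T, hg, hS, hS', hT, hT'⟩ :=
    RegularUnipotent.exists_conj_mul_upperTriangular (by lia) g
  obtain ⟨a, b, hab⟩ := RegularUnipotent.exists_eq_mul_conj hn hu hu' hS hS'
  obtain ⟨c, d, hcd⟩ := RegularUnipotent.exists_eq_mul_conj hn hu hu' hT hT'
  have hprod : g = (k * a) * u * (k * a)⁻¹ * ((k * b) * u * (k * b)⁻¹) *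
      ((k * c) * u * (k * c)⁻¹) * ((k * d) * u * (k * d)⁻¹) := by
    rw [hg, hab, hcd]
    group
  rw [hprod, pow_succ, pow_succ, pow_succ, pow_one]
  exact Set.mul_mem_mul (Set.mul_mem_mul (Set.mul_mem_mul ⟨_, rfl⟩ ⟨_, rfl⟩) ⟨_, rfl⟩) ⟨_, rfl⟩
end

section
/- Let F be an algebraically closed field and n ≥ 13. Let u ∈ SL_n(F) be a regular unipotent element, i.e., (u − 1)^n = 0 and (u − 1)^{n−1} ≠ 0, and let C = {h u h⁻¹ : h ∈ SL_n(F)} be its conjugacy class. Then every diagonal matrix in SL_n(F) belongs to C^36. -/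
namespace Matrix

section CommRing

variable {R : Type*} [CommRing R] {n : ℕ}

/-- A square matrix `M` is regular unipotent if `M - 1` is nilpotent of maximal index. -/
def IsRegularUnipotent (M : Matrix (Fin n) (Fin n) R) : Prop :=
  (M - 1) ^ n = 0 ∧ (M - 1) ^ (n - 1) ≠ 0

/-- A matrix all of whose entries on or below the diagonal vanish. -/
def IsStrictUpper (N : Matrix (Fin n) (Fin n) R) : Prop :=
  ∀ i j, j ≤ i → N i j = 0

/-- The lower bidiagonal unipotent matrix with subdiagonal entries `b i` in row `i`. -/
def lowerBidiagonal (b : Fin n → R) : Matrix (Fin n) (Fin n) R :=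
  1 + of fun i j : Fin n => if (i : ℕ) = j + 1 then b i else 0

theorem IsStrictUpper.pow_apply_eq_zero {N : Matrix (Fin n) (Fin n) R} (hN : N.IsStrictUpper)
    (k : ℕ) (i j : Fin n) (h : (j : ℕ) < i + k) : (N ^ k) i j = 0 := by
  induction k generalizing j with
  | zero => rw [pow_zero, one_apply_ne]; rintro rfl; omega
  | succ k ih =>
    rw [pow_succ, mul_apply]
    refine Finset.sum_eq_zero fun l _ => ?_
    by_cases hl : (l : ℕ) < i + k
    · rw [ih l hl, zero_mul]
    · rw [hN l j (Fin.le_def.2 (by omega)), mul_zero]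

theorem IsStrictUpper.pow_apply_ne_zero [IsDomain R] {N : Matrix (Fin n) (Fin n) R}
    (hN : N.IsStrictUpper) (hN' : ∀ i j : Fin n, (j : ℕ) = i + 1 → N i j ≠ 0)
    (k : ℕ) (i j : Fin n) (h : (j : ℕ) = i + k) : (N ^ k) i j ≠ 0 := by
  induction k generalizing j with
  | zero =>
    obtain rfl : j = i := Fin.ext h
    simp
  | succ k ih =>
    have hl : (i : ℕ) + k < n := by omega
    rw [pow_succ, mul_apply, Finset.sum_eq_single (⟨i + k, hl⟩ : Fin n)]
    · exact mul_ne_zero (ih _ rfl) (hN' _ _ (by simp only; omega))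
    · intro l _ hne
      have hne' : (l : ℕ) ≠ i + k := fun h' => hne (Fin.ext h')
      by_cases hlt : (l : ℕ) < i + k
      · rw [hN.pow_apply_eq_zero k i l hlt, zero_mul]
      · rw [hN l j (Fin.le_def.2 (by omega)), mul_zero]
    · simp

theorem IsStrictUpper.isRegularUnipotent [IsDomain R] {M : Matrix (Fin n) (Fin n) R}
    (hn : 0 < n) (hM : (M - 1).IsStrictUpper)
    (hM' : ∀ i j : Fin n, (j : ℕ) = i + 1 → M i j ≠ 0) : M.IsRegularUnipotent := by
  refine ⟨?_, fun h => ?_⟩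
  · ext i j
    exact hM.pow_apply_eq_zero n i j (by omega)
  · refine hM.pow_apply_ne_zero (fun i j hij => ?_) (n - 1) ⟨0, hn⟩ ⟨n - 1, by omega⟩ (by simp)
      (by rw [h, zero_apply])
    have hne : i ≠ j := fun h' => by rw [h'] at hij; omega
    rw [sub_apply, one_apply_ne hne, sub_zero]
    exact hM' i j hij

theorem IsStrictUpper.det_eq_one {M : Matrix (Fin n) (Fin n) R} (hM : (M - 1).IsStrictUpper) :
    M.det = 1 := by
  have h1 : ∀ i, M i i = 1 := fun i => by
    simpa [sub_eq_zero] using hM i i le_rfl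
  rw [det_of_isUpperTriangular, Finset.prod_congr rfl fun i _ => h1 i, Finset.prod_const_one]
  intro i j hij
  have := hM i j (le_of_lt hij)
  rwa [sub_apply, one_apply_ne (show i ≠ j from ne_of_gt hij), sub_zero] at this

theorem isStrictUpper_transpose_lowerBidiagonal_sub_one (b : Fin n → R) :
    ((lowerBidiagonal b)ᵀ - 1).IsStrictUpper := by
  intro i j hij
  have : (j : ℕ) ≠ i + 1 := by have := Fin.le_def.1 hij; omega
  simp [lowerBidiagonal, one_apply, this]

theorem lowerBidiagonal_apply_succ (b : Fin n → R) (i j : Fin n) (h : (i : ℕ) = j + 1) :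
    lowerBidiagonal b i j = b i := by
  have hne : i ≠ j := fun h' => by rw [h'] at h; omega
  simp [lowerBidiagonal, h, one_apply_ne hne]

theorem det_lowerBidiagonal (b : Fin n → R) : (lowerBidiagonal b).det = 1 := by
  rw [← det_transpose]
  exact (isStrictUpper_transpose_lowerBidiagonal_sub_one b).det_eq_one

theorem IsRegularUnipotent.of_transpose {M : Matrix (Fin n) (Fin n) R}
    (hM : Mᵀ.IsRegularUnipotent) : M.IsRegularUnipotent := by
  have h : ∀ k, (Mᵀ - 1) ^ k = ((M - 1) ^ k)ᵀ := fun k => by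
    rw [transpose_pow, transpose_sub, transpose_one]
  rw [IsRegularUnipotent, h, h] at hM
  exact ⟨transpose_eq_zero.1 hM.1, fun h' => hM.2 (transpose_eq_zero.2 h')⟩

theorem isRegularUnipotent_transpose_lowerBidiagonal [IsDomain R] (hn : 0 < n) {b : Fin n → R}
    (hb : ∀ i, b i ≠ 0) : (lowerBidiagonal b)ᵀ.IsRegularUnipotent :=
  (isStrictUpper_transpose_lowerBidiagonal_sub_one b).isRegularUnipotent hn fun i j hij => by
    rw [transpose_apply, lowerBidiagonal_apply_succ b j i hij]
    exact hb j

theorem IsRegularUnipotent.inv {g : SpecialLinearGroup (Fin n) R}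
    (hg : (g : Matrix (Fin n) (Fin n) R).IsRegularUnipotent) :
    ((g⁻¹ : SpecialLinearGroup (Fin n) R) : Matrix (Fin n) (Fin n) R).IsRegularUnipotent := by
  have key : ∀ (a : SpecialLinearGroup (Fin n) R) (k : ℕ),
      ((a : Matrix (Fin n) (Fin n) R) - 1) ^ k = 0 →
      (((a⁻¹ : SpecialLinearGroup (Fin n) R) : Matrix (Fin n) (Fin n) R) - 1) ^ k = 0 := by
    intro a k h
    have h1 : (a : Matrix (Fin n) (Fin n) R) * (a⁻¹ : SpecialLinearGroup (Fin n) R) = 1 := by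
      rw [← SpecialLinearGroup.coe_mul, mul_inv_cancel, SpecialLinearGroup.coe_one]
    have h2 : ((a⁻¹ : SpecialLinearGroup (Fin n) R) : Matrix (Fin n) (Fin n) R) * a = 1 := by
      rw [← SpecialLinearGroup.coe_mul, inv_mul_cancel, SpecialLinearGroup.coe_one]
    generalize ((a⁻¹ : SpecialLinearGroup (Fin n) R) : Matrix (Fin n) (Fin n) R) = B at h1 h2 ⊢
    generalize (a : Matrix (Fin n) (Fin n) R) = A at h h1 h2 ⊢
    have h3 : B - 1 = (-B) * (A - 1) := by rw [mul_sub, neg_mul, h2]; simp; abel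
    have h4 : Commute (-B) (A - 1) := by
      rw [Commute, SemiconjBy, mul_sub, sub_mul, neg_mul, mul_neg, h2, h1]; simp
    rw [h3, h4.mul_pow, h, mul_zero]
  exact ⟨key g n hg.1, fun h => hg.2 (by simpa using key g⁻¹ _ h)⟩

theorem isRegularUnipotent_conj_iff (h g : SpecialLinearGroup (Fin n) R) :
    ((h * g * h⁻¹ : SpecialLinearGroup (Fin n) R) : Matrix (Fin n) (Fin n) R).IsRegularUnipotent ↔
      (g : Matrix (Fin n) (Fin n) R).IsRegularUnipotent := by
  have key : ∀ (h g : SpecialLinearGroup (Fin n) R) (k : ℕ),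
      ((g : Matrix (Fin n) (Fin n) R) - 1) ^ k = 0 →
      (((h * g * h⁻¹ : SpecialLinearGroup (Fin n) R) : Matrix (Fin n) (Fin n) R) - 1) ^ k = 0 := by
    intro h g k hk
    have h1 : (h : Matrix (Fin n) (Fin n) R) * (h⁻¹ : SpecialLinearGroup (Fin n) R) = 1 := by
      rw [← SpecialLinearGroup.coe_mul, mul_inv_cancel, SpecialLinearGroup.coe_one]
    have h2 : ((h⁻¹ : SpecialLinearGroup (Fin n) R) : Matrix (Fin n) (Fin n) R) * h = 1 := by
      rw [← SpecialLinearGroup.coe_mul, inv_mul_cancel, SpecialLinearGroup.coe_one]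
    have h3 : SemiconjBy (h : Matrix (Fin n) (Fin n) R) ((g : Matrix (Fin n) (Fin n) R) - 1)
        (((h * g * h⁻¹ : SpecialLinearGroup (Fin n) R) : Matrix (Fin n) (Fin n) R) - 1) := by
      rw [SemiconjBy, mul_sub, sub_mul, SpecialLinearGroup.coe_mul, SpecialLinearGroup.coe_mul,
        Matrix.mul_assoc _ _ (h : Matrix (Fin n) (Fin n) R), h2]
      simp
    have h4 := (h3.pow_right k).eq
    rw [hk, mul_zero] at h4
    have h5 := congrArg (· * ((h⁻¹ : SpecialLinearGroup (Fin n) R) : Matrix (Fin n) (Fin n) R)) h4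
    simpa only [Matrix.mul_assoc, h1, Matrix.mul_one, Matrix.zero_mul, eq_comm] using h5
  have key' : ∀ k, (((h * g * h⁻¹ : SpecialLinearGroup (Fin n) R) : Matrix (Fin n) (Fin n) R) - 1)
      ^ k = 0 ↔ ((g : Matrix (Fin n) (Fin n) R) - 1) ^ k = 0 := fun k =>
    ⟨fun hk => by simpa [mul_assoc] using key h⁻¹ _ k hk, key h g k⟩
  rw [IsRegularUnipotent, IsRegularUnipotent, key', Ne, key']

theorem mul_lowerBidiagonal_apply (Q : Matrix (Fin n) (Fin n) R) (b : Fin n → R) (i j : Fin n) :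
    (Q * lowerBidiagonal b) i j =
      Q i j + if h : (j : ℕ) + 1 < n then Q i ⟨j + 1, h⟩ * b ⟨j + 1, h⟩ else 0 := by
  rw [lowerBidiagonal, Matrix.mul_add, Matrix.mul_one, add_apply, mul_apply]
  congr 1
  split_ifs with h
  · rw [Finset.sum_eq_single (⟨j + 1, h⟩ : Fin n)]
    · simp
    · intro l _ hl
      have : (l : ℕ) ≠ j + 1 := fun h' => hl (Fin.ext h')
      simp [this]
    · simp
  · refine Finset.sum_eq_zero fun l _ => ?_
    have : (l : ℕ) ≠ j + 1 := by omega
    simp [this]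

theorem lowerBidiagonal_mul_apply (Q : Matrix (Fin n) (Fin n) R) (b : Fin n → R) (i j : Fin n) :
    (lowerBidiagonal b * Q) i j =
      Q i j + if (i : ℕ) = 0 then 0 else b i * Q ⟨i - 1, by omega⟩ j := by
  rw [lowerBidiagonal, Matrix.add_mul, Matrix.one_mul, add_apply, mul_apply]
  congr 1
  split_ifs with h
  · refine Finset.sum_eq_zero fun l _ => ?_
    simp [h]
  · rw [Finset.sum_eq_single (⟨i - 1, by omega⟩ : Fin n)]
    · have : (i : ℕ) = i - 1 + 1 := by omega
      simp [← this]
    · intro l _ hl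
      have : (i : ℕ) ≠ l + 1 := fun h' => hl (Fin.ext (by simp only; omega))
      simp [this]
    · simp

/-- For every diagonal there is a unipotent change of basis `P` under which the Jordan block
agrees, away from the last column, with a lower bidiagonal matrix with that diagonal. -/
theorem exists_isStrictUpper_lowerBidiagonal_mul_eq (d : Fin n → R) :
    ∃ P : Matrix (Fin n) (Fin n) R, (P - 1).IsStrictUpper ∧
      ∀ i j : Fin n, ∀ h : (j : ℕ) + 1 < n,
        (lowerBidiagonal (1 : Fin n → R) * P) i j = P i j * d j + P i ⟨j + 1, h⟩ := by
  let p : ℕ → ℕ → R := Nat.rec (fun i => if i = 0 then 1 else 0) fun j q i =>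
    (if h : j < n then 1 - d ⟨j, h⟩ else 0) * q i + if i = 0 then 0 else q (i - 1)
  have h0 : ∀ i, p 0 i = if i = 0 then 1 else 0 := fun i => rfl
  have hs : ∀ j i, p (j + 1) i = (if h : j < n then 1 - d ⟨j, h⟩ else 0) * p j i +
    if i = 0 then 0 else p j (i - 1) := fun j i => rfl
  clear_value p
  have hlt : ∀ j i, j < i → p j i = 0 := by
    intro j
    induction j with
    | zero => intro i hi; rw [h0, if_neg (by omega)]
    | succ j ih =>
      intro i hi
      rw [hs, ih i (by omega), ih (i - 1) (by omega)]
      simp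
  have heq : ∀ j, p j j = 1 := by
    intro j
    induction j with
    | zero => simp [h0]
    | succ j ih => rw [hs, hlt j (j + 1) (by omega)]; simp [ih]
  refine ⟨of fun i j => p j i, fun i j hij => ?_, fun i j h => ?_⟩
  · rcases eq_or_lt_of_le hij with rfl | hij
    · simp [heq]
    · simp [hlt j i hij, one_apply_ne (ne_of_gt hij)]
  · rw [lowerBidiagonal_mul_apply]
    simp only [of_apply, hs, Pi.one_apply, j.isLt, dite_true, one_mul]
    ring

end CommRing

section Field

variable {F : Type*} [Field F] {n : ℕ}

theorem IsRegularUnipotent.exists_conj_lowerBidiagonal [IsAlgClosed F] (hn : 0 < n)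
    {M : Matrix (Fin n) (Fin n) F} (hM : M.IsRegularUnipotent) :
    ∃ S : SpecialLinearGroup (Fin n) F,
      M * (S : Matrix (Fin n) (Fin n) F) = S * lowerBidiagonal (1 : Fin n → F) := by
  obtain ⟨v, hv⟩ : ∃ v, ((M - 1) ^ (n - 1)) *ᵥ v ≠ 0 := by
    by_contra! h
    exact hM.2 (ext_of_mulVec_single fun i => by rw [h, zero_mulVec])
  have hnil := hM.1
  set N := M - 1 with hN
  let Q : Matrix (Fin n) (Fin n) F := of fun i j => ((N ^ (j : ℕ)) *ᵥ v) i
  have hQ : M * Q = Q * lowerBidiagonal 1 := by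
    have hM1 : M = 1 + N := by rw [hN]; abel
    ext i j
    rw [mul_lowerBidiagonal_apply, hM1, Matrix.add_mul, Matrix.one_mul, add_apply]
    congr 1
    have h1 : (N * Q) i j = ((N ^ ((j : ℕ) + 1)) *ᵥ v) i := by
      rw [pow_succ', ← mulVec_mulVec]; rfl
    rw [h1]
    split_ifs with h
    · simp [Q]
    · have : (j : ℕ) + 1 = n := by omega
      rw [this, hnil, zero_mulVec, Pi.zero_apply]
  have hdet : Q.det ≠ 0 := by
    intro h
    obtain ⟨c, hc, hQc⟩ := exists_mulVec_eq_zero_iff.2 h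
    have hsum : ∑ j : Fin n, c j • ((N ^ (j : ℕ)) *ᵥ v) = 0 := by
      rw [← hQc]
      ext i
      simp [Q, mulVec, dotProduct, mul_comm]
    have hzero : ∀ m : ℕ, ∀ j : Fin n, (j : ℕ) = m → c j = 0 := by
      intro m
      induction m using Nat.strong_induction_on with
      | _ m ih =>
        intro j hj
        have h2 := congrArg (fun w => (N ^ (n - 1 - j)) *ᵥ w) hsum
        simp only [mulVec_sum, mulVec_smul, mulVec_mulVec, ← pow_add, mulVec_zero] at h2
        rw [Finset.sum_eq_single j] at h2
        · rw [Nat.sub_add_cancel (by omega)] at h2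
          exact (smul_eq_zero.1 h2).resolve_right hv
        · intro l _ hl
          have hne : (l : ℕ) ≠ j := fun h' => hl (Fin.ext h')
          by_cases hlt : (l : ℕ) < j
          · rw [ih l (by omega) l rfl, zero_smul]
          · rw [pow_eq_zero_of_le (by omega) hnil, zero_mulVec, smul_zero]
        · simp
    exact hc (funext fun j => hzero j j rfl)
  obtain ⟨c, hc⟩ := IsAlgClosed.exists_pow_nat_eq (Q.det)⁻¹ hn
  refine ⟨⟨c • Q, ?_⟩, ?_⟩
  · rw [det_smul, Fintype.card_fin, hc, inv_mul_cancel₀ hdet]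
  · simp only [Matrix.mul_smul, Matrix.smul_mul, hQ]

theorem IsRegularUnipotent.exists_conj [IsAlgClosed F] (hn : 0 < n)
    {u g : SpecialLinearGroup (Fin n) F} (hu : (u : Matrix (Fin n) (Fin n) F).IsRegularUnipotent)
    (hg : (g : Matrix (Fin n) (Fin n) F).IsRegularUnipotent) :
    ∃ h : SpecialLinearGroup (Fin n) F, g = h * u * h⁻¹ := by
  obtain ⟨S, hS⟩ := hu.exists_conj_lowerBidiagonal hn
  obtain ⟨T, hT⟩ := hg.exists_conj_lowerBidiagonal hn
  let J : SpecialLinearGroup (Fin n) F := ⟨lowerBidiagonal 1, det_lowerBidiagonal 1⟩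
  have hS' : u * S = S * J := Subtype.ext hS
  have hT' : g * T = T * J := Subtype.ext hT
  refine ⟨T * S⁻¹, ?_⟩
  rw [eq_mul_inv_of_mul_eq hT', eq_mul_inv_of_mul_eq hS']
  group

theorem exists_eq_mul_of_isStrictUpper_sub_one [Infinite F] (hn : 0 < n)
    (w : SpecialLinearGroup (Fin n) F)
    (hw : ((w : Matrix (Fin n) (Fin n) F) - 1).IsStrictUpper) :
    ∃ a b : SpecialLinearGroup (Fin n) F, (a : Matrix (Fin n) (Fin n) F).IsRegularUnipotent ∧
      (b : Matrix (Fin n) (Fin n) F).IsRegularUnipotent ∧ w = a * b := by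
  have hex : ∀ i : Fin n, ∃ b : F, b ≠ 0 ∧
      ∀ j : Fin n, (i : ℕ) = j + 1 → (w : Matrix (Fin n) (Fin n) F) j i + b ≠ 0 := by
    intro i
    classical
    obtain ⟨b, hb⟩ := Infinite.exists_notMem_finset
      (insert 0 (Finset.univ.image fun j => -(w : Matrix (Fin n) (Fin n) F) j i))
    simp only [Finset.mem_insert, Finset.mem_image, Finset.mem_univ, true_and, not_or,
      not_exists] at hb
    exact ⟨b, hb.1, fun j _ h => hb.2 j (neg_eq_of_add_eq_zero_right h)⟩
  choose b hb hb' using hex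
  let V : SpecialLinearGroup (Fin n) F :=
    ⟨(lowerBidiagonal b)ᵀ, by rw [det_transpose, det_lowerBidiagonal]⟩
  have hV : (V : Matrix (Fin n) (Fin n) F).IsRegularUnipotent :=
    isRegularUnipotent_transpose_lowerBidiagonal hn hb
  have hV1 : ((V : Matrix (Fin n) (Fin n) F) - 1).IsStrictUpper :=
    isStrictUpper_transpose_lowerBidiagonal_sub_one b
  have hV2 : ∀ i j : Fin n, (j : ℕ) = i + 1 → (V : Matrix (Fin n) (Fin n) F) i j = b j :=
    fun i j h => lowerBidiagonal_apply_succ b j i h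
  refine ⟨w * V, V⁻¹, ?_, hV.inv, by group⟩
  rw [SpecialLinearGroup.coe_mul]
  generalize (V : Matrix (Fin n) (Fin n) F) = V at hV1 hV2
  generalize (w : Matrix (Fin n) (Fin n) F) = W at hw hb'
  have hprod : W * V = (W - 1) * (V - 1) + (W + V - 1) := by noncomm_ring
  have hzero : ∀ i j : Fin n, (j : ℕ) ≤ i + 1 → ((W - 1) * (V - 1)) i j = 0 := by
    intro i j hij
    rw [mul_apply]
    refine Finset.sum_eq_zero fun l _ => ?_
    by_cases hl : l ≤ i
    · rw [hw i l hl, zero_mul]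
    · rw [hV1 l j (Fin.le_def.2 (by rw [Fin.le_def] at hl; omega)), mul_zero]
  refine IsStrictUpper.isRegularUnipotent hn (fun i j hij => ?_) fun i j hij => ?_
  · have h1 := hw i j hij
    have h2 := hV1 i j hij
    have h3 := hzero i j (by have := Fin.le_def.1 hij; omega)
    rw [sub_apply] at h1 h2
    rw [hprod, sub_apply, add_apply, h3, sub_apply, add_apply]
    linear_combination h1 + h2
  · have hne : i ≠ j := fun h' => by rw [h'] at hij; omega
    rw [hprod, add_apply, hzero i j (by omega), sub_apply, add_apply, one_apply_ne hne,
      hV2 i j hij, zero_add, sub_zero]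
    exact hb' j i hij

theorem exists_eq_mul_of_diagonal [Infinite F] (hn : 0 < n) (g : SpecialLinearGroup (Fin n) F)
    (hg : ∀ i j, i ≠ j → (g : Matrix (Fin n) (Fin n) F) i j = 0) :
    ∃ a b c e : SpecialLinearGroup (Fin n) F, (a : Matrix (Fin n) (Fin n) F).IsRegularUnipotent ∧
      (b : Matrix (Fin n) (Fin n) F).IsRegularUnipotent ∧
      (c : Matrix (Fin n) (Fin n) F).IsRegularUnipotent ∧
      (e : Matrix (Fin n) (Fin n) F).IsRegularUnipotent ∧ g = a * b * c * e := by
  let d : Fin n → F := fun i => (g : Matrix (Fin n) (Fin n) F) i i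
  have hgd : (g : Matrix (Fin n) (Fin n) F) = diagonal d := by
    ext i j
    by_cases h : i = j
    · subst h; simp [d]
    · rw [hg i j h, diagonal_apply_ne _ h]
  have hd : ∀ i, d i ≠ 0 := by
    have h1 := g.det_coe
    rw [hgd, det_diagonal] at h1
    intro i hi
    rw [Finset.prod_eq_zero (Finset.mem_univ i) hi] at h1
    exact zero_ne_one h1
  obtain ⟨P, hP, hPcol⟩ := exists_isStrictUpper_lowerBidiagonal_mul_eq d
  let p : SpecialLinearGroup (Fin n) F := ⟨P, hP.det_eq_one⟩
  let J : SpecialLinearGroup (Fin n) F := ⟨lowerBidiagonal 1, det_lowerBidiagonal 1⟩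
  let l : SpecialLinearGroup (Fin n) F :=
    ⟨lowerBidiagonal fun i => (d i)⁻¹, det_lowerBidiagonal _⟩
  have hJ : (J : Matrix (Fin n) (Fin n) F).IsRegularUnipotent :=
    (isRegularUnipotent_transpose_lowerBidiagonal hn fun _ => one_ne_zero).of_transpose
  have hl : (l : Matrix (Fin n) (Fin n) F).IsRegularUnipotent :=
    (isRegularUnipotent_transpose_lowerBidiagonal hn fun i => inv_ne_zero (hd i)).of_transpose
  let w : SpecialLinearGroup (Fin n) F := (J * p)⁻¹ * (p * g * l)
  have hcol : ∀ i j : Fin n, (j : ℕ) + 1 < n →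
      ((w : Matrix (Fin n) (Fin n) F) - 1) i j = 0 := by
    intro i j hj
    have h1 : (w : Matrix (Fin n) (Fin n) F) - 1 =
        ((J * p)⁻¹ : SpecialLinearGroup (Fin n) F) *
          (((p * g * l : SpecialLinearGroup (Fin n) F) : Matrix (Fin n) (Fin n) F) -
            ((J * p : SpecialLinearGroup (Fin n) F) : Matrix (Fin n) (Fin n) F)) := by
      rw [Matrix.mul_sub, ← SpecialLinearGroup.coe_mul, ← SpecialLinearGroup.coe_mul,
        inv_mul_cancel, SpecialLinearGroup.coe_one]
    rw [h1, mul_apply]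
    refine Finset.sum_eq_zero fun k _ => ?_
    have h2 : ((p * g * l : SpecialLinearGroup (Fin n) F) : Matrix (Fin n) (Fin n) F) k j =
        ((J * p : SpecialLinearGroup (Fin n) F) : Matrix (Fin n) (Fin n) F) k j := by
      rw [SpecialLinearGroup.coe_mul, SpecialLinearGroup.coe_mul, SpecialLinearGroup.coe_mul,
        hgd]
      change (P * diagonal d * lowerBidiagonal fun i : Fin n => (d i)⁻¹) k j =
        (lowerBidiagonal (1 : Fin n → F) * P) k j
      rw [hPcol k j hj, mul_lowerBidiagonal_apply, dif_pos hj, mul_diagonal, mul_diagonal,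
        mul_assoc, mul_inv_cancel₀ (hd _), mul_one]
    rw [sub_apply, h2, sub_self, mul_zero]
  have hw : ((w : Matrix (Fin n) (Fin n) F) - 1).IsStrictUpper := by
    have hupper : ∀ i j, j < i → (w : Matrix (Fin n) (Fin n) F) i j = 0 := by
      intro i j hij
      have := hcol i j (by have := Fin.lt_def.1 hij; omega)
      rwa [sub_apply, one_apply_ne (ne_of_gt hij), sub_zero] at this
    have hdiag : ∀ j : Fin n, (j : ℕ) + 1 < n → (w : Matrix (Fin n) (Fin n) F) j j = 1 :=
      fun j hj => by simpa [sub_eq_zero] using hcol j j hj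
    intro i j hij
    by_cases hj : (j : ℕ) + 1 < n
    · exact hcol i j hj
    · obtain rfl : i = j := Fin.ext (by have := Fin.le_def.1 hij; omega)
      have hdet := w.det_coe
      rw [det_of_isUpperTriangular fun i j hij => hupper i j hij, Finset.prod_eq_single i] at hdet
      · rw [sub_apply, hdet, one_apply_eq, sub_self]
      · intro k _ hk
        have : (k : ℕ) ≠ i := fun h' => hk (Fin.ext h')
        exact hdiag k (by omega)
      · simp
  obtain ⟨a, b, ha, hb, hab⟩ := exists_eq_mul_of_isStrictUpper_sub_one hn w hw
  have hH := (isRegularUnipotent_conj_iff p⁻¹ J).2 hJ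
  refine ⟨_, a, b, l⁻¹, hH, ha, hb, hl.inv, ?_⟩
  rw [mul_assoc _ a b, ← hab]
  simp only [w]
  group

end Field

end Matrix

open Pointwise

/-- For `n ≥ 13`, the 36-th power of the conjugacy class of a regular unipotent
element of `SL_n(F)` contains every diagonal matrix of `SL_n(F)`. -/
theorem diagonal_mem_pow_36_of_regular_unipotent_class {F : Type*} [Field F]
    [IsAlgClosed F] (n : ℕ) (hn : 13 ≤ n)
    (u : Matrix.SpecialLinearGroup (Fin n) F)
    (hu : ((u : Matrix (Fin n) (Fin n) F) - 1) ^ n = 0)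
    (hu' : ((u : Matrix (Fin n) (Fin n) F) - 1) ^ (n - 1) ≠ 0)
    (C : Set (Matrix.SpecialLinearGroup (Fin n) F))
    (hC : C = {g | ∃ h : Matrix.SpecialLinearGroup (Fin n) F, g = h * u * h⁻¹}) :
    ∀ g : Matrix.SpecialLinearGroup (Fin n) F,
      (∀ i j : Fin n, i ≠ j → (g : Matrix (Fin n) (Fin n) F) i j = 0) →
      g ∈ C ^ 36 := by
  have hpos : 0 < n := by omega
  have hmem : ∀ g : Matrix.SpecialLinearGroup (Fin n) F,
      (g : Matrix (Fin n) (Fin n) F).IsRegularUnipotent → g ∈ C := fun g hg => by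
    rw [hC]
    exact Matrix.IsRegularUnipotent.exists_conj hpos ⟨hu, hu'⟩ hg
  have hfour : ∀ g : Matrix.SpecialLinearGroup (Fin n) F,
      (∀ i j : Fin n, i ≠ j → (g : Matrix (Fin n) (Fin n) F) i j = 0) → g ∈ C ^ 4 := by
    intro g hg
    obtain ⟨a, b, c, e, ha, hb, hc, he, rfl⟩ := Matrix.exists_eq_mul_of_diagonal hpos g hg
    rw [pow_succ, pow_succ, pow_two]
    exact Set.mul_mem_mul (Set.mul_mem_mul (Set.mul_mem_mul (hmem a ha) (hmem b hb)) (hmem c hc))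
      (hmem e he)
  intro g hg
  have hone : (1 : Matrix.SpecialLinearGroup (Fin n) F) ∈ (C ^ 4) ^ 8 := by
    have h1 : (1 : Matrix.SpecialLinearGroup (Fin n) F) ∈ C ^ 4 :=
      hfour 1 fun i j hij => by rw [Matrix.SpecialLinearGroup.coe_one, Matrix.one_apply_ne hij]
    simpa using Set.pow_mem_pow (n := 8) h1
  rw [show 36 = 4 * 8 + 4 from rfl, pow_add, pow_mul, ← one_mul g]
  exact Set.mul_mem_mul hone (hfour g hg)
end

section
/- Let F be an algebraically closed field, n ≥ 2, and let u ∈ SL_n(F) be a unipotent element (i.e., (u − 1)^n = 0 as a matrix) with u ≠ 1. Let ℓ = dim_F ker(u − 1) be the dimension of the fixed space of u (the number of Jordan blocks of u), so ℓ < n. Let C = {h u h⁻¹ : h ∈ SL_n(F)} be the conjugacy class of u. Then there exists a positive integer k with k·(n − ℓ) ≤ 288·(n − 1) such that C^k = SL_n(F). -/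
open Pointwise

section CyclicGenerators

open Polynomial DirectSum

variable {F V : Type*} [Field F] [AddCommGroup V] [Module F V]

/-- The vectors `g i` generate `V` as an `F[N]`-module, and `V` is the direct sum of the cyclic
submodules they generate, `g i` being killed by `N ^ k i`. -/
structure CyclicGenerators (N : Module.End F V) {d : ℕ} (k : Fin d → ℕ) (g : Fin d → V) :
    Prop where
  pow_apply : ∀ i, (N ^ k i) (g i) = 0
  sum_eq : ∑ i, k i = Module.finrank F V
  eq_top : ∀ W : Submodule F V, (∀ x ∈ W, N x ∈ W) → (∀ i, g i ∈ W) → W = ⊤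

theorem exists_cyclicGenerators [FiniteDimensional F V] (N : Module.End F V)
    (hN : IsNilpotent N) :
    ∃ (d : ℕ) (k : Fin d → ℕ) (g : Fin d → V), CyclicGenerators N k g := by
  classical
  obtain ⟨m, hm⟩ := hN
  obtain ⟨d, k, ⟨e⟩⟩ := Module.torsion_by_prime_power_decomposition
    (R := F[X]) (M := Module.AEval' N) (p := X) irreducible_X (by
      intro x
      refine ⟨⟨X ^ m, m, rfl⟩, ?_⟩
      obtain ⟨y, rfl⟩ := (Module.AEval'.of N).surjective x
      change (X ^ m : F[X]) • Module.AEval'.of N y = 0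
      rw [Module.AEval'.X_pow_smul_of, hm]
      simp)
  set φ := Module.AEval'.of N
  let v : Fin d → Module.AEval' N := fun i => e.symm (lof F[X] (Fin d) _ i (Submodule.Quotient.mk 1))
  refine ⟨d, k, fun i => φ.symm (v i), ?_, ?_, ?_⟩
  · intro i
    apply φ.injective
    have := Module.AEval'.X_pow_smul_of N (φ.symm (v i)) (k i)
    simp only [Module.End.smul_def] at this
    rw [← this, map_zero]
    change (X ^ k i : F[X]) • φ (φ.symm (v i)) = 0
    rw [LinearEquiv.apply_symm_apply]
    simp only [v]
    rw [← map_smul, ← map_smul, ← Submodule.Quotient.mk_smul, (Submodule.Quotient.mk_eq_zero _).2]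
    · simp
    · simp
  · rw [(φ.trans (e.restrictScalars F)).finrank_eq]
    have hfin : ∀ i, Module.Finite F (F[X] ⧸ F[X] ∙ (X : F[X]) ^ k i) := fun i => by
      have := (monic_X_pow (R := F) (k i)).finite_quotient
      exact this
    rw [Module.finrank_directSum]
    refine Finset.sum_congr rfl fun i _ => ?_
    have := finrank_quotient_span_eq_natDegree (f := (X ^ k i : F[X]))
    rw [natDegree_X_pow] at this
    exact this.symm
  · intro W hW hg
    rw [eq_top_iff]
    intro x _
    have key : ∀ (p : F[X]) (y : V), y ∈ W → φ.symm (p • φ y) ∈ W := by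
      intro p y hy
      induction p using Polynomial.induction_on' with
      | add p q hp hq => rw [add_smul, map_add]; exact W.add_mem hp hq
      | monomial n a =>
        rw [← C_mul_X_pow_eq_monomial, mul_smul, Module.AEval'.X_pow_smul_of]
        have : ∀ n, (N ^ n) y ∈ W := by
          intro n
          induction n with
          | zero => simpa
          | succ n ih => rw [pow_succ']; exact hW _ ih
        have h2 : (C a : F[X]) • φ (N ^ n • y) = φ (a • (N ^ n • y)) := by
          rw [LinearEquiv.map_smul φ a]; exact Module.AEval.C_smul _ _ _
        rw [h2, LinearEquiv.symm_apply_apply]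
        exact W.smul_mem _ (this n)
    have : ∀ z : ⨁ i : Fin d, F[X] ⧸ F[X] ∙ (X : F[X]) ^ k i, φ.symm (e.symm z) ∈ W := by
      intro z
      induction z using DirectSum.induction_on with
      | zero => simp
      | add x y hx hy => rw [map_add, map_add]; exact W.add_mem hx hy
      | of i x =>
        obtain ⟨p, rfl⟩ := Submodule.Quotient.mk_surjective _ x
        have h3 := key p _ (hg i)
        rw [LinearEquiv.apply_symm_apply] at h3
        convert h3 using 2
        simp only [v]
        rw [← map_smul, ← map_smul, ← Submodule.Quotient.mk_smul, smul_eq_mul, mul_one]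
        rfl
    have h4 := this (e (φ x))
    simpa using h4

/-- A family indexed by `Σ i, Fin (k i)` that is stable under `N` up to its span and contains the
generators in its span is a basis. -/
theorem CyclicGenerators.exists_basis [FiniteDimensional F V] {N : Module.End F V} {d : ℕ}
    {k : Fin d → ℕ} {g : Fin d → V} (h : CyclicGenerators N k g) (y : (Σ i, Fin (k i)) → V)
    (hN : ∀ s, N (y s) ∈ Submodule.span F (Set.range y))
    (hg : ∀ i, g i ∈ Submodule.span F (Set.range y)) :
    ∃ b : Module.Basis (Σ i, Fin (k i)) F V, ⇑b = y := by
  refine ⟨basisOfTopLeSpanOfCardEqFinrank y (h.eq_top _ ?_ hg).ge ?_,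
    coe_basisOfTopLeSpanOfCardEqFinrank _ _ _⟩
  · intro x hx
    induction hx using Submodule.span_induction with
    | mem x hx => obtain ⟨s, rfl⟩ := hx; exact hN s
    | zero => simp
    | add x y _ _ hx hy => rw [map_add]; exact Submodule.add_mem _ hx hy
    | smul a x _ hx => rw [map_smul]; exact Submodule.smul_mem _ _ hx
  · simp [h.sum_eq]

theorem CyclicGenerators.generator_mem [FiniteDimensional F V] {N : Module.End F V} {d : ℕ}
    {k : Fin d → ℕ} {g : Fin d → V} (h : CyclicGenerators N k g) (W : Submodule F V) (i : Fin d)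
    (hi : 0 < k i → g i ∈ W) : g i ∈ W := by
  rcases Nat.eq_zero_or_pos (k i) with h0 | h0
  · have := h.pow_apply i
    rw [h0, pow_zero, Module.End.one_apply] at this
    rw [this]
    exact W.zero_mem
  · exact hi h0

/-- Basis of a nilpotent operator adapted to its cyclic decomposition. -/
theorem CyclicGenerators.exists_jordan_basis [FiniteDimensional F V] {N : Module.End F V} {d : ℕ}
    {k : Fin d → ℕ} {g : Fin d → V} (h : CyclicGenerators N k g) :
    ∃ b : Module.Basis (Σ i, Fin (k i)) F V,
      ∀ s, N (b s) = if hs : s.2.1 + 1 < k s.1 then b ⟨s.1, s.2.1 + 1, hs⟩ else 0 := by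
  have hN : ∀ s : Σ i, Fin (k i), N ((N ^ s.2.1) (g s.1)) =
      if hs : s.2.1 + 1 < k s.1 then (N ^ (s.2.1 + 1)) (g s.1) else 0 := by
    intro s
    rw [← Module.End.mul_apply, ← pow_succ']
    split_ifs with hs
    · rfl
    · have : s.2.1 + 1 = k s.1 := by have := s.2.2; omega
      rw [this, h.pow_apply]
  obtain ⟨b, hb⟩ := h.exists_basis (fun s => (N ^ s.2.1) (g s.1)) (by
    intro s
    rw [hN]
    split_ifs with hs
    · exact Submodule.subset_span ⟨⟨s.1, s.2.1 + 1, hs⟩, rfl⟩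
    · exact Submodule.zero_mem _) (fun i => h.generator_mem _ i fun hi =>
      Submodule.subset_span ⟨⟨i, 0, hi⟩, by simp⟩)
  refine ⟨b, fun s => ?_⟩
  simp only [hb]
  exact hN s

/-- A unipotent operator is conjugate to its inverse. -/
theorem exists_conj_inverse [FiniteDimensional F V] (f f' : Module.End F V) (hff' : f * f' = 1)
    (hf : IsNilpotent (f - 1)) : ∃ T : V ≃ₗ[F] V, ∀ x, T (f x) = f' (T x) := by
  have hf'f : f' * f = 1 := by
    have := (mul_eq_one_comm (a := f) (b := f')).1 hff'
    exact this
  obtain ⟨d, k, g, h⟩ := exists_cyclicGenerators (f - 1) hf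
  have hfac : f' - 1 = (-f') * (f - 1) := by
    rw [mul_sub, neg_mul, hf'f, mul_one]; abel
  have hcomm : Commute (-f') (f - 1) := by
    have : Commute f' f := by rw [Commute, SemiconjBy, hff', hf'f]
    exact (this.sub_right (Commute.one_right _)).neg_left
  have h' : CyclicGenerators (f' - 1) k g := by
    refine ⟨fun i => ?_, h.sum_eq, fun W hW hg => h.eq_top W ?_ hg⟩
    · rw [hfac, hcomm.mul_pow, Module.End.mul_apply, h.pow_apply, map_zero]
    · let E : V ≃ₗ[F] V := LinearEquiv.ofLinearMap f' f hf'f hff'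
      have hle : W.map (E : V →ₗ[F] V) ≤ W := by
        rintro _ ⟨x, hx, rfl⟩
        have := W.add_mem (hW x hx) hx
        simpa [E] using this
      have heq : W.map (E : V →ₗ[F] V) = W :=
        Submodule.eq_of_le_of_finrank_eq hle (LinearEquiv.finrank_map_eq E W)
      intro x hx
      rw [← heq] at hx
      obtain ⟨z, hz, rfl⟩ := hx
      have : f (f' z) = z := by rw [← Module.End.mul_apply, hff']; rfl
      simp only [E, LinearMap.sub_apply, Module.End.one_apply]
      have h2 : ((LinearEquiv.ofLinearMap f' f hf'f hff' : V ≃ₗ[F] V) : V →ₗ[F] V) z = f' z := rfl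
      rw [h2, this]
      exact W.sub_mem hz (hle ⟨z, hz, rfl⟩)
  obtain ⟨b, hb⟩ := h.exists_jordan_basis
  obtain ⟨b', hb'⟩ := h'.exists_jordan_basis
  let T := b.equiv b' (Equiv.refl _)
  have hT : ∀ s, T (b s) = b' s := fun s => by simp [T]
  have key : (T : V →ₗ[F] V) ∘ₗ (f - 1) = (f' - 1) ∘ₗ (T : V →ₗ[F] V) := by
    refine b.ext fun s => ?_
    simp only [LinearMap.comp_apply, LinearEquiv.coe_coe]
    rw [hT, hb, hb']
    split_ifs with hs
    · exact hT _
    · simp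
  refine ⟨T, fun x => ?_⟩
  have := LinearMap.congr_fun key x
  simpa using this

/-- The rank of `N` is at most twice the number of pairs of consecutive vectors in its Jordan
chains. -/
theorem CyclicGenerators.finrank_range_le [FiniteDimensional F V] {N : Module.End F V} {d : ℕ}
    {k : Fin d → ℕ} {g : Fin d → V} (h : CyclicGenerators N k g) :
    Module.finrank F (LinearMap.range N) ≤ 2 * ∑ i, k i / 2 := by
  obtain ⟨b, hb⟩ := h.exists_jordan_basis
  let z : (Σ i, Fin (k i - 1)) → V := fun s => b ⟨s.1, s.2.1 + 1, by have := s.2.2; omega⟩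
  have hle : LinearMap.range N ≤ Submodule.span F (Set.range z) := by
    rw [LinearMap.range_eq_map, ← b.span_eq, Submodule.map_span, Submodule.span_le]
    rintro _ ⟨_, ⟨s, rfl⟩, rfl⟩
    simp only [SetLike.mem_coe]
    rw [hb]
    split_ifs with hs
    · exact Submodule.subset_span ⟨⟨s.1, s.2.1, by omega⟩, rfl⟩
    · exact Submodule.zero_mem _
  calc Module.finrank F (LinearMap.range N)
      ≤ Module.finrank F (Submodule.span F (Set.range z)) := Submodule.finrank_mono hle
    _ ≤ Fintype.card (Σ i, Fin (k i - 1)) := finrank_range_le_card z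
    _ = ∑ i, (k i - 1) := by simp
    _ ≤ ∑ i, 2 * (k i / 2) := Finset.sum_le_sum fun i _ => by omega
    _ = 2 * ∑ i, k i / 2 := (Finset.mul_sum _ _ _).symm

/-- A unipotent operator `f` with inverse `f'` admits a basis containing at least `rank (f - 1) / 2`
disjoint pairs `(v, f v)` such that the coordinate along `f v` of `f' x` is minus the coordinate
along `v` of `x`. The basis consists of the vectors `w ^ l g` and `f w ^ l g`, where
`w = f + f' - 2`. -/
theorem exists_pair_basis [FiniteDimensional F V] (f f' : Module.End F V) (hff' : f * f' = 1)
    (hf : IsNilpotent (f - 1)) :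
    ∃ (ι P : Type) (_ : Fintype ι) (_ : Fintype P) (y : Module.Basis ι F V) (p : P ⊕ P → ι),
      Function.Injective p ∧ (∀ a, f (y (p (.inl a))) = y (p (.inr a))) ∧
      (∀ a x, y.coord (p (.inr a)) (f' x) = - y.coord (p (.inl a)) x) ∧
      Module.finrank F (LinearMap.range (f - 1)) ≤ 2 * Fintype.card P := by
  classical
  have hf'f : f' * f = 1 := (mul_eq_one_comm (a := f) (b := f')).1 hff'
  have hff'x : ∀ x, f (f' x) = x := fun x => LinearMap.congr_fun hff' x
  have hf'fx : ∀ x, f' (f x) = x := fun x => LinearMap.congr_fun hf'f x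
  obtain ⟨d, k, g, h⟩ := exists_cyclicGenerators (f - 1) hf
  set w : Module.End F V := f' * (f - 1) ^ 2 with hw
  have hwx : ∀ x, w x = f x + f' x - 2 • x := by
    intro x
    simp only [hw, pow_two, Module.End.mul_apply, LinearMap.sub_apply, Module.End.one_apply,
      map_sub, hf'fx]
    rw [two_smul]; abel
  have hcomm : Commute f' (f - 1) := by
    have : Commute f' f := by rw [Commute, SemiconjBy, hff', hf'f]
    exact this.sub_right (Commute.one_right _)
  have hcf : Commute f w :=
    (show Commute f f' by rw [Commute, SemiconjBy, hff', hf'f]).mul_right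
      (((Commute.refl f).sub_right (Commute.one_right _)).pow_right 2)
  have hwl : ∀ l, w ^ l = f' ^ l * (f - 1) ^ (2 * l) := by
    intro l
    rw [hw, (hcomm.pow_right 2).mul_pow, pow_mul]
  have hpow : ∀ i m, k i ≤ m → ((f - 1) ^ m) (g i) = 0 := by
    intro i m hm
    rw [← Nat.sub_add_cancel hm, pow_add, Module.End.mul_apply, h.pow_apply, map_zero]
  have hw0 : ∀ i l, k i ≤ 2 * l → (w ^ l) (g i) = 0 := by
    intro i l hl
    rw [hwl, Module.End.mul_apply, hpow i _ hl, map_zero]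
  have hw1 : ∀ i l, k i ≤ 2 * l + 1 → f ((w ^ l) (g i)) = (w ^ l) (g i) := by
    intro i l hl
    have h1 : (f - 1) ((w ^ l) (g i)) = 0 := by
      rw [hwl, ← Module.End.mul_apply, ← mul_assoc,
        ((hcomm.symm.pow_right l).eq : (f - 1) * f' ^ l = f' ^ l * (f - 1)), mul_assoc,
        ← pow_succ', Module.End.mul_apply, hpow i _ hl, map_zero]
    rwa [LinearMap.sub_apply, Module.End.one_apply, sub_eq_zero] at h1
  let Y : (Σ i, Fin (k i)) → V := fun s =>
    if Even s.2.1 then (w ^ (s.2.1 / 2)) (g s.1) else f ((w ^ (s.2.1 / 2)) (g s.1))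
  have hY0 : ∀ i l (hl : 2 * l < k i), Y ⟨i, 2 * l, hl⟩ = (w ^ l) (g i) := by
    intro i l hl
    simp [Y]
  have hY1 : ∀ i l (hl : 2 * l + 1 < k i), Y ⟨i, 2 * l + 1, hl⟩ = f ((w ^ l) (g i)) := by
    intro i l hl
    have h1 : ¬ Even (2 * l + 1) := by simp
    have h2 : (2 * l + 1) / 2 = l := by omega
    simp only [Y, if_neg h1, h2]
  have hmem0 : ∀ i l, (w ^ l) (g i) ∈ Submodule.span F (Set.range Y) := by
    intro i l
    rcases lt_or_ge (2 * l) (k i) with hl | hl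
    · rw [← hY0 i l hl]; exact Submodule.subset_span ⟨_, rfl⟩
    · rw [hw0 i l hl]; exact Submodule.zero_mem _
  have hmem1 : ∀ i l, f ((w ^ l) (g i)) ∈ Submodule.span F (Set.range Y) := by
    intro i l
    rcases lt_or_ge (2 * l + 1) (k i) with hl | hl
    · rw [← hY1 i l hl]; exact Submodule.subset_span ⟨_, rfl⟩
    · rw [hw1 i l hl]; exact hmem0 i l
  have hcases : ∀ s : Σ i, Fin (k i), (∃ l, ∃ hl : 2 * l < k s.1, s = ⟨s.1, 2 * l, hl⟩) ∨
      ∃ l, ∃ hl : 2 * l + 1 < k s.1, s = ⟨s.1, 2 * l + 1, hl⟩ := by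
    rintro ⟨i, j, hj⟩
    rcases Nat.even_or_odd' j with ⟨l, rfl | rfl⟩
    · exact .inl ⟨l, hj, rfl⟩
    · exact .inr ⟨l, hj, rfl⟩
  have hffw : ∀ x, f (f x) = f (w x) + 2 • f x - x := by
    intro x
    rw [hwx, map_sub, map_add, hff'x, map_nsmul]; abel
  obtain ⟨y, hy⟩ := h.exists_basis Y (by
    intro s
    rw [LinearMap.sub_apply]
    refine Submodule.sub_mem _ ?_ (Submodule.subset_span ⟨s, rfl⟩)
    rcases hcases s with ⟨l, hl, hs⟩ | ⟨l, hl, hs⟩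
    · rw [hs, hY0]; exact hmem1 _ _
    · rw [hs, hY1, hffw, ← Module.End.mul_apply w, ← pow_succ']
      exact Submodule.sub_mem _ (Submodule.add_mem _ (hmem1 _ _)
        (Submodule.smul_of_tower_mem _ 2 (hmem1 _ _))) (hmem0 _ _))
    (fun i => by simpa using hmem0 i 0)
  have hy0 : ∀ i l (hl : 2 * l < k i), y ⟨i, 2 * l, hl⟩ = (w ^ l) (g i) := by
    rw [hy]; exact hY0
  have hy1 : ∀ i l (hl : 2 * l + 1 < k i), y ⟨i, 2 * l + 1, hl⟩ = f ((w ^ l) (g i)) := by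
    rw [hy]; exact hY1
  let ev : (Σ i, Fin (k i / 2)) → Σ i, Fin (k i) := fun a =>
    ⟨a.1, 2 * a.2.1, by have := a.2.2; omega⟩
  let od : (Σ i, Fin (k i / 2)) → Σ i, Fin (k i) := fun a =>
    ⟨a.1, 2 * a.2.1 + 1, by have := a.2.2; omega⟩
  have hcoord : ∀ a i l, y.coord (od a) ((w ^ l) (g i)) = 0 := by
    intro a i l
    rcases lt_or_ge (2 * l) (k i) with hl | hl
    · rw [← hy0 i l hl, Module.Basis.coord_apply, y.repr_self, Finsupp.single_eq_of_ne]
      intro hc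
      obtain ⟨h1, h2⟩ := Sigma.mk.inj_iff.1 hc
      subst h1
      have := Fin.mk.inj_iff.1 (eq_of_heq h2)
      omega
    · rw [hw0 i l hl, map_zero]
  refine ⟨Σ i, Fin (k i), Σ i, Fin (k i / 2), inferInstance, inferInstance, y, Sum.elim ev od,
    ?_, ?_, ?_, ?_⟩
  · rintro (⟨i, a, ha⟩ | ⟨i, a, ha⟩) (⟨j, b, hb⟩ | ⟨j, b, hb⟩) hab <;>
    · obtain ⟨h1, h2⟩ := Sigma.mk.inj_iff.1 hab
      dsimp only at h1
      subst h1
      have := Fin.mk.inj_iff.1 (eq_of_heq h2)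
      dsimp only at this
      first
        | omega
        | (have h3 : a = b := by omega
           subst h3; rfl)
  · intro a
    change f (y ⟨a.1, 2 * a.2.1, _⟩) = y ⟨a.1, 2 * a.2.1 + 1, _⟩
    rw [hy0, hy1]
  · intro a x
    suffices hlin : y.coord (od a) ∘ₗ f' = - y.coord (ev a) from LinearMap.congr_fun hlin x
    refine y.ext fun s => ?_
    simp only [LinearMap.comp_apply, LinearMap.neg_apply]
    obtain ⟨i, j, hl⟩ := s
    rcases Nat.even_or_odd' j with ⟨l, rfl | rfl⟩
    · have h1 : f' (y ⟨i, 2 * l, hl⟩) = (w ^ (l + 1)) (g i) + 2 • (w ^ l) (g i) - f ((w ^ l) (g i)) := by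
        rw [pow_succ', Module.End.mul_apply, hwx, hy0]; abel
      rw [h1, map_sub, map_add, map_nsmul, hcoord, hcoord, smul_zero, add_zero, zero_sub, neg_inj]
      rcases lt_or_ge (2 * l + 1) (k i) with hl' | hl'
      · rw [← hy1 i l hl']
        simp only [Module.Basis.coord_apply, y.repr_self, Finsupp.single_apply, od, ev]
        congr 1
        simp only [eq_iff_iff]
        constructor <;>
        · intro hc
          obtain ⟨h1, h2⟩ := Sigma.mk.inj_iff.1 hc
          obtain ⟨i', b, hb⟩ := a
          dsimp only at h1 h2
          subst h1
          have := Fin.mk.inj_iff.1 (eq_of_heq h2)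
          have h3 : l = b := by omega
          subst h3; rfl
      · rw [hw1 _ _ hl', hcoord, Module.Basis.coord_apply, y.repr_self,
          Finsupp.single_eq_of_ne]
        intro hc
        obtain ⟨h1, h2⟩ := Sigma.mk.inj_iff.1 hc
        obtain ⟨i', b, hb⟩ := a
        dsimp only at h1 h2
        subst h1
        have := Fin.mk.inj_iff.1 (eq_of_heq h2)
        omega
    · rw [hy1 i l hl, hf'fx, hcoord, ← hy1 i l hl, Module.Basis.coord_apply, y.repr_self,
        Finsupp.single_eq_of_ne, neg_zero]
      intro hc
      obtain ⟨h1, h2⟩ := Sigma.mk.inj_iff.1 hc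
      obtain ⟨i', b, hb⟩ := a
      dsimp only at h1 h2
      subst h1
      have := Fin.mk.inj_iff.1 (eq_of_heq h2)
      omega
  · simpa using h.finrank_range_le

end CyclicGenerators
section SpecialLinear

open Matrix

variable {F : Type*} [Field F] {n : ℕ}

theorem Matrix.SpecialLinearGroup.coe_mul_mulVec (A B : SpecialLinearGroup (Fin n) F)
    (v : Fin n → F) :
    ((A * B : SpecialLinearGroup (Fin n) F) : Matrix (Fin n) (Fin n) F) *ᵥ v =
      (A : Matrix (Fin n) (Fin n) F) *ᵥ ((B : Matrix (Fin n) (Fin n) F) *ᵥ v) :=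
  (mulVec_mulVec v _ _).symm

/-- Conjugation in the general linear group by `T` is realised in `SL_n` when `F` is algebraically
closed. -/
theorem exists_conj_mulVec [IsAlgClosed F] (hn : 0 < n) (T : (Fin n → F) ≃ₗ[F] (Fin n → F))
    (D : SpecialLinearGroup (Fin n) F) :
    ∃ h : SpecialLinearGroup (Fin n) F, ∀ v,
      ((h * D * h⁻¹ : SpecialLinearGroup (Fin n) F) : Matrix (Fin n) (Fin n) F) *ᵥ T v =
        T ((D : Matrix (Fin n) (Fin n) F) *ᵥ v) := by
  set A := LinearMap.toMatrix' (T : (Fin n → F) →ₗ[F] (Fin n → F)) with hA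
  have hAv : ∀ v, A *ᵥ v = T v := fun v => by
    rw [← Matrix.toLin'_apply, hA, Matrix.toLin'_toMatrix']; rfl
  have hdet : A.det ≠ 0 := by
    rw [hA, LinearMap.det_toMatrix']
    exact (LinearEquiv.isUnit_det' T).ne_zero
  obtain ⟨α, hα⟩ := IsAlgClosed.exists_pow_nat_eq (A.det⁻¹) hn
  let h : SpecialLinearGroup (Fin n) F := ⟨α • A, by
    rw [det_smul, Fintype.card_fin, hα, inv_mul_cancel₀ hdet]⟩
  refine ⟨h, fun v => ?_⟩
  have hα0 : α ≠ 0 := by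
    rintro rfl
    rw [zero_pow hn.ne'] at hα
    exact inv_ne_zero hdet hα.symm
  have hTv : ∀ v, T v = (h : Matrix (Fin n) (Fin n) F) *ᵥ (α⁻¹ • v) := fun v => by
    change T v = (α • A) *ᵥ (α⁻¹ • v)
    rw [smul_mulVec, mulVec_smul, smul_smul, mul_inv_cancel₀ hα0, one_smul, hAv]
  rw [hTv, hTv, ← SpecialLinearGroup.coe_mul_mulVec, inv_mul_cancel_right,
    SpecialLinearGroup.coe_mul_mulVec, mulVec_smul]

theorem exists_conj_eq [IsAlgClosed F] (hn : 0 < n) (T : (Fin n → F) ≃ₗ[F] (Fin n → F))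
    (X D : SpecialLinearGroup (Fin n) F)
    (hX : ∀ v, (X : Matrix (Fin n) (Fin n) F) *ᵥ T v = T ((D : Matrix (Fin n) (Fin n) F) *ᵥ v)) :
    ∃ h : SpecialLinearGroup (Fin n) F, X = h * D * h⁻¹ := by
  obtain ⟨h, hh⟩ := exists_conj_mulVec hn T D
  refine ⟨h, Subtype.ext (Matrix.ext_iff_mulVec.2 fun v => ?_)⟩
  obtain ⟨v, rfl⟩ := T.surjective v
  rw [hX, hh]

/-- If `u` is unipotent, then a diagonal matrix with few pairs of entries `x a, (x a)⁻¹` and ones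
elsewhere is a product of two conjugates of `u`. -/
theorem diagonal_pairs_mem_mul [IsAlgClosed F] (hn : 0 < n) (u : SpecialLinearGroup (Fin n) F)
    (hu : ((u : Matrix (Fin n) (Fin n) F) - 1) ^ n = 0) (C : Set (SpecialLinearGroup (Fin n) F))
    (hC : C = {g | ∃ h : SpecialLinearGroup (Fin n) F, g = h * u * h⁻¹})
    {κ : Type*} [Fintype κ]
    (hκ : 2 * Fintype.card κ ≤ Module.finrank F
      (LinearMap.range (toLin' ((u : Matrix (Fin n) (Fin n) F) - 1))) + 1)
    (j : κ ⊕ κ → Fin n) (hj : Function.Injective j) (x : κ → F)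
    (hx0 : ∀ a, x a ≠ 0) (hx1 : ∀ a, x a ≠ 1) (hx2 : ∀ a, x a ≠ -1)
    (D : SpecialLinearGroup (Fin n) F)
    (hD : (D : Matrix (Fin n) (Fin n) F) =
      diagonal (Function.extend j (Sum.elim x fun a => (x a)⁻¹) 1)) :
    D ∈ C * C := by
  classical
  set f : Module.End F (Fin n → F) := toLin' (u : Matrix (Fin n) (Fin n) F) with hf
  set f' : Module.End F (Fin n → F) :=
    toLin' ((u⁻¹ : SpecialLinearGroup (Fin n) F) : Matrix (Fin n) (Fin n) F) with hf'
  have hff' : f * f' = 1 := by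
    refine LinearMap.ext fun v => ?_
    change (u : Matrix (Fin n) (Fin n) F) *ᵥ
      (((u⁻¹ : SpecialLinearGroup (Fin n) F) : Matrix (Fin n) (Fin n) F) *ᵥ v) = v
    rw [← SpecialLinearGroup.coe_mul_mulVec, mul_inv_cancel]
    exact one_mulVec v
  have hff'x : ∀ v, f (f' v) = v := fun v => LinearMap.congr_fun hff' v
  have hf'f : f' * f = 1 := (mul_eq_one_comm (a := f) (b := f')).1 hff'
  have hf'fx : ∀ v, f' (f v) = v := fun v => LinearMap.congr_fun hf'f v
  have hf1 : toLin' ((u : Matrix (Fin n) (Fin n) F) - 1) = f - 1 := by rw [map_sub, toLin'_one]; rfl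
  have hnil : IsNilpotent (f - 1) := ⟨n, by rw [← hf1, ← toLin'_pow, hu, map_zero]⟩
  rw [hf1] at hκ
  obtain ⟨T₀, hT₀⟩ := exists_conj_inverse f f' hff' hnil
  obtain ⟨ι, P, _, _, y, p, hp, hpf, hpf', hP⟩ := exists_pair_basis f f' hff' hnil
  have hcard : Fintype.card κ ≤ Fintype.card P := by omega
  obtain ⟨c⟩ := Function.Embedding.nonempty_of_card_le hcard
  let ev : κ → ι := fun a => p (.inl (c a))
  let od : κ → ι := fun a => p (.inr (c a))
  have hevinj : Function.Injective ev := fun a b hab => c.injective (Sum.inl_injective (hp hab))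
  have hodinj : Function.Injective od := fun a b hab => c.injective (Sum.inr_injective (hp hab))
  have hevod : ∀ a b, ev a ≠ od b := fun a b hab => Sum.inl_ne_inr (hp hab)
  let q : κ ⊕ κ → ι := Sum.elim ev od
  have hq : Function.Injective q := Sum.elim_injective.2 ⟨hevinj, hodinj, hevod⟩
  -- matching the pairs of basis vectors with the prescribed positions
  have hcι : Fintype.card ι = n := by
    rw [← Module.finrank_eq_card_basis y, Module.finrank_fin_fun]
  obtain ⟨σ', hσ'⟩ := Set.MapsTo.exists_equiv_extend_of_card_eq
    (t := (Finset.univ : Finset (Fin n))) (by simp [hcι]) (s := Set.range q)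
    (f := Function.extend q j (fun _ => ⟨0, hn⟩)) (fun _ _ => by simp) (by
      rintro _ ⟨a, rfl⟩ _ ⟨b, rfl⟩ hab
      rw [hq.extend_apply, hq.extend_apply] at hab
      rw [hj hab])
  let σ : ι ≃ Fin n := σ'.trans (Equiv.subtypeUnivEquiv (by simp))
  have hσ : ∀ t, σ (q t) = j t := fun t => by
    have := hσ' (q t) ⟨t, rfl⟩
    rw [hq.extend_apply] at this
    exact this
  -- the conjugating element `1 + E`
  have hroot : ∀ a, ∃ r : F, r ^ 2 = x a + (x a)⁻¹ - 2 := fun a =>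
    IsAlgClosed.exists_pow_nat_eq _ two_pos
  choose r hr using hroot
  let E : Module.End F (Fin n → F) :=
    ∑ a, r a • (y.coord (od a)).smulRight (y (ev a))
  have hEv : ∀ v, E v = ∑ a, (r a * y.coord (od a) v) • y (ev a) := fun v => by
    simp [E, LinearMap.sum_apply, smul_smul]
  have hE0 : ∀ s, (∀ a, s ≠ od a) → E (y s) = 0 := by
    intro s hs
    rw [hEv]
    refine Finset.sum_eq_zero fun a _ => ?_
    rw [Module.Basis.coord_apply, y.repr_self, Finsupp.single_eq_of_ne (hs a).symm, mul_zero,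
      zero_smul]
  have hE1 : ∀ a, E (y (od a)) = r a • y (ev a) := by
    intro a
    rw [hEv, Finset.sum_eq_single a]
    · simp
    · intro b _ hb
      rw [Module.Basis.coord_apply, y.repr_self,
        Finsupp.single_eq_of_ne (fun h => hb (hodinj h)), mul_zero, zero_smul]
    · simp
  let E' : Module.End F (Fin n → F) := f * E * f'
  have hE'v : ∀ v, E' v = - ∑ a, (r a * y.coord (ev a) v) • y (od a) := fun v => by
    change f (E (f' v)) = _
    rw [hEv, map_sum, ← Finset.sum_neg_distrib]
    refine Finset.sum_congr rfl fun a _ => ?_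
    rw [map_smul, hpf, hpf', mul_neg, neg_smul]
  have hE'0 : ∀ s, (∀ a, s ≠ ev a) → E' (y s) = 0 := by
    intro s hs
    rw [hE'v, Finset.sum_eq_zero, neg_zero]
    intro a _
    rw [Module.Basis.coord_apply, y.repr_self, Finsupp.single_eq_of_ne (hs a).symm, mul_zero,
      zero_smul]
  have hE'1 : ∀ a, E' (y (ev a)) = - r a • y (od a) := by
    intro a
    rw [hE'v, Finset.sum_eq_single a]
    · simp
    · intro b _ hb
      rw [Module.Basis.coord_apply, y.repr_self,
        Finsupp.single_eq_of_ne (fun h => hb (hevinj h)), mul_zero, zero_smul]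
    · simp
  have hEE : E * E = 0 := by
    refine y.ext fun s => ?_
    rw [Module.End.mul_apply, hEv (y s), map_sum, LinearMap.zero_apply]
    refine Finset.sum_eq_zero fun a _ => ?_
    rw [map_smul, hE0 _ (fun b => hevod a b), smul_zero]
  let G : (Fin n → F) ≃ₗ[F] (Fin n → F) := LinearEquiv.ofLinearMap (1 + E) (1 - E)
    (by change (1 + E) * (1 - E) = 1
        rw [add_mul, mul_sub, mul_sub, hEE]; simp)
    (by change (1 - E) * (1 + E) = 1
        rw [sub_mul, mul_add, mul_add, hEE]; simp)
  have hG : ∀ v, G v = v + E v := fun v => rfl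
  have hG' : ∀ v, G.symm v = v - E v := fun v => rfl
  -- the commutator of `f` and `1 + E`, and its basis of eigenvectors
  let K : Module.End F (Fin n → F) := (1 + E') * (1 - E)
  have hK : ∀ v, K v = f (G (f' (G.symm v))) := by
    intro v
    rw [hG, map_add, hff'x, hG']
    rfl
  have hKev : ∀ a, K (y (ev a)) = y (ev a) - r a • y (od a) := by
    intro a
    simp only [K, Module.End.mul_apply, LinearMap.sub_apply, LinearMap.add_apply,
      Module.End.one_apply]
    rw [hE0 _ (fun b => hevod a b), sub_zero, hE'1, neg_smul, ← sub_eq_add_neg]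
  have hKod : ∀ a, K (y (od a)) = y (od a) - r a • y (ev a) + (r a ^ 2) • y (od a) := by
    intro a
    simp only [K, Module.End.mul_apply, LinearMap.sub_apply, LinearMap.add_apply,
      Module.End.one_apply]
    rw [hE1, map_sub, map_smul, hE'0 _ (fun b => (hevod b a).symm), hE'1, zero_sub, neg_smul,
      smul_neg, neg_neg, smul_smul, pow_two]
  have hKy : ∀ s, (∀ a, s ≠ ev a) → (∀ a, s ≠ od a) → K (y s) = y s := by
    intro s h1 h2
    simp only [K, Module.End.mul_apply, LinearMap.sub_apply, LinearMap.add_apply,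
      Module.End.one_apply]
    rw [hE0 s h2, sub_zero, hE'0 s h1, add_zero]
  let z : ι → Fin n → F := Function.extend q
    (Sum.elim (fun a => r a • y (ev a) + (1 - x a) • y (od a))
      (fun a => r a • y (ev a) + (1 - (x a)⁻¹) • y (od a))) y
  have hzev : ∀ a, z (ev a) = r a • y (ev a) + (1 - x a) • y (od a) := fun a =>
    hq.extend_apply _ _ (Sum.inl a)
  have hzod : ∀ a, z (od a) = r a • y (ev a) + (1 - (x a)⁻¹) • y (od a) := fun a =>
    hq.extend_apply _ _ (Sum.inr a)
  have hcases : ∀ s, (∃ a, s = ev a) ∨ (∃ a, s = od a) ∨ ¬ ∃ t, q t = s := by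
    intro s
    by_cases h : ∃ t, q t = s
    · obtain ⟨a | a, rfl⟩ := h
      · exact .inl ⟨a, rfl⟩
      · exact .inr (.inl ⟨a, rfl⟩)
    · exact .inr (.inr h)
  have hr0 : ∀ a, r a ≠ 0 := by
    intro a ha
    have h1 := hr a
    rw [ha] at h1
    have h2 : (x a - 1) ^ 2 = 0 := by
      have h3 := hx0 a
      field_simp at h1
      linear_combination -h1
    exact hx1 a (sub_eq_zero.1 (pow_eq_zero_iff two_ne_zero |>.1 h2))
  have hxx : ∀ a, x a - (x a)⁻¹ ≠ 0 := by
    intro a ha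
    have h3 := hx0 a
    have h2 : (x a - 1) * (x a + 1) = 0 := by
      field_simp at ha
      linear_combination ha
    rcases mul_eq_zero.1 h2 with h | h
    · exact hx1 a (sub_eq_zero.1 h)
    · exact hx2 a (eq_neg_of_add_eq_zero_left h)
  have hspan : ⊤ ≤ Submodule.span F (Set.range z) := by
    rw [← y.span_eq, Submodule.span_le]
    have hz : ∀ s, z s ∈ Submodule.span F (Set.range z) := fun s =>
      Submodule.subset_span ⟨s, rfl⟩
    have h1 : ∀ a, y (od a) ∈ Submodule.span F (Set.range z) := by
      intro a
      have h2 : y (od a) = (x a - (x a)⁻¹)⁻¹ • (z (od a) - z (ev a)) := by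
        rw [eq_inv_smul_iff₀ (hxx a), hzev, hzod]
        module
      rw [h2]
      exact Submodule.smul_mem _ _ (Submodule.sub_mem _ (hz _) (hz _))
    rintro _ ⟨s, rfl⟩
    rcases hcases s with ⟨a, rfl⟩ | ⟨a, rfl⟩ | h
    · have h2 : y (ev a) = (r a)⁻¹ • (z (ev a) - (1 - x a) • y (od a)) := by
        rw [eq_inv_smul_iff₀ (hr0 a), hzev]
        module
      rw [h2]
      exact Submodule.smul_mem _ _ (Submodule.sub_mem _ (hz _) (Submodule.smul_mem _ _ (h1 a)))
    · exact h1 a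
    · have h2 : z s = y s := Function.extend_apply' _ _ _ h
      rw [← h2]
      exact hz s
  let b : Module.Basis ι F (Fin n → F) := basisOfTopLeSpanOfCardEqFinrank z hspan
    (Module.finrank_eq_card_basis y).symm
  have hb : ⇑b = z := coe_basisOfTopLeSpanOfCardEqFinrank _ _ _
  let T : (Fin n → F) ≃ₗ[F] (Fin n → F) := (Pi.basisFun F (Fin n)).equiv b σ.symm
  have hT : ∀ s, T (Pi.single (σ s) 1) = z s := fun s => by
    rw [← Pi.basisFun_apply, Module.Basis.equiv_apply, hb, Equiv.symm_apply_apply]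
  have hDσ : ∀ s, (D : Matrix (Fin n) (Fin n) F) *ᵥ (Pi.single (σ s) 1) =
      (Function.extend q (Sum.elim x fun a => (x a)⁻¹) 1 s) • Pi.single (σ s) 1 := by
    intro s
    have h1 : Function.extend j (Sum.elim x fun a => (x a)⁻¹) 1 (σ s) =
        Function.extend q (Sum.elim x fun a => (x a)⁻¹) 1 s := by
      by_cases h : ∃ t, q t = s
      · obtain ⟨t, rfl⟩ := h
        rw [hσ, hj.extend_apply, hq.extend_apply]
      · rw [Function.extend_apply' _ _ _ h, Function.extend_apply']
        · rfl
        · rintro ⟨t, ht⟩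
          exact h ⟨t, σ.injective (by rw [hσ, ht])⟩
    rw [hD, ← h1, diagonal_mulVec_single, mul_one, ← Pi.single_smul, smul_eq_mul, mul_one]
  have hKz : ∀ s, K (z s) = (Function.extend q (Sum.elim x fun a => (x a)⁻¹) 1 s) • z s := by
    intro s
    rcases hcases s with ⟨a, rfl⟩ | ⟨a, rfl⟩ | h
    · have h1 : Function.extend q (Sum.elim x fun a => (x a)⁻¹) 1 (ev a) = x a :=
        hq.extend_apply _ _ (Sum.inl a)
      rw [h1, hzev, map_add, map_smul, map_smul, hKev, hKod, hr]
      have h3 := hx0 a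
      match_scalars
      · ring
      · have h4 := hr a
        field_simp at h4 ⊢
        linear_combination -h4
    · have h1 : Function.extend q (Sum.elim x fun a => (x a)⁻¹) 1 (od a) = (x a)⁻¹ :=
        hq.extend_apply _ _ (Sum.inr a)
      rw [h1, hzod, map_add, map_smul, map_smul, hKev, hKod, hr]
      have h3 := hx0 a
      match_scalars
      · ring
      · have h4 := hr a
        field_simp at h4 ⊢
        linear_combination (-x a) * h4
    · rw [Function.extend_apply' _ _ _ h, show z s = y s from Function.extend_apply' _ _ _ h,
        hKy s (fun a ha => h ⟨.inl a, ha.symm⟩) (fun a ha => h ⟨.inr a, ha.symm⟩)]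
      simp
  have hKT : ∀ v, K (T v) = T ((D : Matrix (Fin n) (Fin n) F) *ᵥ v) := by
    have : K ∘ₗ (T : (Fin n → F) →ₗ[F] (Fin n → F)) =
        (T : (Fin n → F) →ₗ[F] (Fin n → F)) ∘ₗ toLin' (D : Matrix (Fin n) (Fin n) F) := by
      refine (Pi.basisFun F (Fin n)).ext fun i => ?_
      obtain ⟨s, rfl⟩ := σ.surjective i
      simp only [LinearMap.comp_apply, LinearEquiv.coe_coe, Pi.basisFun_apply, toLin'_apply]
      rw [hT, hKz, hDσ, map_smul, hT]
    exact fun v => LinearMap.congr_fun this v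
  obtain ⟨h, hh⟩ := exists_conj_mulVec hn T D
  set R := h * D * h⁻¹ with hR
  have hRK : ∀ v, (R : Matrix (Fin n) (Fin n) F) *ᵥ v = f (G (f' (G.symm v))) := by
    intro v
    obtain ⟨v, rfl⟩ := T.surjective v
    rw [hh, ← hKT, hK]
  obtain ⟨h₁, hh₁⟩ := exists_conj_eq hn G (u⁻¹ * R) u⁻¹ (by
    intro v
    rw [SpecialLinearGroup.coe_mul_mulVec, hRK, LinearEquiv.symm_apply_apply]
    exact hf'fx _)
  obtain ⟨h₀, hh₀⟩ := exists_conj_eq hn T₀.symm u u⁻¹ (by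
    intro v
    have h1 := hT₀ (T₀.symm v)
    rw [LinearEquiv.apply_symm_apply] at h1
    apply T₀.injective
    rw [LinearEquiv.apply_symm_apply]
    exact h1)
  rw [hC]
  refine Set.mem_mul.2 ⟨h⁻¹ * u * h, ⟨h⁻¹, by rw [inv_inv]⟩, h⁻¹ * (u⁻¹ * R) * h, ?_, ?_⟩
  · refine ⟨h⁻¹ * h₁ * h₀⁻¹, ?_⟩
    rw [hh₁]
    have h2 : u⁻¹ = h₀⁻¹ * u * h₀ := by
      calc u⁻¹ = h₀⁻¹ * (h₀ * u⁻¹ * h₀⁻¹) * h₀ := by group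
        _ = h₀⁻¹ * u * h₀ := by rw [← hh₀]
    rw [h2]
    group
  · rw [hR]; group

end SpecialLinear
section Torus

open Matrix

variable {F : Type*} [Field F] {N : ℕ}

/-- The diagonal matrix with entries `f 0, f 1 / f 0, …, f (N - 1) / f (N - 2), 1 / f (N - 1)`, i.e.
the product of the simple coroots evaluated at the entries of `f`. -/
def coroot (f : Fin N → Fˣ) : SpecialLinearGroup (Fin (N + 1)) F :=
  ⟨diagonal fun k => ((Fin.snoc (α := fun _ => Fˣ) f 1 k /
    Fin.cons (α := fun _ => Fˣ) 1 f k : Fˣ) : F), by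
    rw [det_diagonal, ← Units.coe_prod, Finset.prod_div_distrib, Fin.prod_snoc, Fin.prod_cons]
    simp⟩

theorem coe_coroot (f : Fin N → Fˣ) : (coroot f : Matrix (Fin (N + 1)) (Fin (N + 1)) F) =
    diagonal fun k => ((Fin.snoc (α := fun _ => Fˣ) f 1 k /
      Fin.cons (α := fun _ => Fˣ) 1 f k : Fˣ) : F) := rfl

theorem coroot_mul (f g : Fin N → Fˣ) : coroot (f * g) = coroot f * coroot g := by
  refine Subtype.ext ?_
  change _ = (coroot f : Matrix (Fin (N + 1)) (Fin (N + 1)) F) *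
    (coroot g : Matrix (Fin (N + 1)) (Fin (N + 1)) F)
  simp only [coe_coroot, diagonal_mul_diagonal]
  congr 1
  funext k
  rw [← Units.val_mul, div_mul_div_comm]
  congr 2
  · refine Fin.lastCases ?_ (fun i => ?_) k <;> simp
  · refine Fin.cases ?_ (fun i => ?_) k <;> simp

theorem coroot_one : coroot (1 : Fin N → Fˣ) = 1 := by
  have h := coroot_mul (1 : Fin N → Fˣ) 1
  rwa [mul_one, left_eq_mul] at h

theorem exists_eq_coroot (D : SpecialLinearGroup (Fin (N + 1)) F) (d : Fin (N + 1) → F)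
    (hD : (D : Matrix (Fin (N + 1)) (Fin (N + 1)) F) = diagonal d) : ∃ f, D = coroot f := by
  have hdet : ∏ i, d i = 1 := by rw [← det_diagonal, ← hD, D.det_coe]
  have hd : ∀ i, d i ≠ 0 := fun i hi => by
    rw [Finset.prod_eq_zero (Finset.mem_univ i) hi] at hdet
    exact zero_ne_one hdet
  let e : Fin (N + 1) → Fˣ := fun i => Units.mk0 (d i) (hd i)
  have he : ∏ i, e i = 1 := Units.ext (by rw [Units.coe_prod]; exact hdet)
  let f : Fin N → Fˣ := fun i => Fin.partialProd e i.succ.castSucc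
  have h1 : ∀ k, Fin.cons (α := fun _ => Fˣ) 1 f k = Fin.partialProd e k.castSucc := by
    refine Fin.cases ?_ fun i => ?_ <;> simp [f]
  have h2 : ∀ k, Fin.snoc (α := fun _ => Fˣ) f 1 k = Fin.partialProd e k.succ := by
    refine Fin.lastCases ?_ fun i => ?_
    · rw [Fin.snoc_last, Fin.succ_last, ← he, Fin.partialProd, Fin.val_last,
        List.take_of_length_le (by simp), List.prod_ofFn]
    · rw [Fin.snoc_castSucc, Fin.succ_castSucc]
  refine ⟨f, Subtype.ext ?_⟩
  rw [hD, coe_coroot]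
  congr 1
  funext k
  rw [h1, h2, Fin.partialProd_succ, mul_div_cancel_left]
  rfl

theorem coroot_mem_mul [IsAlgClosed F] (u : SpecialLinearGroup (Fin (N + 1)) F)
    (hu : ((u : Matrix (Fin (N + 1)) (Fin (N + 1)) F) - 1) ^ (N + 1) = 0)
    (C : Set (SpecialLinearGroup (Fin (N + 1)) F))
    (hC : C = {g | ∃ h : SpecialLinearGroup (Fin (N + 1)) F, g = h * u * h⁻¹})
    (S : Finset (Fin N)) (hS : 2 * S.card ≤ Module.finrank F
      (LinearMap.range (toLin' ((u : Matrix (Fin (N + 1)) (Fin (N + 1)) F) - 1))) + 1)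
    (hSS : ∀ a ∈ S, ∀ b ∈ S, a.castSucc ≠ b.succ)
    (f : Fin N → Fˣ) (hf : ∀ i ∉ S, f i = 1) (hf1 : ∀ i ∈ S, f i ≠ 1) (hf2 : ∀ i ∈ S, f i ≠ -1) :
    coroot f ∈ C * C := by
  let j : S ⊕ S → Fin (N + 1) := Sum.elim (fun a => a.1.castSucc) fun a => a.1.succ
  have hj : Function.Injective j := Sum.elim_injective.2
    ⟨(Fin.castSucc_injective N).comp Subtype.val_injective,
      (Fin.succ_injective N).comp Subtype.val_injective, fun a b => hSS a a.2 b b.2⟩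
  have hsnoc : ∀ k, (∀ a ∈ S, k ≠ a.castSucc) → Fin.snoc (α := fun _ => Fˣ) f 1 k = 1 := by
    refine Fin.lastCases (fun _ => by simp) fun i hi => ?_
    rw [Fin.snoc_castSucc]
    exact hf i fun h => hi i h rfl
  have hcons : ∀ k, (∀ a ∈ S, k ≠ a.succ) → Fin.cons (α := fun _ => Fˣ) 1 f k = 1 := by
    refine Fin.cases (fun _ => by simp) fun i hi => ?_
    rw [Fin.cons_succ]
    exact hf i fun h => hi i h rfl
  refine diagonal_pairs_mem_mul N.succ_pos u hu C hC (κ := S) (by simpa using hS) j hj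
    (fun a => (f a : F)) (fun a => (f a).ne_zero) (fun a h => hf1 a a.2 (Units.ext h))
    (fun a h => hf2 a a.2 (Units.ext h)) (coroot f) ?_
  rw [coe_coroot]
  congr 1
  funext k
  by_cases hk : ∃ t, j t = k
  · obtain ⟨t, rfl⟩ := hk
    rw [hj.extend_apply]
    obtain a | a := t
    · change ((Fin.snoc (α := fun _ => Fˣ) f 1 a.1.castSucc /
        Fin.cons (α := fun _ => Fˣ) 1 f a.1.castSucc : Fˣ) : F) = f a
      rw [Fin.snoc_castSucc, hcons _ fun b hb => hSS a a.2 b hb, div_one]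
    · change ((Fin.snoc (α := fun _ => Fˣ) f 1 a.1.succ /
        Fin.cons (α := fun _ => Fˣ) 1 f a.1.succ : Fˣ) : F) = (f a : F)⁻¹
      rw [Fin.cons_succ, hsnoc _ fun b hb => (hSS b hb a a.2).symm, one_div, Units.val_inv_eq_inv_val]
  · rw [Function.extend_apply' _ _ _ hk, hsnoc k fun a ha h => hk ⟨.inl ⟨a, ha⟩, h.symm⟩,
      hcons k fun a ha h => hk ⟨.inr ⟨a, ha⟩, h.symm⟩]
    simp

theorem coroot_mem_pow_four [IsAlgClosed F] (u : SpecialLinearGroup (Fin (N + 1)) F)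
    (hu : ((u : Matrix (Fin (N + 1)) (Fin (N + 1)) F) - 1) ^ (N + 1) = 0)
    (C : Set (SpecialLinearGroup (Fin (N + 1)) F))
    (hC : C = {g | ∃ h : SpecialLinearGroup (Fin (N + 1)) F, g = h * u * h⁻¹})
    (S : Finset (Fin N)) (hS : 2 * S.card ≤ Module.finrank F
      (LinearMap.range (toLin' ((u : Matrix (Fin (N + 1)) (Fin (N + 1)) F) - 1))) + 1)
    (hSS : ∀ a ∈ S, ∀ b ∈ S, a.castSucc ≠ b.succ)
    (f : Fin N → Fˣ) (hf : ∀ i ∉ S, f i = 1) :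
    coroot f ∈ C ^ 4 := by
  classical
  have : Infinite F := IsAlgClosed.instInfinite
  have hy : ∀ i, ∃ y : Fˣ, y ≠ 1 ∧ y ≠ -1 ∧ y⁻¹ * f i ≠ 1 ∧ y⁻¹ * f i ≠ -1 := by
    intro i
    obtain ⟨y, hy⟩ := Infinite.exists_notMem_finset ({0, 1, -1, (f i : F), -(f i : F)} : Finset F)
    simp only [Finset.mem_insert, Finset.mem_singleton, not_or] at hy
    obtain ⟨h0, h1, h2, h3, h4⟩ := hy
    refine ⟨Units.mk0 y h0, fun h => h1 ?_, fun h => h2 ?_, fun h => h3 ?_, fun h => h4 ?_⟩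
    · simpa using congrArg Units.val h
    · simpa using congrArg Units.val h
    · rw [inv_mul_eq_one] at h
      simpa using congrArg Units.val h
    · rw [inv_mul_eq_iff_eq_mul, mul_neg_one] at h
      rw [h]
      simp
  choose y hy1 hy2 hy3 hy4 using hy
  let g : Fin N → Fˣ := fun i => if i ∈ S then y i else 1
  have hfg : f = g * (g⁻¹ * f) := by rw [mul_inv_cancel_left]
  rw [hfg, coroot_mul, show C ^ 4 = (C * C) * (C * C) by rw [← pow_two, ← pow_two, ← pow_mul]]
  refine Set.mul_mem_mul (coroot_mem_mul u hu C hC S hS hSS _ ?_ ?_ ?_)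
    (coroot_mem_mul u hu C hC S hS hSS _ ?_ ?_ ?_)
  · intro i hi; simp [g, hi]
  · intro i hi; simp [g, hi, hy1]
  · intro i hi; simp [g, hi, hy2]
  · intro i hi; simp [g, hi, hf]
  · intro i hi; simp [g, hi, hy3]
  · intro i hi; simp [g, hi, hy4]

theorem diagonal_mem_pow [IsAlgClosed F] (u : SpecialLinearGroup (Fin (N + 1)) F)
    (hu : ((u : Matrix (Fin (N + 1)) (Fin (N + 1)) F) - 1) ^ (N + 1) = 0)
    (C : Set (SpecialLinearGroup (Fin (N + 1)) F))
    (hC : C = {g | ∃ h : SpecialLinearGroup (Fin (N + 1)) F, g = h * u * h⁻¹})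
    (p m : ℕ) (hp : 2 * p ≤ Module.finrank F
      (LinearMap.range (toLin' ((u : Matrix (Fin (N + 1)) (Fin (N + 1)) F) - 1))) + 1)
    (hm : 2 ≤ m) (hmp : N ≤ m * p)
    (D : SpecialLinearGroup (Fin (N + 1)) F) (d : Fin (N + 1) → F)
    (hD : (D : Matrix (Fin (N + 1)) (Fin (N + 1)) F) = diagonal d) :
    D ∈ C ^ (4 * m) := by
  obtain ⟨f, rfl⟩ := exists_eq_coroot D d hD
  clear hD
  suffices h : ∀ c : ℕ, ∀ f : Fin N → Fˣ, (∀ i : Fin N, c ≤ i % m → f i = 1) →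
      coroot f ∈ C ^ (4 * c) from
    h m f fun i hi => absurd (Nat.mod_lt _ (by omega)) hi.not_gt
  intro c
  induction c with
  | zero =>
    intro f hf
    rw [show f = 1 from funext fun i => hf i (Nat.zero_le _), coroot_one]
    simp
  | succ c ih =>
    intro f hf
    let S : Finset (Fin N) := Finset.univ.filter fun i => i.1 % m = c
    have hS : S.card ≤ p := by
      have h1 : S.card ≤ (Finset.range p).card := by
        refine Finset.card_le_card_of_injOn (fun i => i.1 / m) (fun i _ => ?_) fun i hi k hk h => ?_
        · rw [Finset.coe_range, Set.mem_Iio, Nat.div_lt_iff_lt_mul (by omega), mul_comm]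
          exact i.2.trans_le hmp
        · have hi' : i.1 % m = c := by simpa [S] using hi
          have hk' : k.1 % m = c := by simpa [S] using hk
          ext
          rw [← Nat.div_add_mod i.1 m, ← Nat.div_add_mod k.1 m, hi', hk']
          exact congrArg (m * · + c) h
      simpa using h1
    let g : Fin N → Fˣ := fun i => if i ∈ S then 1 else f i
    have hfg : f = g * (g⁻¹ * f) := by rw [mul_inv_cancel_left]
    rw [hfg, coroot_mul, show 4 * (c + 1) = 4 * c + 4 by ring, pow_add]
    refine Set.mul_mem_mul (ih g fun i hi => ?_) (coroot_mem_pow_four u hu C hC S (by omega) ?_ _ ?_)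
    · by_cases h : i ∈ S
      · simp [g, h]
      · have h1 : i.1 % m ≠ c := by simpa [S] using h
        simp only [g, h, if_false]
        exact hf i (by omega)
    · intro a ha b hb hab
      have ha' : a.1 % m = c := by simpa [S] using ha
      have hb' : b.1 % m = c := by simpa [S] using hb
      have h1 : a.1 = b.1 + 1 := congrArg Fin.val hab
      have h2 : b.1 ≡ b.1 + 1 [MOD m] := by rw [Nat.ModEq, ← h1, ha', hb']
      have h3 := (Nat.modEq_iff_dvd' (Nat.le_add_right _ _)).1 h2
      rw [Nat.add_sub_cancel_left, Nat.dvd_one] at h3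
      omega
    · intro i hi
      simp [g, hi]

end Torus
section Triangular

open Matrix

variable {F : Type*} [Field F] {n : ℕ}

theorem det_of_isTriangular {M : Matrix (Fin n) (Fin n) F}
    (hM : M.IsUpperTriangular ∨ M.IsLowerTriangular) : M.det = ∏ i, M i i :=
  hM.elim det_of_isUpperTriangular (det_of_isLowerTriangular M)

theorem exists_conj_diagonal [IsAlgClosed F] (hn : 0 < n) (X D : SpecialLinearGroup (Fin n) F)
    (hX : (X : Matrix (Fin n) (Fin n) F).IsUpperTriangular ∨
      (X : Matrix (Fin n) (Fin n) F).IsLowerTriangular)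
    (t : Fin n → F) (ht : Function.Injective t) (hXt : ∀ i, (X : Matrix (Fin n) (Fin n) F) i i = t i)
    (hD : (D : Matrix (Fin n) (Fin n) F) = diagonal t) :
    ∃ h : SpecialLinearGroup (Fin n) F, X = h * D * h⁻¹ := by
  have hv : ∀ i, ∃ v : Fin n → F, v ≠ 0 ∧ (X : Matrix (Fin n) (Fin n) F) *ᵥ v = t i • v := by
    intro i
    have h1 : ((X : Matrix (Fin n) (Fin n) F) - diagonal fun _ => t i).det = 0 := by
      rw [det_of_isTriangular (hX.imp (fun h => h.sub (blockTriangular_diagonal _))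
        fun h => h.sub (blockTriangular_diagonal _))]
      refine Finset.prod_eq_zero (Finset.mem_univ i) ?_
      rw [Matrix.sub_apply, diagonal_apply_eq, hXt, sub_self]
    obtain ⟨v, hv0, hv⟩ := exists_mulVec_eq_zero_iff.2 h1
    refine ⟨v, hv0, ?_⟩
    rw [sub_mulVec, sub_eq_zero] at hv
    rw [hv]
    ext k
    rw [mulVec_diagonal, Pi.smul_apply, smul_eq_mul]
  choose v hv0 hv using hv
  have hli : LinearIndependent F v :=
    Module.End.eigenvectors_linearIndependent' (toLin' (X : Matrix (Fin n) (Fin n) F)) t ht v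
      fun i => ⟨Module.End.mem_eigenspace_iff.2 (by rw [toLin'_apply, hv]), hv0 i⟩
  let b : Module.Basis (Fin n) F (Fin n → F) := basisOfLinearIndependentOfCardEqFinrank' v hli
    (by simp)
  have hb : ⇑b = v := coe_basisOfLinearIndependentOfCardEqFinrank' _ _ _
  let T : (Fin n → F) ≃ₗ[F] (Fin n → F) := (Pi.basisFun F (Fin n)).equiv b (Equiv.refl _)
  have hT : ∀ s, T (Pi.single s 1) = v s := fun s => by
    rw [← Pi.basisFun_apply, Module.Basis.equiv_apply, hb, Equiv.refl_apply]
  refine exists_conj_eq hn T X D fun w => ?_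
  have h : toLin' (X : Matrix (Fin n) (Fin n) F) ∘ₗ (T : (Fin n → F) →ₗ[F] (Fin n → F)) =
      (T : (Fin n → F) →ₗ[F] (Fin n → F)) ∘ₗ toLin' (D : Matrix (Fin n) (Fin n) F) := by
    refine (Pi.basisFun F (Fin n)).ext fun i => ?_
    simp only [LinearMap.comp_apply, LinearEquiv.coe_coe, Pi.basisFun_apply, toLin'_apply]
    rw [hT, hv, hD, diagonal_mulVec_single, ← smul_eq_mul, Pi.single_smul, map_smul, hT]
  exact LinearMap.congr_fun h w

theorem exists_injective_prod_eq_one [IsAlgClosed F] (hn : 0 < n) :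
    ∃ t : Fin n → F, Function.Injective t ∧ ∏ i, t i = 1 := by
  have : Infinite F := IsAlgClosed.instInfinite
  obtain ⟨e⟩ : Nonempty (Fin n ↪ ({0}ᶜ : Set F)) := by
    have : Infinite ({0}ᶜ : Set F) := (Set.finite_singleton (0 : F)).infinite_compl.to_subtype
    exact ⟨Fin.valEmbedding.trans (Infinite.natEmbedding _)⟩
  have h0 : ∏ i, (e i : F) ≠ 0 := Finset.prod_ne_zero_iff.2 fun i _ => (e i).2
  obtain ⟨α, hα⟩ := IsAlgClosed.exists_pow_nat_eq (∏ i, (e i : F))⁻¹ hn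
  have hα0 : α ≠ 0 := by
    rintro rfl
    rw [zero_pow hn.ne'] at hα
    exact inv_ne_zero h0 hα.symm
  refine ⟨fun i => α * e i, fun i k hik => e.injective (Subtype.ext (mul_left_cancel₀ hα0 hik)), ?_⟩
  rw [Finset.prod_mul_distrib, Finset.prod_const, Finset.card_univ, Fintype.card_fin, hα,
    inv_mul_cancel₀ h0]

theorem triangular_mem_mul [IsAlgClosed F] (hn : 0 < n) (S : Set (SpecialLinearGroup (Fin n) F))
    (hS : ∀ h, ∀ g ∈ S, h * g * h⁻¹ ∈ S)
    (hdiag : ∀ (D : SpecialLinearGroup (Fin n) F) (d : Fin n → F),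
      (D : Matrix (Fin n) (Fin n) F) = diagonal d → D ∈ S)
    (X : SpecialLinearGroup (Fin n) F)
    (hX : (X : Matrix (Fin n) (Fin n) F).IsUpperTriangular ∨
      (X : Matrix (Fin n) (Fin n) F).IsLowerTriangular) : X ∈ S * S := by
  obtain ⟨t, ht, ht1⟩ := exists_injective_prod_eq_one (F := F) hn
  have hd1 : ∏ i, (X : Matrix (Fin n) (Fin n) F) i i = 1 := by
    rw [← det_of_isTriangular hX, X.det_coe]
  have hd0 : ∀ i, (X : Matrix (Fin n) (Fin n) F) i i ≠ 0 := fun i hi =>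
    zero_ne_one ((Finset.prod_eq_zero (f := fun i => (X : Matrix (Fin n) (Fin n) F) i i)
      (Finset.mem_univ i) hi).symm.trans hd1)
  let Dt : SpecialLinearGroup (Fin n) F := ⟨diagonal t, by rw [det_diagonal, ht1]⟩
  let D : SpecialLinearGroup (Fin n) F :=
    ⟨diagonal fun i => t i / (X : Matrix (Fin n) (Fin n) F) i i, by
      rw [det_diagonal, Finset.prod_div_distrib, ht1, hd1, div_one]⟩
  let D' : SpecialLinearGroup (Fin n) F :=
    ⟨diagonal fun i => (X : Matrix (Fin n) (Fin n) F) i i / t i, by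
      rw [det_diagonal, Finset.prod_div_distrib, ht1, hd1, div_one]⟩
  have ht0 : ∀ i, t i ≠ 0 := fun i hi => by
    rw [Finset.prod_eq_zero (Finset.mem_univ i) hi] at ht1
    exact zero_ne_one ht1
  have hDD : D * D' = 1 := by
    refine Subtype.ext ?_
    change diagonal _ * diagonal _ = (1 : Matrix (Fin n) (Fin n) F)
    rw [diagonal_mul_diagonal, ← diagonal_one]
    congr 1
    funext i
    rw [div_mul_div_cancel₀ (hd0 i), div_self (ht0 i)]
  have hXD : ((X * D : SpecialLinearGroup (Fin n) F) : Matrix (Fin n) (Fin n) F) =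
      (X : Matrix (Fin n) (Fin n) F) *
        diagonal fun i => t i / (X : Matrix (Fin n) (Fin n) F) i i := rfl
  obtain ⟨h, hh⟩ := exists_conj_diagonal hn (X * D) Dt (by
    rw [hXD]
    exact hX.imp (fun h => h.mul (blockTriangular_diagonal _))
      fun h => h.mul (blockTriangular_diagonal _)) t ht
    (fun i => by rw [hXD, mul_diagonal, mul_div_cancel₀ _ (hd0 i)]) rfl
  refine Set.mem_mul.2 ⟨X * D, ?_, D', hdiag D' _ rfl, by rw [mul_assoc, hDD, mul_one]⟩
  rw [hh]
  exact hS h _ (hdiag Dt _ rfl)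

open Polynomial in
/-- A polynomial family of matrices passing through the identity generically admits an LU
decomposition. -/
theorem exists_eval_eq_lower_mul_upper (A : Matrix (Fin n) (Fin n) F[X]) (s₀ : F)
    (hA : ∀ i k, (A i k).eval s₀ = (1 : Matrix (Fin n) (Fin n) F) i k) :
    ∃ f : F[X], f ≠ 0 ∧ ∀ s, f.eval s ≠ 0 → ∃ L U : Matrix (Fin n) (Fin n) F,
      L.IsLowerTriangular ∧ U.IsUpperTriangular ∧ A.map (Polynomial.eval s) = L * U := by
  induction n with
  | zero => exact ⟨1, one_ne_zero, fun s _ => ⟨0, 0, fun i => i.elim0, fun i => i.elim0,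
      Matrix.ext fun i => i.elim0⟩⟩
  | succ n ih =>
    let B : Matrix (Fin n) (Fin n) F[X] := Matrix.of fun i k =>
      A 0 0 * A i.succ k.succ - A i.succ 0 * A 0 k.succ
    obtain ⟨f, hf0, hf⟩ := ih B fun i k => by
      simp only [B, of_apply, eval_sub, eval_mul, hA]
      simp [one_apply, Fin.succ_inj]
    have ha0 : A 0 0 ≠ 0 := fun h => by simpa [h] using hA 0 0
    refine ⟨A 0 0 * f, mul_ne_zero ha0 hf0, fun s hs => ?_⟩
    rw [eval_mul, mul_ne_zero_iff] at hs
    obtain ⟨ha, hfs⟩ := hs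
    obtain ⟨L, U, hL, hU, hLU⟩ := hf s hfs
    refine ⟨Matrix.of (Fin.cons (Fin.cons 1 0) fun i =>
        Fin.cons ((A i.succ 0).eval s / (A 0 0).eval s) fun k => L i k / (A 0 0).eval s),
      Matrix.of (Fin.cons (Fin.cons ((A 0 0).eval s) fun k => (A 0 k.succ).eval s) fun i =>
        Fin.cons 0 (U i)), ?_, ?_, ?_⟩
    · intro i k hik
      have hik : i < k := hik
      refine Fin.cases (fun hik => ?_) (fun k hik => ?_) k hik
      · exact absurd hik (Fin.not_lt_zero i)
      · refine Fin.cases (fun _ => rfl) (fun i hik => ?_) i hik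
        have h1 : L i k = 0 := hL (Fin.succ_lt_succ_iff.1 hik)
        simp [h1]
    · intro i k hik
      have hik : k < i := hik
      refine Fin.cases (fun hik => ?_) (fun i hik => ?_) i hik
      · exact absurd hik (Fin.not_lt_zero k)
      · refine Fin.cases (fun _ => rfl) (fun k hik => ?_) k hik
        exact hU (Fin.succ_lt_succ_iff.1 hik)
    · ext i k
      have hBik : ∀ i k, (A 0 0).eval s * (A i.succ k.succ).eval s -
          (A i.succ 0).eval s * (A 0 k.succ).eval s = ∑ l, L i l * U l k := fun i k => by
        have h1 := congrFun (congrFun hLU i) k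
        rw [mul_apply] at h1
        rw [← h1]
        simp [B]
      rw [mul_apply, Fin.sum_univ_succ]
      refine Fin.cases ?_ (fun i => ?_) i <;> refine Fin.cases ?_ (fun k => ?_) k
      · simp
      · simp
      · simp [ha]
      · simp only [map_apply, of_apply, Fin.cons_succ, Fin.cons_zero, div_mul_eq_mul_div,
          ← Finset.sum_div, ← hBik]
        field_simp
        ring

open Polynomial in
theorem exists_eq_lower_mul_upper_mul_lower [Infinite F] (g : Matrix (Fin n) (Fin n) F)
    (hg : g.det ≠ 0) : ∃ L U L' : Matrix (Fin n) (Fin n) F,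
      L.IsLowerTriangular ∧ U.IsUpperTriangular ∧ L'.IsLowerTriangular ∧ g = L * U * L' := by
  let H : Matrix (Fin n) (Fin n) F[X] :=
    Matrix.of fun i k => (1 - X) * C ((1 : Matrix (Fin n) (Fin n) F) i k) + X * C (g⁻¹ i k)
  let K : Matrix (Fin n) (Fin n) F[X] :=
    Matrix.of fun i k => (1 - X) * C (g i k) + X * C ((1 : Matrix (Fin n) (Fin n) F) i k)
  have hH : ∀ s, H.map (Polynomial.eval s) = (1 - s) • 1 + s • g⁻¹ := fun s => by
    ext i k
    simp [H, mul_comm s]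
  have hK : ∀ s, K.map (Polynomial.eval s) = (1 - s) • g + s • 1 := fun s => by
    ext i k
    simp [K, mul_comm s]
  have hKH : ∀ s, K.map (Polynomial.eval s) = g * H.map (Polynomial.eval s) := fun s => by
    rw [hH, hK, mul_add, Matrix.mul_smul, Matrix.mul_smul, mul_one,
      mul_nonsing_inv _ (isUnit_iff_ne_zero.2 hg)]
  obtain ⟨f₁, hf₁, h₁⟩ := exists_eval_eq_lower_mul_upper H 0 fun i k => by simp [H]
  obtain ⟨f₂, hf₂, h₂⟩ := exists_eval_eq_lower_mul_upper K 1 fun i k => by simp [K]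
  have hdet : ∀ s, H.det.eval s = (H.map (Polynomial.eval s)).det := fun s =>
    (evalRingHom s).map_det H
  have hdet0 : H.det ≠ 0 := fun h => by
    have h3 := hdet 0
    rw [hH, h] at h3
    simp at h3
  obtain ⟨s, hs⟩ : ∃ s, (f₁ * f₂ * H.det).eval s ≠ 0 := by
    by_contra! h
    exact mul_ne_zero (mul_ne_zero hf₁ hf₂) hdet0 (Polynomial.funext fun s => by rw [h, eval_zero])
  rw [eval_mul, eval_mul, mul_ne_zero_iff, mul_ne_zero_iff, hdet] at hs
  obtain ⟨⟨hs₁, hs₂⟩, hs₃⟩ := hs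
  obtain ⟨L₁, U₁, hL₁, hU₁, hLU₁⟩ := h₁ s hs₁
  obtain ⟨L₂, U₂, hL₂, hU₂, hLU₂⟩ := h₂ s hs₂
  rw [hLU₁, det_mul, mul_ne_zero_iff] at hs₃
  have hL₁d := isUnit_iff_ne_zero.2 hs₃.1
  have hU₁d := isUnit_iff_ne_zero.2 hs₃.2
  have := invertibleOfIsUnitDet _ hL₁d
  have := invertibleOfIsUnitDet _ hU₁d
  refine ⟨L₂, U₂ * U₁⁻¹, L₁⁻¹, hL₂, hU₂.mul (blockTriangular_inv_of_blockTriangular hU₁),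
    blockTriangular_inv_of_blockTriangular hL₁, ?_⟩
  have h3 := hKH s
  rw [hLU₁, hLU₂] at h3
  rw [← mul_assoc L₂, h3, ← mul_assoc g, mul_nonsing_inv_cancel_right _ _ hU₁d,
    mul_nonsing_inv_cancel_right _ _ hL₁d]

theorem Matrix.SpecialLinearGroup.exists_eq_lower_mul_upper_mul_lower [IsAlgClosed F] (hn : 0 < n)
    (g : SpecialLinearGroup (Fin n) F) : ∃ L U L' : SpecialLinearGroup (Fin n) F,
      (L : Matrix (Fin n) (Fin n) F).IsLowerTriangular ∧
      (U : Matrix (Fin n) (Fin n) F).IsUpperTriangular ∧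
      (L' : Matrix (Fin n) (Fin n) F).IsLowerTriangular ∧ g = L * U * L' := by
  have : Infinite F := IsAlgClosed.instInfinite
  have hg1 : (g : Matrix (Fin n) (Fin n) F).det = 1 := g.det_coe
  obtain ⟨L, U, L', hL, hU, hL', h⟩ := _root_.exists_eq_lower_mul_upper_mul_lower
    (g : Matrix (Fin n) (Fin n) F) (by rw [hg1]; exact one_ne_zero)
  rw [h, det_mul, det_mul] at hg1
  have hLU0 : L.det * U.det ≠ 0 := left_ne_zero_of_mul_eq_one hg1
  obtain ⟨α, hα⟩ := IsAlgClosed.exists_pow_nat_eq L.det⁻¹ hn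
  obtain ⟨β, hβ⟩ := IsAlgClosed.exists_pow_nat_eq U.det⁻¹ hn
  have hL0 := left_ne_zero_of_mul hLU0
  have hU0 := right_ne_zero_of_mul hLU0
  have hne : ∀ {x y : F}, x ^ n = y⁻¹ → y ≠ 0 → x ≠ 0 := by
    rintro x y hxy hy rfl
    rw [zero_pow hn.ne'] at hxy
    exact inv_ne_zero hy hxy.symm
  have hα0 := hne hα hL0
  have hβ0 := hne hβ hU0
  refine ⟨⟨α • L, ?_⟩, ⟨β • U, ?_⟩, ⟨(α * β)⁻¹ • L', ?_⟩, ?_, ?_, ?_, ?_⟩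
  · rw [det_smul, Fintype.card_fin, hα, inv_mul_cancel₀ hL0]
  · rw [det_smul, Fintype.card_fin, hβ, inv_mul_cancel₀ hU0]
  · rw [det_smul, Fintype.card_fin, inv_pow, mul_pow, hα, hβ, ← mul_inv, inv_inv, hg1]
  · exact fun i k hik => by
      change α * L i k = 0
      rw [hL hik, mul_zero]
  · exact fun i k hik => by
      change β * U i k = 0
      rw [hU hik, mul_zero]
  · exact fun i k hik => by
      change (α * β)⁻¹ * L' i k = 0
      rw [hL' hik, mul_zero]
  · refine Subtype.ext ?_
    change _ = (α • L) * (β • U) * ((α * β)⁻¹ • L')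
    rw [h, smul_mul_smul_comm, smul_mul_smul_comm, mul_inv_cancel₀ (mul_ne_zero hα0 hβ0), one_smul]

end Triangular

theorem conj_mem_pow {G : Type*} [Group G] {C : Set G} (hC : ∀ h, ∀ g ∈ C, h * g * h⁻¹ ∈ C) (k : ℕ) :
    ∀ h, ∀ g ∈ C ^ k, h * g * h⁻¹ ∈ C ^ k := by
  induction k with
  | zero =>
    intro h g hg
    rw [pow_zero, Set.mem_one] at hg ⊢
    rw [hg]
    group
  | succ k ih =>
    intro h g hg
    rw [pow_succ] at hg ⊢
    obtain ⟨a, ha, b, hb, rfl⟩ := Set.mem_mul.1 hg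
    exact Set.mem_mul.2 ⟨_, ih h a ha, _, hC h b hb, by group⟩

/-- Paper's Theorem B for `SL_n(F)`: if `u ≠ 1` is unipotent with fixed space of
dimension `ℓ` (so the class `C` of `u` has rank `n - ℓ`), then some power
`C^k = SL_n(F)` with `k·(n - ℓ) ≤ 288·(n - 1)`. -/
theorem covering_number_rank_bound_SL {F : Type*} [Field F] [IsAlgClosed F]
    (n : ℕ) (hn : 2 ≤ n)
    (u : Matrix.SpecialLinearGroup (Fin n) F)
    (hu : ((u : Matrix (Fin n) (Fin n) F) - 1) ^ n = 0) (hu1 : u ≠ 1)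
    (ℓ : ℕ)
    (hℓ : ℓ = Module.finrank F
      (LinearMap.ker (Matrix.toLin' ((u : Matrix (Fin n) (Fin n) F) - 1))))
    (C : Set (Matrix.SpecialLinearGroup (Fin n) F))
    (hC : C = {g | ∃ h : Matrix.SpecialLinearGroup (Fin n) F, g = h * u * h⁻¹}) :
    ∃ k : ℕ, 0 < k ∧ k * (n - ℓ) ≤ 288 * (n - 1) ∧ C ^ k = Set.univ := by
  obtain ⟨N, rfl⟩ : ∃ N, n = N + 1 := ⟨n - 1, by omega⟩
  have hrank := LinearMap.finrank_range_add_finrank_ker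
    (Matrix.toLin' ((u : Matrix (Fin (N + 1)) (Fin (N + 1)) F) - 1))
  rw [← hℓ, Module.finrank_fin_fun] at hrank
  have hr0 : Module.finrank F (LinearMap.range
      (Matrix.toLin' ((u : Matrix (Fin (N + 1)) (Fin (N + 1)) F) - 1))) ≠ 0 := by
    intro h
    rw [Submodule.finrank_eq_zero, LinearMap.range_eq_bot, LinearEquiv.map_eq_zero_iff,
      sub_eq_zero] at h
    exact hu1 (Subtype.ext h)
  generalize hr : Module.finrank F (LinearMap.range
      (Matrix.toLin' ((u : Matrix (Fin (N + 1)) (Fin (N + 1)) F) - 1))) = r at hrank hr0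
  obtain ⟨p, hp1, hp2, hp0⟩ : ∃ p, 2 * p ≤ r + 1 ∧ r ≤ 2 * p ∧ 0 < p :=
    ⟨(r + 1) / 2, by omega, by omega, by omega⟩
  obtain ⟨m, hm, hmp, hmp'⟩ : ∃ m, 2 ≤ m ∧ N ≤ m * p ∧ m * p ≤ N + 2 * p := by
    refine ⟨N / p + 2, Nat.le_add_left _ _, ?_, ?_⟩
    · have h1 := Nat.div_add_mod N p
      have h2 := Nat.mod_lt N hp0
      rw [add_mul, mul_comm (N / p)]
      omega
    · have h1 := Nat.div_mul_le_self N p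
      rw [add_mul]
      omega
  have hconj : ∀ h, ∀ g ∈ C, h * g * h⁻¹ ∈ C := by
    rw [hC]
    rintro h _ ⟨a, rfl⟩
    exact ⟨h * a, by group⟩
  have htri := triangular_mem_mul N.succ_pos (C ^ (4 * m)) (conj_mem_pow hconj _)
    fun D d => diagonal_mem_pow u hu C hC p m (by omega) hm hmp D d
  refine ⟨24 * m, by omega, ?_, Set.eq_univ_of_forall fun g => ?_⟩
  · have h1 : N + 1 - ℓ = r := by omega
    calc 24 * m * (N + 1 - ℓ) ≤ 24 * m * (2 * p) := by rw [h1]; gcongr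
      _ = 48 * (m * p) := by ring
      _ ≤ 288 * (N + 1 - 1) := by omega
  · obtain ⟨L, U, L', hL, hU, hL', rfl⟩ :=
      Matrix.SpecialLinearGroup.exists_eq_lower_mul_upper_mul_lower N.succ_pos g
    rw [show C ^ (24 * m) = C ^ (4 * m) * C ^ (4 * m) * (C ^ (4 * m) * C ^ (4 * m)) *
      (C ^ (4 * m) * C ^ (4 * m)) by simp only [← pow_add]; congr 1; ring]
    exact Set.mul_mem_mul (Set.mul_mem_mul (htri L (.inr hL)) (htri U (.inl hU)))
      (htri L' (.inr hL'))
end
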